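/- For each of the probabilities considered (the totality and infinitude probabilities of universal oracle machines, the infinity probability of universal monotone machines and of universal infinitary self-delimiting machines, the cofiniteness and computability probabilities of universal oracle machines, and the completeness probability of universal oracle machines), the Turing degree of the probability depends on the chosen universal machine: there exist universal machines U and V of the corresponding type such that the respective probabilities P_U and P_V have Turing-incomparable degrees. -/

import Mathlib

open scoped Classical
open MeasureTheory

namespace RandProb

/-- Cantor space: the space of infinite binary sequences. -/
abbrev Cantor := ℕ → Bool

/-! ### Oracle partial recursive functions, via codes -/

/-- Codes for partial recursive functions with access to an oracle `O : ℕ → ℕ`.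
These codes play the role of (oracle) Turing machines. -/
inductive CodeO : Type
  | zero : CodeO
  | succ : CodeO
  | left : CodeO
  | right : CodeO
  | oracle : CodeO
  | pair : CodeO → CodeO → CodeO
  | comp : CodeO → CodeO → CodeO
  | prec : CodeO → CodeO → CodeO
  | rfind' : CodeO → CodeO

/-- Evaluation of an oracle code with (total) oracle `O`. -/
def CodeO.eval (O : ℕ → ℕ) : CodeO → ℕ →. ℕ
  | .zero => pure 0
  | .succ => Nat.succ
  | .left => ↑fun n : ℕ => n.unpair.1
  | .right => ↑fun n : ℕ => n.unpair.2
  | .oracle => ↑fun n : ℕ => O n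
  | .pair cf cg => fun n => Nat.pair <$> cf.eval O n <*> cg.eval O n
  | .comp cf cg => fun n => cg.eval O n >>= cf.eval O
  | .prec cf cg =>
    Nat.unpaired fun a n =>
      n.rec (cf.eval O a) fun y IH => do
        let i ← IH
        cg.eval O (Nat.pair a (Nat.pair y i))
  | .rfind' cf =>
    Nat.unpaired fun a m =>
      (Nat.rfind fun n => (fun m => m = 0) <$> cf.eval O (Nat.pair a (n + m))).map (· + m)

/-- A canonical injective numbering of oracle codes. -/
def CodeO.encode : CodeO → ℕ
  | .zero => 0
  | .succ => 1
  | .left => 2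
  | .right => 3
  | .oracle => 4
  | .pair cf cg => 2 * (2 * Nat.pair cf.encode cg.encode) + 5
  | .comp cf cg => 2 * (2 * Nat.pair cf.encode cg.encode + 1) + 5
  | .prec cf cg => 2 * (2 * Nat.pair cf.encode cg.encode) + 6
  | .rfind' cf => 2 * (2 * cf.encode + 1) + 6

/-- The Turing jump of an oracle: the halting problem relative to `O`,
as a `{0,1}`-valued function. -/
noncomputable def jump (O : ℕ → ℕ) : ℕ → ℕ := fun e =>
  if ∃ c : CodeO, c.encode = e ∧ (c.eval O e).Dom then 1 else 0

/-- `iterJump n` is `∅^(n)`, the `n`-th iterate of the halting problem (as an oracle). -/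
noncomputable def iterJump : ℕ → ℕ → ℕ
  | 0 => fun _ => 0
  | n + 1 => jump (iterJump n)

/-- `S ⊆ ℕ` is computably enumerable relative to the oracle `O`. -/
def CeIn (O : ℕ → ℕ) (S : Set ℕ) : Prop := ∃ c : CodeO, S = {m | (c.eval O m).Dom}

/-- The left Dedekind cut of `α` (as a set of codes of rationals) is c.e. in `O`. -/
def LeftCeIn (O : ℕ → ℕ) (α : ℝ) : Prop :=
  CeIn O {m | ∃ q : ℚ, Encodable.encode q = m ∧ (q : ℝ) < α}

/-- The right Dedekind cut of `α` (as a set of codes of rationals) is c.e. in `O`. -/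
def RightCeIn (O : ℕ → ℕ) (α : ℝ) : Prop :=
  CeIn O {m | ∃ q : ℚ, Encodable.encode q = m ∧ α < (q : ℝ)}

/-! ### Martin-Löf randomness for real numbers -/

/-- The `i`-th component of a Martin-Löf test coded by the set `W ⊆ ℕ`:
the union of all open rational intervals whose codes are enumerated into the
`i`-th section of `W`. -/
def testSet (W : Set ℕ) (i : ℕ) : Set ℝ :=
  {x | ∃ p q : ℚ, Nat.pair i (Encodable.encode (p, q)) ∈ W ∧ (p : ℝ) < x ∧ x < (q : ℝ)}

/-- `α` is Martin-Löf random relative to the oracle `O`. -/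
def MLRandomIn (O : ℕ → ℕ) (α : ℝ) : Prop :=
  ∀ W : Set ℕ, CeIn O W →
    (∀ i, volume (testSet W i) ≤ ENNReal.ofReal ((2 : ℝ)⁻¹ ^ i)) →
    ∃ i, α ∉ testSet W i

/-- `α` is `n`-random: Martin-Löf random relative to `∅^(n-1)`. -/
def NRandom (n : ℕ) (α : ℝ) : Prop := MLRandomIn (iterJump (n - 1)) α

/-! ### The uniform measure on Cantor space -/

/-- The binary digits of a real number (meaningful on `[0,1)`). -/
noncomputable def digits (x : ℝ) : Cantor := fun n => decide (⌊x * 2 ^ (n + 1)⌋ % 2 = 1)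

/-- The uniform (Lebesgue) product measure on Cantor space, obtained as the
pushforward of Lebesgue measure on `[0,1)` under the binary-digit map. -/
noncomputable def mu : Measure Cantor :=
  Measure.map digits (volume.restrict (Set.Ico (0 : ℝ) 1))

/-- The uniform measure of a set of elements of Cantor space, as a real number. -/
noncomputable def muR (S : Set Cantor) : ℝ := (mu S).toReal

/-! ### Strings, prefixes and cylinders -/

/-- The length-`n` initial segment of `X ∈ 2^ω`, as a finite binary string. -/
def initSeg (X : Cantor) (n : ℕ) : List Bool := (List.range n).map X

/-- `⟦S⟧`: the elements of Cantor space having a prefix in the set of strings `S`. -/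
def cyl (S : Set (List Bool)) : Set Cantor := {X | ∃ n, initSeg X n ∈ S}

/-- A set of strings is prefix-free if none of its elements properly extends another. -/
def IsPrefixFree (S : Set (List Bool)) : Prop := ∀ σ ∈ S, ∀ τ ∈ S, σ <+: τ → σ = τ

/-- A set of strings is upward closed if it is closed under taking extensions. -/
def UpClosed (S : Set (List Bool)) : Prop := ∀ σ ∈ S, ∀ τ, σ <+: τ → τ ∈ S

/-- Two strings are compatible if one is a prefix of the other. -/
def Compatible (σ τ : List Bool) : Prop := σ <+: τ ∨ τ <+: σ

/-! ### Oracle machines -/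

/-- An element of Cantor space viewed as a `{0,1}`-valued oracle. -/
def oX (X : Cantor) : ℕ → ℕ := fun n => cond (X n) 1 0

/-- `evalO X c n`: the (possibly divergent) output of the oracle machine `c`
on input `n` with oracle `X`. -/
def evalO (X : Cantor) (c : CodeO) (n : ℕ) : Part ℕ := c.eval (oX X) n

/-- The oracle obtained by writing the string `ρ` before the bits of `X`. -/
def prepend (ρ : List Bool) (X : Cantor) : Cantor := fun n =>
  if n < ρ.length then ρ.getD n false else X (n - ρ.length)

/-- `X ∈ 2^ω` extends the finite string `ρ`. -/
def Extends (X : Cantor) (ρ : List Bool) : Prop := initSeg X ρ.length = ρ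

/-- `u` is a universal oracle machine: some effective, prefix-free translation
`c ↦ σ_c` satisfies `u(σ_c * X, n) ≃ c(X, n)` for all machines `c`. -/
def UniversalOM (u : CodeO) : Prop :=
  ∃ σ : CodeO → List Bool,
    (∃ f : ℕ → ℕ, Computable f ∧ ∀ c : CodeO, f c.encode = Encodable.encode (σ c)) ∧
    IsPrefixFree (Set.range σ) ∧
    ∀ (c : CodeO) (X : Cantor) (n : ℕ), evalO (prepend (σ c) X) u n = evalO X c n

/-- `TOT(c)`: the oracles `X` such that the function `c(X)` is total. -/
def TOT (c : CodeO) : Set Cantor := {X | ∀ n, (evalO X c n).Dom}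

/-- The domain of the partial function `c(X)`. -/
def domSet (c : CodeO) (X : Cantor) : Set ℕ := {n | (evalO X c n).Dom}

/-- The range of the partial function `c(X)`. -/
def ranSet (c : CodeO) (X : Cantor) : Set ℕ := {v | ∃ n, v ∈ evalO X c n}

/-- `INF(c)`: the oracles `X` such that `c(X)` has infinite domain. -/
def INF (c : CodeO) : Set Cantor := {X | (domSet c X).Infinite}

/-- `COF(c)`: the oracles `X` such that `c(X)` has cofinite domain. -/
def COF (c : CodeO) : Set Cantor := {X | (domSet c X)ᶜ.Finite}

/-- `COM(c)`: the oracles `X` such that `c(X)` has computable domain. -/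
def COM (c : CodeO) : Set Cantor := {X | ComputablePred fun n => n ∈ domSet c X}

/-- The characteristic function of a set of naturals. -/
noncomputable def chi (A : Set ℕ) : ℕ → ℕ := fun n => if n ∈ A then 1 else 0

/-- Turing reducibility between sets of naturals. -/
def TuringLEs (B A : Set ℕ) : Prop := ∃ c : CodeO, ∀ n, c.eval (chi A) n = Part.some (chi B n)

/-- The halting problem `∅'` as a set of naturals. -/
noncomputable def HaltingSet : Set ℕ := {e | iterJump 1 e = 1}

/-- `COMPL(c)`: the oracles `X` such that the domain of `c(X)` computes the halting problem. -/
noncomputable def COMPL (c : CodeO) : Set Cantor := {X | TuringLEs HaltingSet (domSet c X)}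

/-- Turing reducibility between total functions on ℕ. -/
def TuringLEf (f g : ℕ → ℕ) : Prop := ∃ c : CodeO, ∀ n, c.eval g n = Part.some (f n)

/-- A real number viewed as an oracle, via its binary expansion. -/
noncomputable def realOracle (α : ℝ) : ℕ → ℕ := oX (digits α)

/-- Two reals have Turing-incomparable degrees. -/
noncomputable def TIncompReal (α β : ℝ) : Prop :=
  ¬ TuringLEf (realOracle α) (realOracle β) ∧ ¬ TuringLEf (realOracle β) (realOracle α)

/-! ### Arithmetical hierarchy -/

/-- Evaluation with the trivial (empty) oracle: ordinary partial recursion. -/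
def eval0 (c : CodeO) : ℕ →. ℕ := c.eval fun _ => 0

/-- `SigmaNumIdx n c` is the `Σ^0_{n+1}` subset of `ℕ` with index `c`. -/
def SigmaNumIdx : ℕ → CodeO → Set ℕ
  | 0, c => {m | (eval0 c m).Dom}
  | n + 1, c => {m | ∃ k, Nat.pair m k ∉ SigmaNumIdx n c}

/-- `S ⊆ ℕ` is `Σ^0_n` (intended for `n ≥ 1`). -/
def SigmaN (n : ℕ) (S : Set ℕ) : Prop := ∃ c : CodeO, S = SigmaNumIdx (n - 1) c

/-- The set of codes of the elements of a set of binary strings. -/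
def strCodes (S : Set (List Bool)) : Set ℕ := {m | ∃ σ ∈ S, Encodable.encode σ = m}

/-- A set of binary strings is `Σ^0_n`. -/
def SigmaStr (n : ℕ) (S : Set (List Bool)) : Prop := SigmaN n (strCodes S)

/-- A set of binary strings is `Π^0_n`: its complement is `Σ^0_n`. -/
def PiStr (n : ℕ) (S : Set (List Bool)) : Prop := SigmaStr n Sᶜ

/-- A set of binary strings is c.e. relative to the oracle `O`. -/
def CeStrIn (O : ℕ → ℕ) (S : Set (List Bool)) : Prop := CeIn O (strCodes S)

/-- `SigmaClassIdx n c m` is the `Σ^0_{n+1}` class of elements of Cantor space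
with index `c` and parameter `m`. -/
def SigmaClassIdx : ℕ → CodeO → ℕ → Set Cantor
  | 0, c, m => {X | (evalO X c m).Dom}
  | n + 1, c, m => {X | ∃ k, X ∉ SigmaClassIdx n c (Nat.pair m k)}

/-! ### Monotone machines -/

/-- A monotone machine: a partial computable, monotone map on finite binary strings. -/
structure MonoMachine where
  f : List Bool →. List Bool
  partrec : Partrec f
  mono : ∀ ⦃σ τ a b : List Bool⦄, σ <+: τ → a ∈ f σ → b ∈ f τ → a <+: b

/-- The oracles `X` such that the output of the monotone machine on `X` is infinite. -/
def MonoINF (M : MonoMachine) : Set Cantor :=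
  {X | ∀ k, ∃ n a, a ∈ M.f (initSeg X n) ∧ k ≤ a.length}

/-- The `k`-th bit of the output `M(X)` of a monotone machine is `b`. -/
def MonoMachine.hasBit (M : MonoMachine) (X : Cantor) (k : ℕ) (b : Bool) : Prop :=
  ∃ n a, a ∈ M.f (initSeg X n) ∧ a[k]? = some b

/-- `U` is a universal monotone machine. -/
def UniversalMono (U : MonoMachine) : Prop :=
  ∃ (M : ℕ → MonoMachine) (σ : ℕ → List Bool),
    Partrec₂ (fun (e : ℕ) (τ : List Bool) => (M e).f τ) ∧
    (∀ V : MonoMachine, ∃ e, (M e).f = V.f) ∧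
    Computable σ ∧ IsPrefixFree (Set.range σ) ∧
    ∀ e τ, U.f (σ e ++ τ) = (M e).f τ

/-! ### Infinitary self-delimiting machines -/

/-- Chaitin's infinitary self-delimiting machines: `f σ n` is the `n`-th approximation
of the output on program `σ` (`none` meaning divergence); the convergence relation is
decidable, approximations are monotone, and machines are self-delimiting. -/
structure InfMachine where
  f : List Bool → ℕ → Option (List Bool)
  computable : Computable₂ f
  mono : ∀ σ m n a, n < m → f σ m = some a → ∃ b, f σ n = some b ∧ b <+: a
  sd : ∀ σ τ n a, f σ n = some a → f (σ ++ τ) n = some a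

/-- `M^∞(σ)↓`: all approximations converge. -/
def InfMachine.domInf (M : InfMachine) (σ : List Bool) : Prop := ∀ n, M.f σ n ≠ none

/-- The domain of `M^∞`. -/
def InfMachine.DOM (M : InfMachine) : Set (List Bool) := {σ | M.domInf σ}

/-- The output `M^∞(σ)` is infinite (a stream). -/
def InfMachine.outInf (M : InfMachine) (σ : List Bool) : Prop :=
  ∀ k, ∃ n a, M.f σ n = some a ∧ k ≤ a.length

/-- `FIN(M^∞)`: programs in the domain with finite output. -/
def InfMachine.FIN (M : InfMachine) : Set (List Bool) := {σ | M.domInf σ ∧ ¬ M.outInf σ}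

/-- `INF(M^∞)`: programs in the domain with infinite output. -/
def InfMachine.INF (M : InfMachine) : Set (List Bool) := {σ | M.domInf σ ∧ M.outInf σ}

/-- The `k`-th bit of the output `M^∞(σ)` is `b`. -/
def InfMachine.hasBit (M : InfMachine) (σ : List Bool) (k : ℕ) (b : Bool) : Prop :=
  ∃ n a, M.f σ n = some a ∧ a[k]? = some b

/-- The domain of the prefix-free machine `M^*`: minimal strings in the domain of `M^∞`. -/
def InfMachine.DOMstar (M : InfMachine) : Set (List Bool) :=
  {σ | M.domInf σ ∧ ∀ τ, τ <+: σ → τ ≠ σ → ¬ M.domInf τ}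

/-- Programs whose output is a stream with a tail of 1s. -/
def InfMachine.COFout (M : InfMachine) : Set (List Bool) :=
  {σ | M.domInf σ ∧ M.outInf σ ∧ ∃ t, ∀ k, t ≤ k → M.hasBit σ k true}

/-- `A^∞(σ) ≃ B^∞(τ)`: both converge or both diverge, with equal outputs. -/
def InfAgree (A : InfMachine) (σ : List Bool) (B : InfMachine) (τ : List Bool) : Prop :=
  (A.domInf σ ↔ B.domInf τ) ∧ (A.domInf σ → ∀ k b, (A.hasBit σ k b ↔ B.hasBit τ k b))

/-- `U` is a universal infinitary self-delimiting machine. -/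
def UniversalInf (U : InfMachine) : Prop :=
  ∃ (M : ℕ → InfMachine) (σ : ℕ → List Bool),
    Computable (fun p : ℕ × List Bool × ℕ => (M p.1).f p.2.1 p.2.2) ∧
    (∀ V : InfMachine, ∃ e, ∀ τ, InfAgree (M e) τ V τ) ∧
    Computable σ ∧ IsPrefixFree (Set.range σ) ∧
    ∀ e τ, InfAgree U (σ e ++ τ) (M e) τ

end RandProb

section
namespace RandProb

/-! ### Automation for primitive recursive functions -/

section fp
variable {α β γ δ : Type} [Primcodable α] [Primcodable β] [Primcodable γ] [Primcodable δ]
attribute [fun_prop] Primrec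
attribute [fun_prop] Primrec.id Primrec.const Primrec.comp

@[fun_prop] theorem fp_fst {f : α → β × γ} (hf : Primrec f) : Primrec fun x => (f x).1 :=
  Primrec.fst.comp hf
@[fun_prop] theorem fp_snd {f : α → β × γ} (hf : Primrec f) : Primrec fun x => (f x).2 :=
  Primrec.snd.comp hf
@[fun_prop] theorem fp_mk {f : α → β} {g : α → γ} (hf : Primrec f) (hg : Primrec g) :
    Primrec fun x => (f x, g x) := Primrec.pair hf hg
@[fun_prop] theorem fp_add {f g : α → ℕ} (hf : Primrec f) (hg : Primrec g) :
    Primrec fun x => f x + g x := Primrec.nat_add.comp hf hg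
@[fun_prop] theorem fp_sub {f g : α → ℕ} (hf : Primrec f) (hg : Primrec g) :
    Primrec fun x => f x - g x := Primrec.nat_sub.comp hf hg
@[fun_prop] theorem fp_mul {f g : α → ℕ} (hf : Primrec f) (hg : Primrec g) :
    Primrec fun x => f x * g x := Primrec.nat_mul.comp hf hg
@[fun_prop] theorem fp_div {f g : α → ℕ} (hf : Primrec f) (hg : Primrec g) :
    Primrec fun x => f x / g x := Primrec.nat_div.comp hf hg
@[fun_prop] theorem fp_mod {f g : α → ℕ} (hf : Primrec f) (hg : Primrec g) :
    Primrec fun x => f x % g x := Primrec.nat_mod.comp hf hg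
@[fun_prop] theorem fp_max {f g : α → ℕ} (hf : Primrec f) (hg : Primrec g) :
    Primrec fun x => max (f x) (g x) := Primrec.nat_max.comp hf hg
@[fun_prop] theorem fp_min {f g : α → ℕ} (hf : Primrec f) (hg : Primrec g) :
    Primrec fun x => min (f x) (g x) := Primrec.nat_min.comp hf hg
@[fun_prop] theorem fp_natpair {f g : α → ℕ} (hf : Primrec f) (hg : Primrec g) :
    Primrec fun x => Nat.pair (f x) (g x) := Primrec₂.natPair.comp hf hg
@[fun_prop] theorem fp_unpair {f : α → ℕ} (hf : Primrec f) :
    Primrec fun x => Nat.unpair (f x) := Primrec.unpair.comp hf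
@[fun_prop] theorem fp_rec {f : α → ℕ} {g : α → β} {h : α → ℕ → β → β} (hf : Primrec f)
    (hg : Primrec g) (hh : Primrec fun p : α × ℕ × β => h p.1 p.2.1 p.2.2) :
    Primrec fun x => (Nat.rec (g x) (fun n ih => h x n ih) (f x) : β) :=
  Primrec.nat_rec' hf hg (h := fun a p => h a p.1 p.2) hh
@[fun_prop] theorem fp_pow {f g : α → ℕ} (hf : Primrec f) (hg : Primrec g) :
    Primrec fun x => f x ^ g x := by
  have : Primrec fun x => (Nat.rec 1 (fun _ ih => ih * f x) (g x) : ℕ) := by fun_prop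
  refine this.of_eq fun x => ?_
  induction g x with
  | zero => rfl
  | succ n ih => simp only [pow_succ]; rw [← ih]

@[fun_prop] theorem fp_lt {f g : α → ℕ} (hf : Primrec f) (hg : Primrec g) :
    Primrec fun x => decide (f x < g x) := (Primrec.nat_lt.comp hf hg).decide
@[fun_prop] theorem fp_le {f g : α → ℕ} (hf : Primrec f) (hg : Primrec g) :
    Primrec fun x => decide (f x ≤ g x) := (Primrec.nat_le.comp hf hg).decide
@[fun_prop] theorem fp_eq [DecidableEq β] {f g : α → β} (hf : Primrec f) (hg : Primrec g) :
    Primrec fun x => decide (f x = g x) := (Primrec.eq.comp hf hg).decide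
@[fun_prop] theorem fp_band {f g : α → Bool} (hf : Primrec f) (hg : Primrec g) :
    Primrec fun x => f x && g x := Primrec.and.comp hf hg
@[fun_prop] theorem fp_bor {f g : α → Bool} (hf : Primrec f) (hg : Primrec g) :
    Primrec fun x => f x || g x := Primrec.or.comp hf hg
@[fun_prop] theorem fp_bnot {f : α → Bool} (hf : Primrec f) :
    Primrec fun x => !f x := Primrec.not.comp hf
@[fun_prop] theorem fp_cond {c : α → Bool} {f g : α → β} (hc : Primrec c) (hf : Primrec f)
    (hg : Primrec g) : Primrec fun x => cond (c x) (f x) (g x) := Primrec.cond hc hf hg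
@[fun_prop] theorem fp_ite {c : α → Prop} [DecidablePred c] {f g : α → β}
    (hc : Primrec fun x => decide (c x)) (hf : Primrec f)
    (hg : Primrec g) : Primrec fun x => if c x then f x else g x :=
  (Primrec.cond hc hf hg).of_eq fun x => by by_cases h : c x <;> simp [h]
@[fun_prop] theorem fp_dect {c : α → Bool} (hc : Primrec c) : Primrec fun x => decide (c x = true) :=
  hc.of_eq fun x => by simp
@[fun_prop] theorem fp_dand {c d : α → Prop} [DecidablePred c] [DecidablePred d]
    (hc : Primrec fun x => decide (c x)) (hd : Primrec fun x => decide (d x)) :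
    Primrec fun x => decide (c x ∧ d x) :=
  (Primrec.and.comp hc hd).of_eq fun x => by simp
@[fun_prop] theorem fp_dor {c d : α → Prop} [DecidablePred c] [DecidablePred d]
    (hc : Primrec fun x => decide (c x)) (hd : Primrec fun x => decide (d x)) :
    Primrec fun x => decide (c x ∨ d x) :=
  (Primrec.or.comp hc hd).of_eq fun x => by simp
@[fun_prop] theorem fp_dnot {c : α → Prop} [DecidablePred c]
    (hc : Primrec fun x => decide (c x)) :
    Primrec fun x => decide (¬ c x) :=
  (Primrec.not.comp hc).of_eq fun x => by simp

@[fun_prop] theorem fp_some {f : α → β} (hf : Primrec f) : Primrec fun x => some (f x) :=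
  Primrec.option_some.comp hf
@[fun_prop] theorem fp_isSome {f : α → Option β} (hf : Primrec f) : Primrec fun x => (f x).isSome :=
  Primrec.option_isSome.comp hf
@[fun_prop] theorem fp_isNone {f : α → Option β} (hf : Primrec f) : Primrec fun x => (f x).isNone :=
  (Primrec.not.comp (Primrec.option_isSome.comp hf)).of_eq fun x => by cases f x <;> rfl
@[fun_prop] theorem fp_getD {f : α → Option β} {g : α → β} (hf : Primrec f) (hg : Primrec g) :
    Primrec fun x => (f x).getD (g x) := Primrec.option_getD.comp hf hg
@[fun_prop] theorem fp_omap {f : α → Option β} {g : α → β → γ} (hf : Primrec f)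
    (hg : Primrec fun p : α × β => g p.1 p.2) :
    Primrec fun x => (f x).map (g x) := Primrec.option_map hf hg
@[fun_prop] theorem fp_obind {f : α → Option β} {g : α → β → Option γ} (hf : Primrec f)
    (hg : Primrec fun p : α × β => g p.1 p.2) :
    Primrec fun x => (f x).bind (g x) := Primrec.option_bind hf hg
@[fun_prop] theorem fp_encode {f : α → β} (hf : Primrec f) : Primrec fun x => Encodable.encode (f x) :=
  Primrec.encode.comp hf
@[fun_prop] theorem fp_decode {f : α → ℕ} (hf : Primrec f) :
    Primrec fun x => (Encodable.decode (f x) : Option β) :=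
  Primrec.decode.comp hf

@[fun_prop] theorem fp_cons {f : α → β} {g : α → List β} (hf : Primrec f) (hg : Primrec g) :
    Primrec fun x => (f x) :: (g x) := Primrec.list_cons.comp hf hg
@[fun_prop] theorem fp_append {f g : α → List β} (hf : Primrec f) (hg : Primrec g) :
    Primrec fun x => f x ++ g x := Primrec.list_append.comp hf hg
@[fun_prop] theorem fp_length {f : α → List β} (hf : Primrec f) :
    Primrec fun x => (f x).length := Primrec.list_length.comp hf
@[fun_prop] theorem fp_range {f : α → ℕ} (hf : Primrec f) :
    Primrec fun x => List.range (f x) := Primrec.list_range.comp hf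
@[fun_prop] theorem fp_get {f : α → List β} {g : α → ℕ} (hf : Primrec f) (hg : Primrec g) :
    Primrec fun x => (f x)[g x]? := Primrec.list_getElem?.comp hf hg
@[fun_prop] theorem fp_take {f : α → List β} {g : α → ℕ} (hf : Primrec f) (hg : Primrec g) :
    Primrec fun x => (f x).take (g x) := Primrec.list_take.comp hg hf
@[fun_prop] theorem fp_drop {f : α → List β} {g : α → ℕ} (hf : Primrec f) (hg : Primrec g) :
    Primrec fun x => (f x).drop (g x) := Primrec.list_drop.comp hg hf
@[fun_prop] theorem fp_lgetD {f : α → List β} {g : α → ℕ} {d : α → β} (hf : Primrec f)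
    (hg : Primrec g) (hd : Primrec d) : Primrec fun x => (f x).getD (g x) (d x) :=
  (fp_getD (fp_get hf hg) hd).of_eq fun x => by simp
@[fun_prop] theorem fp_map {f : α → List β} {g : α → β → γ} (hf : Primrec f)
    (hg : Primrec fun p : α × β => g p.1 p.2) :
    Primrec fun x => (f x).map (g x) := Primrec.list_map hf hg
@[fun_prop] theorem fp_flatMap {f : α → List β} {g : α → β → List γ} (hf : Primrec f)
    (hg : Primrec fun p : α × β => g p.1 p.2) :
    Primrec fun x => (f x).flatMap (g x) := Primrec.list_flatMap hf hg
@[fun_prop] theorem fp_foldr {f : α → List β} {b : α → γ} {g : α → β → γ → γ} (hf : Primrec f)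
    (hb : Primrec b) (hg : Primrec fun p : α × β × γ => g p.1 p.2.1 p.2.2) :
    Primrec fun x => (f x).foldr (fun y z => g x y z) (b x) :=
  Primrec.list_foldr hf hb (h := fun a p => g a p.1 p.2) hg
@[fun_prop] theorem fp_foldl {f : α → List β} {b : α → γ} {g : α → γ → β → γ} (hf : Primrec f)
    (hb : Primrec b) (hg : Primrec fun p : α × γ × β => g p.1 p.2.1 p.2.2) :
    Primrec fun x => (f x).foldl (fun y z => g x y z) (b x) :=
  Primrec.list_foldl hf hb (h := fun a p => g a p.1 p.2) hg
@[fun_prop] theorem fp_filter {f : α → List β} {g : α → β → Bool} (hf : Primrec f)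
    (hg : Primrec fun p : α × β => g p.1 p.2) :
    Primrec fun x => (f x).filter (g x) := by
  have : Primrec fun x => (f x).foldr (fun y z => cond (g x y) (y :: z) z) [] := by fun_prop
  refine this.of_eq fun x => ?_
  induction f x with
  | nil => rfl
  | cons a l ih => simp only [List.foldr_cons, ih, List.filter_cons]; cases g x a <;> rfl
@[fun_prop] theorem fp_all {f : α → List β} {g : α → β → Bool} (hf : Primrec f)
    (hg : Primrec fun p : α × β => g p.1 p.2) :
    Primrec fun x => (f x).all (g x) := by
  have : Primrec fun x => (f x).foldr (fun y z => (g x y) && z) true := by fun_prop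
  refine this.of_eq fun x => ?_
  induction f x with
  | nil => rfl
  | cons a l ih => simp only [List.foldr_cons, ih, List.all_cons]
@[fun_prop] theorem fp_any {f : α → List β} {g : α → β → Bool} (hf : Primrec f)
    (hg : Primrec fun p : α × β => g p.1 p.2) :
    Primrec fun x => (f x).any (g x) := by
  have : Primrec fun x => (f x).foldr (fun y z => (g x y) || z) false := by fun_prop
  refine this.of_eq fun x => ?_
  induction f x with
  | nil => rfl
  | cons a l ih => simp only [List.foldr_cons, ih, List.any_cons]
@[fun_prop] theorem fp_find {f : α → List β} {g : α → β → Bool} (hf : Primrec f)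
    (hg : Primrec fun p : α × β => g p.1 p.2) :
    Primrec fun x => (f x).find? (g x) := by
  have : Primrec fun x => (f x).foldr (fun y z => cond (g x y) (some y) z) none := by fun_prop
  refine this.of_eq fun x => ?_
  induction f x with
  | nil => rfl
  | cons a l ih => simp only [List.foldr_cons, ih, List.find?_cons]; cases g x a <;> rfl
@[fun_prop] theorem fp_replicate {f : α → ℕ} {g : α → β} (hf : Primrec f) (hg : Primrec g) :
    Primrec fun x => List.replicate (f x) (g x) := by
  have : Primrec fun x => (List.range (f x)).map fun _ => g x := by fun_prop
  refine this.of_eq fun x => ?_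
  simp
@[fun_prop] theorem fp_dropLast {f : α → List β} (hf : Primrec f) :
    Primrec fun x => (f x).dropLast := by
  have : Primrec fun x => (f x).take ((f x).length - 1) := by fun_prop
  exact this.of_eq fun x => (List.dropLast_eq_take).symm
@[fun_prop] theorem fp_reverse {f : α → List β} (hf : Primrec f) :
    Primrec fun x => (f x).reverse := Primrec.list_reverse.comp hf

theorem fp₂ {f : α → β → γ} (h : Primrec₂ f) : Primrec fun p : α × β => f p.1 p.2 := h
end fp

end RandProb

end

section
namespace RandProb

/-! ### Module A: oracle computations -/

/-- Recursion used in `prec`. -/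
def precR (f : ℕ → Part ℕ) (g : ℕ → Part ℕ) (a n : ℕ) : Part ℕ :=
  n.rec (f a) fun y IH => IH.bind fun i => g (Nat.pair a (Nat.pair y i))

theorem precR_succ (f g : ℕ → Part ℕ) (a n : ℕ) :
    precR f g a (n+1) = (precR f g a n).bind fun i => g (Nat.pair a (Nat.pair n i)) := rfl

def rfR (f : ℕ → Part ℕ) (a m : ℕ) : Part ℕ :=
  (Nat.rfind fun n => (fun m => m = 0) <$> f (Nat.pair a (n + m))).map (· + m)

theorem mem_rfR (f : ℕ → Part ℕ) (a m v : ℕ) : v ∈ rfR f a m ↔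
    ∃ n, v = n + m ∧ 0 ∈ f (Nat.pair a (n+m)) ∧
      ∀ j < n, ∃ w, w ≠ 0 ∧ w ∈ f (Nat.pair a (j+m)) := by
  unfold rfR
  constructor
  · intro h
    obtain ⟨n, h', rfl⟩ := (Part.mem_map_iff _).1 h
    obtain ⟨h1, h2⟩ := Nat.mem_rfind.1 h'
    refine ⟨n, rfl, ?_, ?_⟩
    · obtain ⟨w, hw, h0⟩ := (Part.mem_map_iff _).1 h1
      rwa [of_decide_eq_true h0] at hw
    · intro j hj
      obtain ⟨w, hw, h0⟩ := (Part.mem_map_iff _).1 (h2 hj)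
      exact ⟨w, of_decide_eq_false h0, hw⟩
  · rintro ⟨n, rfl, h1, h2⟩
    refine (Part.mem_map_iff _).2 ⟨n, Nat.mem_rfind.2 ⟨?_, ?_⟩, rfl⟩
    · exact (Part.mem_map_iff _).2 ⟨0, h1, decide_eq_true rfl⟩
    · intro j hj
      obtain ⟨w, h0, hw⟩ := h2 j hj
      exact (Part.mem_map_iff _).2 ⟨w, hw, decide_eq_false h0⟩

/-- Evaluation with a partial oracle. -/
def CodeO.evalP (O : ℕ → Part ℕ) : CodeO → ℕ → Part ℕ
  | .zero => fun _ => Part.some 0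
  | .succ => fun n => Part.some (n+1)
  | .left => fun n => Part.some n.unpair.1
  | .right => fun n => Part.some n.unpair.2
  | .oracle => O
  | .pair cf cg => fun n => (cf.evalP O n).bind fun x => (cg.evalP O n).map fun y => Nat.pair x y
  | .comp cf cg => fun n => (cg.evalP O n).bind (cf.evalP O)
  | .prec cf cg => fun n => precR (cf.evalP O) (cg.evalP O) n.unpair.1 n.unpair.2
  | .rfind' cf => fun n => rfR (cf.evalP O) n.unpair.1 n.unpair.2

theorem evalP_pair (O : ℕ → Part ℕ) (f g : CodeO) (n : ℕ) :
    (CodeO.pair f g).evalP O n = (f.evalP O n).bind fun x => (g.evalP O n).map fun y => Nat.pair x y := rfl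
theorem evalP_comp (O : ℕ → Part ℕ) (f g : CodeO) (n : ℕ) :
    (CodeO.comp f g).evalP O n = (g.evalP O n).bind (f.evalP O) := rfl
theorem evalP_prec (O : ℕ → Part ℕ) (f g : CodeO) (n : ℕ) :
    (CodeO.prec f g).evalP O n = precR (f.evalP O) (g.evalP O) n.unpair.1 n.unpair.2 := rfl
theorem evalP_rf (O : ℕ → Part ℕ) (f : CodeO) (n : ℕ) :
    (CodeO.rfind' f).evalP O n = rfR (f.evalP O) n.unpair.1 n.unpair.2 := rfl

theorem evalP_total (O : ℕ → ℕ) (c : CodeO) : c.evalP (fun n => Part.some (O n)) = c.eval O := by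
  induction c with
  | zero => rfl
  | succ => rfl
  | left => rfl
  | right => rfl
  | oracle => rfl
  | pair cf cg h1 h2 =>
    funext n
    rw [evalP_pair, h1, h2]
    exact (Part.bind_map _ _ _).symm
  | comp cf cg h1 h2 => funext n; rw [evalP_comp, h1, h2]; rfl
  | prec cf cg h1 h2 => funext n; rw [evalP_prec, h1, h2]; rfl
  | rfind' cf h1 => funext n; rw [evalP_rf, h1]; rfl

theorem evalO_eq (X : Cantor) (c : CodeO) (n : ℕ) :
    evalO X c n = c.evalP (fun n => Part.some (oX X n)) n := by
  rw [evalP_total]; rfl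

theorem mem_pair {f g : Part ℕ} {v : ℕ} : v ∈ (f.bind fun x => g.map fun y => Nat.pair x y) ↔
    ∃ x ∈ f, ∃ y ∈ g, Nat.pair x y = v := by
  simp

theorem evalP_mono {O O' : ℕ → Part ℕ} (h : ∀ n v, v ∈ O n → v ∈ O' n) (c : CodeO) :
    ∀ n v, v ∈ c.evalP O n → v ∈ c.evalP O' n := by
  induction c with
  | zero => exact fun n v h => h
  | succ => exact fun n v h => h
  | left => exact fun n v h => h
  | right => exact fun n v h => h
  | oracle => exact h
  | pair cf cg h1 h2 =>
    intro n v
    simp only [evalP_pair, mem_pair]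
    rintro ⟨x, hx, y, hy, rfl⟩
    exact ⟨x, h1 _ _ hx, y, h2 _ _ hy, rfl⟩
  | comp cf cg h1 h2 =>
    intro n v
    simp only [evalP_comp, Part.mem_bind_iff]
    rintro ⟨x, hx, y⟩
    exact ⟨x, h2 _ _ hx, h1 _ _ y⟩
  | prec cf cg h1 h2 =>
    intro n
    simp only [evalP_prec]
    induction n.unpair.2 with
    | zero => exact h1 _
    | succ k ih =>
      intro v
      simp only [precR_succ, Part.mem_bind_iff]
      rintro ⟨x, hx, y⟩
      exact ⟨x, ih _ hx, h2 _ _ y⟩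
  | rfind' cf h1 =>
    intro n v
    simp only [evalP_rf, mem_rfR]
    rintro ⟨k, rfl, h0, hk⟩
    refine ⟨k, rfl, h1 _ _ h0, fun j hj => ?_⟩
    obtain ⟨w, hw, h⟩ := hk j hj
    exact ⟨w, hw, h1 _ _ h⟩

/-- restriction of a partial oracle -/
def resO (O : ℕ → Part ℕ) (m : ℕ) : ℕ → Part ℕ := fun n => if n < m then O n else Part.none

theorem resO_mono (O : ℕ → Part ℕ) {m m' : ℕ} (h : m ≤ m') : ∀ n v, v ∈ resO O m n → v ∈ resO O m' n := by
  intro n v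
  simp only [resO]
  split_ifs <;> simp
  omega

theorem resO_le (O : ℕ → Part ℕ) {m : ℕ} : ∀ n v, v ∈ resO O m n → v ∈ O n := by
  intro n v
  simp only [resO]
  split_ifs <;> simp

theorem evalP_compact (O : ℕ → Part ℕ) (c : CodeO) :
    ∀ n v, v ∈ c.evalP O n → ∃ m, v ∈ c.evalP (resO O m) n := by
  have up : ∀ (c : CodeO) {m m' : ℕ} (h : m ≤ m') (n v : ℕ), v ∈ c.evalP (resO O m) n →
      v ∈ c.evalP (resO O m') n := fun c m m' h => evalP_mono (resO_mono O h) c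
  induction c with
  | zero => exact fun n v h => ⟨0, h⟩
  | succ => exact fun n v h => ⟨0, h⟩
  | left => exact fun n v h => ⟨0, h⟩
  | right => exact fun n v h => ⟨0, h⟩
  | oracle => exact fun n v h => ⟨n+1, by simpa [CodeO.evalP, resO] using h⟩
  | pair cf cg h1 h2 =>
    intro n v
    simp only [evalP_pair, mem_pair]
    rintro ⟨x, hx, y, hy, rfl⟩
    obtain ⟨m1, hm1⟩ := h1 _ _ hx
    obtain ⟨m2, hm2⟩ := h2 _ _ hy
    exact ⟨max m1 m2, x, up _ (le_max_left _ _) _ _ hm1, y, up _ (le_max_right _ _) _ _ hm2, rfl⟩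
  | comp cf cg h1 h2 =>
    intro n v
    simp only [evalP_comp, Part.mem_bind_iff]
    rintro ⟨x, hx, hy⟩
    obtain ⟨m1, hm1⟩ := h2 _ _ hx
    obtain ⟨m2, hm2⟩ := h1 _ _ hy
    exact ⟨max m1 m2, x, up _ (le_max_left _ _) _ _ hm1, up _ (le_max_right _ _) _ _ hm2⟩
  | prec cf cg h1 h2 =>
    intro n v hv
    simp only [evalP_prec] at hv ⊢
    have key : ∀ k m m', m ≤ m' → ∀ v, v ∈ precR (cf.evalP (resO O m)) (cg.evalP (resO O m)) n.unpair.1 k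
       → v ∈ precR (cf.evalP (resO O m')) (cg.evalP (resO O m')) n.unpair.1 k := by
      intro k m m' hm v hv
      have := up (.prec cf cg) hm (Nat.pair n.unpair.1 k) v
      simp only [evalP_prec, Nat.unpair_pair] at this
      exact this hv
    revert v
    induction n.unpair.2 with
    | zero => exact h1 _
    | succ k ih =>
      intro v
      simp only [precR_succ, Part.mem_bind_iff]
      rintro ⟨x, hx, hy⟩
      obtain ⟨m1, hm1⟩ := ih _ hx
      obtain ⟨m2, hm2⟩ := h2 _ _ hy
      exact ⟨max m1 m2, x, key _ _ _ (le_max_left _ _) _ hm1, up _ (le_max_right _ _) _ _ hm2⟩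
  | rfind' cf h1 =>
    intro n v
    simp only [evalP_rf, mem_rfR]
    rintro ⟨k, rfl, h0, hk⟩
    obtain ⟨m1, hm1⟩ := h1 _ _ h0
    choose! w hw hw' using hk
    have : ∀ j, ∃ m, j < k → w j ∈ cf.evalP (resO O m) (Nat.pair n.unpair.1 (j + n.unpair.2)) := by
      intro j
      by_cases hj : j < k
      · obtain ⟨m, hm⟩ := h1 _ _ (hw' j hj); exact ⟨m, fun _ => hm⟩
      · exact ⟨0, fun h => absurd h hj⟩
    choose M hM using this
    refine ⟨max m1 ((Finset.range k).sup M), k, rfl, up _ (le_max_left _ _) _ _ hm1, fun j hj =>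
      ⟨w j, hw j hj, up _ ?_ _ _ (hM j hj)⟩⟩
    exact le_trans (Finset.le_sup (Finset.mem_range.2 hj)) (le_max_right _ _)

/-! strings as partial oracles -/

def lookS (σ : List Bool) : ℕ → Part ℕ := fun n => ((σ[n]?.map fun b => cond b 1 0 : Option ℕ) : Part ℕ)

@[simp] theorem length_initSeg (X : Cantor) (k : ℕ) : (initSeg X k).length = k := by simp [initSeg]

theorem initSeg_get (X : Cantor) (k n : ℕ) (h : n < k) : (initSeg X k)[n]? = some (X n) := by
  simp [initSeg, h]

theorem initSeg_take (X : Cantor) {k m : ℕ} (h : m ≤ k) : (initSeg X k).take m = initSeg X m := by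
  simp [initSeg, ← List.map_take, List.take_range, h]

theorem initSeg_pfx (X : Cantor) {k m : ℕ} (h : m ≤ k) : initSeg X m <+: initSeg X k := by
  rw [← initSeg_take X h]; exact ⟨_, List.take_append_drop _ _⟩

theorem lookS_initSeg (X : Cantor) (k : ℕ) : lookS (initSeg X k) = resO (fun n => Part.some (oX X n)) k := by
  funext n
  simp only [lookS, resO]
  split_ifs with h
  · rw [initSeg_get X k n h]; rfl
  · rw [List.getElem?_eq_none (by simp; omega)]; rfl

theorem lookS_mono {σ τ : List Bool} (h : σ <+: τ) : ∀ n v, v ∈ lookS σ n → v ∈ lookS τ n := by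
  intro n v
  obtain ⟨ρ, rfl⟩ := h
  simp only [lookS]
  by_cases hn : n < σ.length
  · rw [List.getElem?_append_left hn]; exact id
  · rw [List.getElem?_eq_none (by omega)]; simp

/-- oracle use principle -/
theorem mem_evalO_iff (X : Cantor) (c : CodeO) (n v : ℕ) :
    v ∈ evalO X c n ↔ ∃ k, v ∈ c.evalP (lookS (initSeg X k)) n := by
  rw [evalO_eq]
  constructor
  · intro h
    obtain ⟨m, hm⟩ := evalP_compact _ _ _ _ h
    exact ⟨m, by rwa [lookS_initSeg]⟩
  · rintro ⟨k, hk⟩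
    rw [lookS_initSeg] at hk
    exact evalP_mono (resO_le _) _ _ _ hk

end RandProb

end

section
namespace RandProb
open Nat.Partrec (Code)

theorem encode_surj (n : ℕ) : ∃ c : CodeO, c.encode = n := by
  induction n using Nat.strong_induction_on with
  | _ n ih =>
    by_cases h : n < 5
    · interval_cases n
      · exact ⟨.zero, rfl⟩
      · exact ⟨.succ, rfl⟩
      · exact ⟨.left, rfl⟩
      · exact ⟨.right, rfl⟩
      · exact ⟨.oracle, rfl⟩
    · have hp : (n-5)/4 < n := by omega
      obtain ⟨a, ha⟩ := ih _ hp
      obtain ⟨b, hb⟩ := ih _ (lt_of_le_of_lt (Nat.unpair_left_le ((n-5)/4)) hp)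
      obtain ⟨d, hd⟩ := ih _ (lt_of_le_of_lt (Nat.unpair_right_le ((n-5)/4)) hp)
      have h4 : (n-5)%4 = 0 ∨ (n-5)%4 = 1 ∨ (n-5)%4 = 2 ∨ (n-5)%4 = 3 := by omega
      rcases h4 with h4 | h4 | h4 | h4
      · exact ⟨.pair b d, by simp only [CodeO.encode, hb, hd, Nat.pair_unpair]; omega⟩
      · exact ⟨.prec b d, by simp only [CodeO.encode, hb, hd, Nat.pair_unpair]; omega⟩
      · exact ⟨.comp b d, by simp only [CodeO.encode, hb, hd, Nat.pair_unpair]; omega⟩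
      · exact ⟨.rfind' a, by simp only [CodeO.encode, ha]; omega⟩

/-- `Code.eval` as a function into `Part`. -/
def evC (c : Code) (n : ℕ) : Part ℕ := c.eval n
theorem evC_zero (n : ℕ) : evC .zero n = Part.some 0 := rfl
theorem evC_succ (n : ℕ) : evC .succ n = Part.some (n+1) := rfl
theorem evC_left (n : ℕ) : evC .left n = Part.some n.unpair.1 := rfl
theorem evC_right (n : ℕ) : evC .right n = Part.some n.unpair.2 := rfl
theorem evC_comp (f g : Code) (n : ℕ) : evC (.comp f g) n = (evC g n).bind (evC f) := rfl
theorem evC_pair (f g : Code) (n : ℕ) : evC (.pair f g) n =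
    (evC f n).bind fun x => (evC g n).map fun y => Nat.pair x y :=
  Part.bind_map (fun x y => Nat.pair x y) (evC f n) (fun h => (evC g n).map h)
theorem evC_prec (f g : Code) (n : ℕ) :
    evC (.prec f g) n = precR (evC f) (evC g) n.unpair.1 n.unpair.2 := rfl
theorem evC_rf (f : Code) (n : ℕ) :
    evC (.rfind' f) n = rfR (evC f) n.unpair.1 n.unpair.2 := rfl

/-- string lookup as a code -/
theorem exists_look : ∃ L : Code, ∀ (σ : List Bool) n,
    evC L (Nat.pair (Encodable.encode σ) n) = lookS σ n := by
  have h : Primrec fun x : ℕ => ((Encodable.decode x.unpair.1 : Option (List Bool)).bind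
    fun σ => σ[x.unpair.2]?).map fun b => cond b 1 0 := by fun_prop
  have h2 : Partrec fun x : ℕ => ((((Encodable.decode x.unpair.1 : Option (List Bool)).bind
    fun σ => σ[x.unpair.2]?).map fun b => cond b 1 0 : Option ℕ) : Part ℕ) := h.to_comp.ofOption
  obtain ⟨L, hL⟩ := Code.exists_code.1 (Partrec.nat_iff.1 h2)
  refine ⟨L, fun σ n => ?_⟩
  rw [evC, hL]
  simp [lookS]

noncomputable def Lc : Code := exists_look.choose
theorem Lc_eval (σ : List Bool) (n : ℕ) :
    evC Lc (Nat.pair (Encodable.encode σ) n) = lookS σ n := exists_look.choose_spec σ n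

def Rc : Code := .pair (.comp .left .left) (.pair (.comp .right .left) .right)
def Qc : Code := .pair (.pair .left (.comp .left .right)) (.comp .right .right)

noncomputable def trS (F : ℕ → Code) (n : ℕ) : Code :=
  if n = 0 then .zero else if n = 1 then .comp .succ .right
  else if n = 2 then .comp .left .right else if n = 3 then .comp .right .right
  else if n = 4 then Lc
  else if (n-5) % 4 = 0 then .pair (F ((n-5)/4).unpair.1) (F ((n-5)/4).unpair.2)
  else if (n-5) % 4 = 1 then
    .comp (.prec (F ((n-5)/4).unpair.1) (.comp (F ((n-5)/4).unpair.2) Rc)) Qc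
  else if (n-5) % 4 = 2 then .comp (F ((n-5)/4).unpair.1) (.pair .left (F ((n-5)/4).unpair.2))
  else .comp (.rfind' (.comp (F ((n-5)/4)) Rc)) Qc

theorem trS_congr {F G : ℕ → Code} {n : ℕ} (h : ∀ i < n, F i = G i) : trS F n = trS G n := by
  unfold trS
  by_cases h5 : n < 5
  · interval_cases n <;> simp
  · have hp : (n-5)/4 < n := by omega
    rw [h _ hp, h _ (lt_of_le_of_lt (Nat.unpair_left_le _) hp),
      h _ (lt_of_le_of_lt (Nat.unpair_right_le _) hp)]

noncomputable def trN (n : ℕ) : Code := trS (fun i => if _h : i < n then trN i else .zero) n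
termination_by n
theorem trN_eq (n : ℕ) : trN n = trS trN n := by
  conv_lhs => unfold trN
  exact trS_congr fun i hi => by simp [hi]

section
variable {α : Type} [Primcodable α]
@[fun_prop] theorem fp_cpair {f g : α → Code} (hf : Primrec f) (hg : Primrec g) :
    Primrec fun x => Code.pair (f x) (g x) := Code.primrec₂_pair.comp hf hg
@[fun_prop] theorem fp_ccomp {f g : α → Code} (hf : Primrec f) (hg : Primrec g) :
    Primrec fun x => Code.comp (f x) (g x) := Code.primrec₂_comp.comp hf hg
@[fun_prop] theorem fp_cprec {f g : α → Code} (hf : Primrec f) (hg : Primrec g) :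
    Primrec fun x => Code.prec (f x) (g x) := Code.primrec₂_prec.comp hf hg
@[fun_prop] theorem fp_crf {f : α → Code} (hf : Primrec f) :
    Primrec fun x => Code.rfind' (f x) := Code.primrec_rfind'.comp hf
@[fun_prop] theorem fp_evaln {k : α → ℕ} {c : α → Code} {n : α → ℕ} (hk : Primrec k)
    (hc : Primrec c) (hn : Primrec n) : Primrec fun x => Code.evaln (k x) (c x) (n x) :=
  Code.primrec_evaln.comp ((hk.pair hc).pair hn)
end

@[fun_prop] theorem primrec_trN : Primrec trN := by
  have h : Primrec₂ fun (_ : Unit) (n : ℕ) => trN n := by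
    refine Primrec.nat_strong_rec _ (g := fun _ l => some (trS (fun i => l.getD i .zero) l.length)) ?_ ?_
    · unfold trS
      show Primrec _
      fun_prop
    · intro _ n
      rw [trN_eq]
      simp only [Option.some.injEq, List.length_map, List.length_range]
      exact trS_congr fun i hi => by simp [hi]
  exact h.comp (Primrec.const ()) Primrec.id

theorem Rc_eval (a b c : ℕ) : evC Rc (Nat.pair (Nat.pair a b) c) = Part.some (Nat.pair a (Nat.pair b c)) := by
  simp [Rc, evC_comp, evC_pair, evC_left, evC_right]
theorem Qc_eval (a b c : ℕ) : evC Qc (Nat.pair a (Nat.pair b c)) = Part.some (Nat.pair (Nat.pair a b) c) := by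
  simp [Qc, evC_comp, evC_pair, evC_left, evC_right]

theorem trN_eval (σ : List Bool) (c : CodeO) (n : ℕ) :
    evC (trN c.encode) (Nat.pair (Encodable.encode σ) n) = c.evalP (lookS σ) n := by
  induction c generalizing n with
  | zero => rw [trN_eq]; rfl
  | succ => rw [trN_eq]; simp [CodeO.encode, trS, evC_comp, evC_succ, evC_left, evC_right, CodeO.evalP]
  | left => rw [trN_eq]; simp [CodeO.encode, trS, evC_comp, evC_succ, evC_left, evC_right, CodeO.evalP]
  | right => rw [trN_eq]; simp [CodeO.encode, trS, evC_comp, evC_succ, evC_left, evC_right, CodeO.evalP]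
  | oracle => rw [trN_eq]; simp [CodeO.encode, trS, Lc_eval, CodeO.evalP]
  | pair f g hf hg =>
    have : trN (CodeO.pair f g).encode = .pair (trN f.encode) (trN g.encode) := by
      have e : (CodeO.pair f g).encode = 4 * Nat.pair f.encode g.encode + 5 := by
        simp only [CodeO.encode]; ring
      rw [trN_eq, e, trS]; simp
    rw [this, evC_pair, hf, hg, evalP_pair]
  | comp f g hf hg =>
    have : trN (CodeO.comp f g).encode = .comp (trN f.encode) (.pair .left (trN g.encode)) := by
      have e : (CodeO.comp f g).encode = 4 * Nat.pair f.encode g.encode + 7 := by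
        simp only [CodeO.encode]; ring
      rw [trN_eq, e, trS]
      have h1 : (4 * Nat.pair f.encode g.encode + 7 - 5)/4 = Nat.pair f.encode g.encode := by omega
      have h2 : (4 * Nat.pair f.encode g.encode + 7 - 5)%4 = 2 := by omega
      rw [h1, h2]
      simp
    rw [this, evC_comp, evC_pair, hg, evalP_comp]
    simp only [evC_left, Part.bind_some, Part.bind_map, Nat.unpair_pair, hf]
  | prec f g hf hg =>
    have : trN (CodeO.prec f g).encode = .comp (.prec (trN f.encode) (.comp (trN g.encode) Rc)) Qc := by
      have e : (CodeO.prec f g).encode = 4 * Nat.pair f.encode g.encode + 6 := by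
        simp only [CodeO.encode]; ring
      rw [trN_eq, e, trS]
      have h1 : (4 * Nat.pair f.encode g.encode + 6 - 5)/4 = Nat.pair f.encode g.encode := by omega
      have h2 : (4 * Nat.pair f.encode g.encode + 6 - 5)%4 = 1 := by omega
      rw [h1, h2]
      simp
    rw [this, evC_comp, evalP_prec]
    conv_lhs => rw [← Nat.pair_unpair n, Qc_eval]
    rw [Part.bind_some, evC_prec]
    simp only [Nat.unpair_pair]
    induction n.unpair.2 with
    | zero => exact hf _
    | succ k ih =>
      rw [precR_succ, precR_succ, ih]
      congr 1
      funext y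
      rw [evC_comp, Rc_eval, Part.bind_some, hg]
  | rfind' f hf =>
    have : trN (CodeO.rfind' f).encode = .comp (.rfind' (.comp (trN f.encode) Rc)) Qc := by
      have e : (CodeO.rfind' f).encode = 4 * f.encode + 8 := by
        simp only [CodeO.encode]; ring
      rw [trN_eq, e, trS]
      have h1 : (4 * f.encode + 8 - 5)/4 = f.encode := by omega
      have h2 : (4 * f.encode + 8 - 5)%4 = 3 := by omega
      rw [h1, h2]
      simp
    rw [this, evC_comp, evalP_rf]
    conv_lhs => rw [← Nat.pair_unpair n, Qc_eval]
    rw [Part.bind_some, evC_rf]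
    simp only [Nat.unpair_pair]
    have : ∀ x, evC (Code.comp (trN f.encode) Rc) (Nat.pair (Nat.pair (Encodable.encode σ) n.unpair.1) x)
       = f.evalP (lookS σ) (Nat.pair n.unpair.1 x) := by
      intro x
      rw [evC_comp, Rc_eval, Part.bind_some, hf]
    simp only [rfR, this]

/-- Computations with finite oracle string: least useful prefix first. -/
noncomputable def phi (e : ℕ) (σ : List Bool) (n : ℕ) : Option ℕ :=
  ((List.range (σ.length + 1)).find? fun m =>
    (Code.evaln σ.length (trN e) (Nat.pair (Encodable.encode (σ.take m)) n)).isSome).bind fun m =>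
    Code.evaln σ.length (trN e) (Nat.pair (Encodable.encode (σ.take m)) n)

@[fun_prop] theorem fp_phi {α : Type} [Primcodable α] {e n : α → ℕ} {s : α → List Bool}
    (he : Primrec e) (hs : Primrec s) (hn : Primrec n) :
    Primrec fun x => phi (e x) (s x) (n x) := by
  unfold phi
  fun_prop

theorem phi_mem {e : ℕ} {σ : List Bool} {n v : ℕ} (h : phi e σ n = some v) :
    ∃ m ≤ σ.length, Code.evaln σ.length (trN e) (Nat.pair (Encodable.encode (σ.take m)) n) = some v := by
  unfold phi at h
  rw [Option.bind_eq_some_iff] at h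
  obtain ⟨m, hm, h⟩ := h
  have := List.mem_of_find?_eq_some hm
  simp at this
  exact ⟨m, by omega, h⟩

theorem phi_isSome {e : ℕ} {σ : List Bool} {n m v : ℕ} (hm : m ≤ σ.length)
    (h : Code.evaln σ.length (trN e) (Nat.pair (Encodable.encode (σ.take m)) n) = some v) :
    ∃ w, phi e σ n = some w := by
  unfold phi
  cases hf : (List.range (σ.length + 1)).find? fun m =>
    (Code.evaln σ.length (trN e) (Nat.pair (Encodable.encode (σ.take m)) n)).isSome with
  | none =>
    rw [List.find?_eq_none] at hf
    have := hf m (by simp; omega)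
    rw [h] at this
    simp at this
  | some k =>
    have := List.find?_some hf
    simp only [Option.bind_some]
    exact Option.isSome_iff_exists.1 this

theorem phi_evalP {c : CodeO} {σ : List Bool} {n v : ℕ} (h : phi c.encode σ n = some v) :
    v ∈ c.evalP (lookS σ) n := by
  obtain ⟨m, hm, h⟩ := phi_mem h
  have := Code.evaln_sound h
  change v ∈ evC _ _ at this
  rw [trN_eval] at this
  exact evalP_mono (lookS_mono ⟨_, List.take_append_drop m σ⟩) _ _ _ this

theorem phi_mono {e : ℕ} {σ τ : List Bool} {n v : ℕ} (hp : σ <+: τ) (h : phi e σ n = some v) :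
    phi e τ n = some v := by
  obtain ⟨c, rfl⟩ := encode_surj e
  obtain ⟨m, hm, h'⟩ := phi_mem h
  have h2 : τ.take m = σ.take m := by
    obtain ⟨ρ, rfl⟩ := hp
    rw [List.take_append_of_le_length hm]
  have h3 := Code.evaln_mono hp.length_le h'
  rw [← h2] at h3
  obtain ⟨w, hw⟩ := phi_isSome (hm.trans hp.length_le) h3
  have h4 := phi_evalP hw
  have h5 := evalP_mono (lookS_mono hp) _ _ _ (phi_evalP h)
  rw [hw, Part.mem_unique h4 h5]

theorem phi_sound {c : CodeO} {X : Cantor} {k n v : ℕ} (h : phi c.encode (initSeg X k) n = some v) :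
    v ∈ evalO X c n := (mem_evalO_iff X c n v).2 ⟨k, phi_evalP h⟩

theorem phi_complete {c : CodeO} {X : Cantor} {n v : ℕ} (h : v ∈ evalO X c n) :
    ∃ k0, ∀ k ≥ k0, phi c.encode (initSeg X k) n = some v := by
  obtain ⟨m, hm⟩ := (mem_evalO_iff X c n v).1 h
  rw [← trN_eval] at hm
  obtain ⟨k, hk⟩ := Code.evaln_complete.1 hm
  refine ⟨max m k, fun k' hk' => ?_⟩
  have hmk : m ≤ k' := (le_max_left m k).trans hk'
  have h3 := Code.evaln_mono ((le_max_right m k).trans hk') hk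
  rw [← initSeg_take X hmk] at h3
  obtain ⟨w, hw⟩ := phi_isSome (σ := initSeg X k') (m := m) (by simpa using hmk) (by simpa using h3)
  rw [hw, Part.mem_unique (phi_sound hw) h]

theorem dom_iff_phi {c : CodeO} {X : Cantor} {n : ℕ} :
    (evalO X c n).Dom ↔ ∃ k, (phi c.encode (initSeg X k) n).isSome := by
  constructor
  · intro h
    obtain ⟨k, hk⟩ := phi_complete (Part.get_mem h)
    exact ⟨k, by rw [hk k le_rfl]; rfl⟩
  · rintro ⟨k, hk⟩
    obtain ⟨v, hv⟩ := Option.isSome_iff_exists.1 hk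
    exact Part.dom_iff_mem.2 ⟨v, phi_sound hv⟩

end RandProb

end

section
namespace RandProb
open Nat.Partrec (Code)

/-- embedding of codes -/
def emb : Code → CodeO
  | .zero => .zero
  | .succ => .succ
  | .left => .left
  | .right => .right
  | .pair f g => .pair (emb f) (emb g)
  | .comp f g => .comp (emb f) (emb g)
  | .prec f g => .prec (emb f) (emb g)
  | .rfind' f => .rfind' (emb f)

theorem emb_eval (O : ℕ → Part ℕ) (c : Code) : (emb c).evalP O = evC c := by
  induction c with
  | zero => rfl
  | succ => rfl
  | left => rfl
  | right => rfl
  | pair cf cg h1 h2 => funext n; rw [evC_pair, emb, evalP_pair, h1, h2]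
  | comp cf cg h1 h2 => funext n; rw [evC_comp, emb, evalP_comp, h1, h2]
  | prec cf cg h1 h2 => funext n; rw [evC_prec, emb, evalP_prec, h1, h2]
  | rfind' cf h1 => funext n; rw [evC_rf, emb, evalP_rf, h1]

theorem exists_evC {f : ℕ → ℕ} (hf : Computable f) : ∃ c : Code, ∀ n, evC c n = Part.some (f n) := by
  obtain ⟨c, hc⟩ := Code.exists_code.1 (Partrec.nat_iff.1 hf)
  exact ⟨c, fun n => by rw [evC, hc]; rfl⟩

theorem exists_evC' {f : ℕ →. ℕ} (hf : Partrec f) : ∃ c : Code, ∀ n, evC c n = f n := by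
  obtain ⟨c, hc⟩ := Code.exists_code.1 (Partrec.nat_iff.1 hf)
  exact ⟨c, fun n => by rw [evC, hc]⟩

theorem initSeg_succ (X : Cantor) (k : ℕ) : initSeg X (k+1) = initSeg X k ++ [X k] := by
  simp [initSeg, List.range_succ]

theorem exists_seg : ∃ c : CodeO, ∀ (X : Cantor) k,
    c.evalP (fun n => Part.some (oX X n)) (Nat.pair 0 k) = Part.some (Encodable.encode (initSeg X k)) := by
  obtain ⟨c0, h0⟩ := exists_evC (f := fun _ => Encodable.encode ([] : List Bool)) (Computable.const _)
  have hs : Primrec fun x : ℕ => Encodable.encode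
    (((Encodable.decode x.unpair.1 : Option (List Bool)).getD []) ++ [decide (x.unpair.2 = 1)]) := by
    fun_prop
  obtain ⟨c1, h1⟩ := exists_evC hs.to_comp
  refine ⟨.prec (emb c0) (.comp (emb c1) (.pair (.comp .right .right)
    (.comp .oracle (.comp .left .right)))), fun X k => ?_⟩
  rw [evalP_prec]
  simp only [Nat.unpair_pair]
  induction k with
  | zero => simp [precR, emb_eval, h0, initSeg]
  | succ k ih =>
    rw [precR_succ, ih, Part.bind_some]
    simp only [evalP_comp, evalP_pair, emb_eval]
    simp only [CodeO.evalP, Part.bind_some, Part.map_some, Nat.unpair_pair, h1, Encodable.encodek,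
      Option.getD_some, initSeg_succ, oX]
    cases X k <;> simp

theorem rfR_first {f : ℕ → Part ℕ} {p : ℕ → Bool} {a : ℕ}
    (h : ∀ k, f (Nat.pair a k) = Part.some (cond (p k) 0 1)) (v : ℕ) :
    v ∈ rfR f a 0 ↔ p v = true ∧ ∀ j < v, p j = false := by
  rw [mem_rfR]
  simp only [Nat.add_zero, h, Part.mem_some_iff]
  constructor
  · rintro ⟨n, rfl, h1, h2⟩
    refine ⟨by cases hp : p v <;> simp [hp] at h1 ⊢, fun j hj => ?_⟩
    obtain ⟨w, hw, hw'⟩ := h2 j hj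
    cases hp : p j
    · rfl
    · simp [hp] at hw'; exact absurd hw' hw
  · rintro ⟨h1, h2⟩
    exact ⟨v, rfl, by simp [h1], fun j hj => ⟨1, one_ne_zero, by simp [h2 j hj]⟩⟩

theorem builder {F : List Bool → ℕ → Option ℕ} (hF : Primrec fun p : List Bool × ℕ => F p.1 p.2) :
    ∃ c : CodeO, ∀ X n, (∀ v, v ∈ evalO X c n → ∃ k, F (initSeg X k) n = some v) ∧
      (∀ k, (F (initSeg X k) n).isSome → (evalO X c n).Dom) := by
  obtain ⟨seg, hseg⟩ := exists_seg
  have ht : Primrec fun x : ℕ => cond ((Encodable.decode x.unpair.1 : Option (List Bool)).bind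
    fun s => F s x.unpair.2).isSome 0 1 := by fun_prop
  have hg : Primrec fun x : ℕ => ((Encodable.decode x.unpair.1 : Option (List Bool)).bind
    fun s => F s x.unpair.2).getD 0 := by fun_prop
  obtain ⟨ct, ht⟩ := exists_evC ht.to_comp
  obtain ⟨cg, hg⟩ := exists_evC hg.to_comp
  let T : CodeO := .pair (.comp seg (.pair .zero .right)) .left
  let I : CodeO := .pair .left .right
  have hT : ∀ (X : Cantor) n k, T.evalP (fun n => Part.some (oX X n)) (Nat.pair n k) =
      Part.some (Nat.pair (Encodable.encode (initSeg X k)) n) := by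
    intro X n k
    simp only [T, evalP_pair, evalP_comp]
    simp only [CodeO.evalP, Part.bind_some, Part.map_some, Nat.unpair_pair, hseg]
  refine ⟨.comp (.comp (emb cg) T) (.pair I (.comp (.rfind' (.comp (emb ct) T)) (.pair I .zero))),
    fun X n => ?_⟩
  have hI : ∀ O, I.evalP O n = Part.some n := by
    intro O
    simp [I, CodeO.evalP]
  have key : evalO X (.comp (.comp (emb cg) T) (.pair I (.comp (.rfind' (.comp (emb ct) T))
      (.pair I .zero)))) n = (rfR ((CodeO.comp (emb ct) T).evalP (fun n => Part.some (oX X n))) n 0).bind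
      fun k => Part.some ((F (initSeg X k) n).getD 0) := by
    rw [evalO_eq, evalP_comp, evalP_pair, hI, Part.bind_some, evalP_comp, evalP_pair, hI,
      Part.bind_some, Part.bind_map]
    simp only [CodeO.evalP, Part.bind_some, Part.map_some, Nat.unpair_pair]
    congr 1
    funext k
    rw [hT, Part.bind_some, emb_eval, hg]
    simp
  have hp := rfR_first (f := (CodeO.comp (emb ct) T).evalP (fun n => Part.some (oX X n)))
    (p := fun k => (F (initSeg X k) n).isSome) (a := n) (by
      intro k
      rw [evalP_comp, hT, Part.bind_some, emb_eval, ht]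
      simp)
  rw [key]
  constructor
  · intro v hv
    obtain ⟨k, hk, hv⟩ := Part.mem_bind_iff.1 hv
    have := (hp k).1 hk
    rw [Part.mem_some_iff] at hv
    obtain ⟨w, hw⟩ := Option.isSome_iff_exists.1 this.1
    exact ⟨k, by rw [hv, hw]; rfl⟩
  · intro k hk
    have hex : ∃ k, (F (initSeg X k) n).isSome = true := ⟨k, hk⟩
    rw [Part.dom_iff_mem]
    refine ⟨_, Part.mem_bind_iff.2 ⟨Nat.find hex, (hp _).2 ⟨Nat.find_spec hex, fun j hj => ?_⟩,
      Part.mem_some _⟩⟩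
    simpa using Nat.find_min hex hj

/-- Reductions from approximations. -/
theorem turing_of_approx {F : List Bool → ℕ → Option ℕ}
    (hF : Primrec fun p : List Bool × ℕ => F p.1 p.2) {f : ℕ → ℕ} {X : Cantor}
    (h1 : ∀ n, ∃ k, (F (initSeg X k) n).isSome)
    (h2 : ∀ n k v, F (initSeg X k) n = some v → v = f n) : TuringLEf f (oX X) := by
  obtain ⟨c, hc⟩ := builder hF
  refine ⟨c, fun n => ?_⟩
  obtain ⟨k, hk⟩ := h1 n
  have hd := (hc X n).2 k hk
  obtain ⟨k', hk'⟩ := (hc X n).1 _ (Part.get_mem hd)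
  have := h2 n k' _ hk'
  rw [← this]
  exact (Part.some_get hd).symm

theorem turing_phi {f : ℕ → ℕ} {X : Cantor} {c : CodeO} (h : ∀ n, c.eval (oX X) n = Part.some (f n)) (n : ℕ) :
    (∀ k v, phi c.encode (initSeg X k) n = some v → v = f n) ∧
    ∃ k0, ∀ k ≥ k0, phi c.encode (initSeg X k) n = some (f n) := by
  have h' : evalO X c n = Part.some (f n) := h n
  constructor
  · intro k v hv
    have := phi_sound hv
    rw [h'] at this
    exact Part.mem_some_iff.1 this
  · exact phi_complete (by rw [h']; exact Part.mem_some _)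

theorem turing_trans {f : ℕ → ℕ} {X Y : Cantor} (h1 : TuringLEf f (oX Y))
    (h2 : TuringLEf (oX Y) (oX X)) : TuringLEf f (oX X) := by
  obtain ⟨d, hd⟩ := h1
  obtain ⟨c, hc⟩ := h2
  have hF : Primrec fun p : List Bool × ℕ => (((List.range (p.1.length + 1)).find? fun m =>
     ((List.range m).all fun i => (phi c.encode p.1 i).isSome) &&
     (phi d.encode ((List.range m).map fun i => decide (phi c.encode p.1 i = some 1)) p.2).isSome).bind
     fun m => phi d.encode ((List.range m).map fun i => decide (phi c.encode p.1 i = some 1)) p.2) := by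
    fun_prop
  have seg : ∀ σ m, (∃ k, σ = initSeg X k) → (∀ i < m, (phi c.encode σ i).isSome) →
      ((List.range m).map fun i => decide (phi c.encode σ i = some 1)) = initSeg Y m := by
    rintro σ m ⟨k, rfl⟩ h
    apply List.map_congr_left
    intro i hi
    obtain ⟨v, hv⟩ := Option.isSome_iff_exists.1 (h i (List.mem_range.1 hi))
    have := (turing_phi hc i).1 _ _ hv
    rw [hv, this, oX]
    cases Y i <;> simp
  refine turing_of_approx (F := fun σ n => ((List.range (σ.length + 1)).find? fun m =>
     ((List.range m).all fun i => (phi c.encode σ i).isSome) &&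
     (phi d.encode ((List.range m).map fun i => decide (phi c.encode σ i = some 1)) n).isSome).bind
     fun m => phi d.encode ((List.range m).map fun i => decide (phi c.encode σ i = some 1)) n) hF ?_ ?_
  · intro n
    obtain ⟨m, hm⟩ := (turing_phi hd n).2
    have : ∃ K, ∀ i < m, ∀ k ≥ K, (phi c.encode (initSeg X k) i).isSome := by
      choose K hK using fun i => (turing_phi hc i).2
      refine ⟨(Finset.range m).sup K, fun i hi k hk => ?_⟩
      rw [hK i k (le_trans (Finset.le_sup (Finset.mem_range.2 hi)) hk)]
      rfl
    obtain ⟨K, hK⟩ := this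
    refine ⟨max m K, ?_⟩
    have hx : ∀ i < m, (phi c.encode (initSeg X (max m K)) i).isSome :=
      fun i hi => hK i hi _ (le_max_right _ _)
    rcases hf : (List.range ((initSeg X (max m K)).length + 1)).find? (fun m' =>
      ((List.range m').all fun i => (phi c.encode (initSeg X (max m K)) i).isSome) &&
       (phi d.encode ((List.range m').map fun i => decide (phi c.encode (initSeg X (max m K)) i = some 1)) n).isSome)
       with _ | m'
    · rw [List.find?_eq_none] at hf
      have := hf m (by simp)
      rw [seg _ m ⟨_, rfl⟩ hx, hm m le_rfl] at this
      simp at this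
      obtain ⟨i, hi, h⟩ := this
      have := hx i hi
      rw [h] at this
      simp at this
    · have := List.find?_some hf
      rw [Bool.and_eq_true] at this
      simpa using this.2
  · intro n k v hv
    obtain ⟨m, hm, hv⟩ := Option.bind_eq_some_iff.1 hv
    have := List.find?_some hm
    rw [Bool.and_eq_true] at this
    rw [seg _ m ⟨k, rfl⟩ (by simpa [List.all_eq_true] using this.1)] at hv
    exact (turing_phi hd n).1 _ _ hv

/-! ### the halting set -/
noncomputable def KB (t x : ℕ) : Bool := (phi x (List.replicate t false) x).isSome

@[fun_prop] theorem fp_KB {α : Type} [Primcodable α] {t x : α → ℕ} (ht : Primrec t) (hx : Primrec x) :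
    Primrec fun a => KB (t a) (x a) := by unfold KB; fun_prop

def X0 : Cantor := fun _ => false
theorem initSeg_X0 (k : ℕ) : initSeg X0 k = List.replicate k false := by
  show List.map (fun _ => false) _ = _
  simp

theorem mem_K {e : ℕ} : e ∈ HaltingSet ↔ ∃ t, KB t e = true := by
  have h1 : e ∈ HaltingSet ↔ ∃ c : CodeO, c.encode = e ∧ (c.eval (fun _ => 0) e).Dom := by
    by_cases h : ∃ c : CodeO, c.encode = e ∧ (c.eval (fun _ => 0) e).Dom
    · simp only [HaltingSet, iterJump, jump, Set.mem_ofPred_eq, h]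
      simp
    · simp only [HaltingSet, iterJump, jump, Set.mem_ofPred_eq, h]
      simp
  have h0 : (fun _ => 0) = oX X0 := by funext n; simp [oX, X0]
  rw [h1]
  constructor
  · rintro ⟨c, rfl, h⟩
    rw [h0] at h
    obtain ⟨k, hk⟩ := dom_iff_phi.1 (show (evalO X0 c c.encode).Dom from h)
    exact ⟨k, by rw [KB, ← initSeg_X0]; exact hk⟩
  · rintro ⟨t, ht⟩
    obtain ⟨c, rfl⟩ := encode_surj e
    refine ⟨c, rfl, ?_⟩
    rw [h0]
    refine dom_iff_phi.2 ⟨t, ?_⟩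
    rw [initSeg_X0]; exact ht

theorem KB_mono {t t' x : ℕ} (h : t ≤ t') (hx : KB t x = true) : KB t' x = true := by
  unfold KB at *
  obtain ⟨v, hv⟩ := Option.isSome_iff_exists.1 hx
  rw [phi_mono (τ := List.replicate t' false) _ hv]
  · rfl
  · rw [← initSeg_X0, ← initSeg_X0]; exact initSeg_pfx _ h

theorem KB_lt {t x : ℕ} (hx : KB t x = true) : x < t := by
  obtain ⟨v, hv⟩ := Option.isSome_iff_exists.1 hx
  obtain ⟨m, hm, h⟩ := phi_mem hv
  have := Code.evaln_bound h
  simp only [List.length_replicate] at this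
  exact lt_of_le_of_lt (Nat.right_le_pair _ _) this

theorem K_not_computable : ¬ ComputablePred fun n => n ∈ HaltingSet := by
  intro h
  obtain ⟨inst, hc⟩ := h
  have h2 : Partrec fun n : ℕ => (cond (decide (n ∈ HaltingSet)) Part.none (Part.some 0) : Part ℕ) :=
    Partrec.cond hc Partrec.none (Computable.const 0)
  obtain ⟨c, hc⟩ := exists_evC' h2
  have h3 : (evalO X0 (emb c) (emb c).encode).Dom ↔ (emb c).encode ∈ HaltingSet := by
    rw [dom_iff_phi, mem_K]
    simp only [initSeg_X0, KB]
  rw [evalO_eq, emb_eval, hc] at h3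
  by_cases hk : (emb c).encode ∈ HaltingSet <;> simp [hk] at h3

/-- search principle: an effective search producing correct stages would decide `K` -/
theorem K_search {P : ℕ → ℕ → Prop} (hP : ComputablePred fun p : ℕ × ℕ => P p.1 p.2)
    (h1 : ∀ x, ∃ s, P x s) (h2 : ∀ x s, P x s → x ∈ HaltingSet → KB s x = true) : False := by
  obtain ⟨inst, hc⟩ := hP
  have hc2 : Computable₂ fun x s : ℕ => decide (P x s) :=
    Computable.of_eq hc fun p => decide_eq_decide.2 Iff.rfl
  have hr : Partrec fun x : ℕ => (Nat.rfind fun s => Part.some (decide (P x s))) :=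
    Partrec.rfind (p := fun x s => Part.some (decide (P x s))) hc2.partrec₂
  obtain ⟨s, hs, hsp⟩ : ∃ s : ℕ → ℕ, Computable s ∧ ∀ x, P x (s x) := by
    have hd : ∀ x, ∃ v, v ∈ (Nat.rfind fun s => Part.some (decide (P x s))) := by
      intro x
      refine ⟨Nat.find (h1 x), Nat.mem_rfind.2 ⟨?_, fun {m} hm => ?_⟩⟩
      · simpa using Nat.find_spec (h1 x)
      · simpa using Nat.find_min (h1 x) hm
    choose s hs using hd
    refine ⟨s, Partrec.of_eq hr fun x => Part.eq_some_iff.2 (hs x), fun x => ?_⟩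
    have := (Nat.mem_rfind.1 (hs x)).1
    simpa using this
  apply K_not_computable
  refine ⟨Classical.decPred _, ?_⟩
  have hk0 : Computable₂ KB := (show Primrec fun p : ℕ × ℕ => KB p.1 p.2 by fun_prop).to_comp
  have hk : Computable fun x => KB (s x) x := hk0.comp hs Computable.id
  refine hk.of_eq fun x => ?_
  by_cases hx : x ∈ HaltingSet
  · rw [h2 x _ (hsp x) hx]; simp [hx]
  · have : KB (s x) x = false := by
      by_contra hn
      exact hx (mem_K.2 ⟨_, by simpa using hn⟩)
    rw [this]; simp [hx]

/-! ### universal oracle machines -/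

theorem initSeg_prepend (ρ : List Bool) (X : Cantor) (k : ℕ) :
    initSeg (prepend ρ X) k = ρ.take k ++ initSeg X (k - ρ.length) := by
  apply List.ext_getElem?
  intro i
  by_cases hk : i < k
  · rw [initSeg_get _ _ _ hk]
    by_cases hi : i < ρ.length
    · rw [List.getElem?_append_left (by simp; omega)]
      simp [prepend, hi, hk]
    · rw [List.getElem?_append_right (by simp; omega)]
      have : (List.take k ρ).length = ρ.length := by simp; omega
      rw [this, initSeg_get _ _ _ (by omega)]
      simp [prepend, hi]
  · rw [List.getElem?_eq_none (by simp; omega), List.getElem?_eq_none (by simp; omega)]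

def lead (σ : List Bool) : ℕ := σ.foldr (fun b n => cond b (n+1) 0) 0

@[fun_prop] theorem fp_lead {α : Type} [Primcodable α] {f : α → List Bool} (hf : Primrec f) :
    Primrec fun x => lead (f x) := by unfold lead; fun_prop

theorem lead_ones (e : ℕ) (τ : List Bool) : lead (List.replicate e true ++ false :: τ) = e := by
  induction e with
  | zero => rfl
  | succ e ih => simpa [List.replicate_succ, lead] using ih

theorem lead_rep (e : ℕ) : lead (List.replicate e true) = e := by
  induction e with
  | zero => rfl
  | succ e ih => simpa [List.replicate_succ, lead] using ih

/-- the decoder for the standard universal machine -/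
noncomputable def F0 (σ : List Bool) (n : ℕ) : Option ℕ :=
  if lead σ < σ.length then phi (lead σ) (σ.drop (lead σ + 1)) n else none

@[fun_prop] theorem fp_F0 {α : Type} [Primcodable α] {f : α → List Bool} {g : α → ℕ}
    (hf : Primrec f) (hg : Primrec g) :
    Primrec fun x => F0 (f x) (g x) := by unfold F0; fun_prop

def onesZ (e : ℕ) : List Bool := List.replicate e true ++ [false]

theorem onesZ_take {e k : ℕ} (h : k ≤ e) : (onesZ e).take k = List.replicate k true := by
  rw [onesZ, List.take_append_of_le_length (by simpa using h)]
  simp [h]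

theorem F0_seg (e : ℕ) (X : Cantor) (k n : ℕ) : F0 (initSeg (prepend (onesZ e) X) k) n =
    if e < k then phi e (initSeg X (k - (e+1))) n else none := by
  rw [initSeg_prepend]
  split_ifs with h
  · rw [List.take_of_length_le (by simp [onesZ]; omega)]
    have h1 : lead (onesZ e ++ initSeg X (k - (onesZ e).length)) = e := by
      rw [onesZ, List.append_assoc]; exact lead_ones _ _
    have h2 : (onesZ e).length = e + 1 := by simp [onesZ]
    rw [F0, h1, h2, if_pos (by simp [h2]; omega)]
    congr 1
    rw [← h2, List.drop_left]
  · have : k - (onesZ e).length = 0 := by simp [onesZ]; omega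
    rw [this, onesZ_take (by omega)]
    simp only [initSeg, List.range_zero, List.map_nil, List.append_nil]
    rw [F0, lead_rep, if_neg (by simp)]

theorem onesZ_inj {e e' : ℕ} {τ τ' : List Bool} (h : onesZ e ++ τ = onesZ e' ++ τ') : e = e' := by
  rw [onesZ, onesZ, List.append_assoc, List.append_assoc] at h
  have := congrArg lead h
  simpa [lead_ones] using this

@[fun_prop] theorem fp_onesZ {α : Type} [Primcodable α] {f : α → ℕ} (hf : Primrec f) :
    Primrec fun x => onesZ (f x) := by unfold onesZ; fun_prop

/-- machine from decoders on the two halves -/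
noncomputable def F1 (g : List Bool → ℕ → Bool) (σ : List Bool) (n : ℕ) : Option ℕ :=
  if σ[0]? = some false then F0 (σ.drop 1) n
  else if σ[0]? = some true then (if g (σ.drop 1) n = true then some 0 else none) else none

def consC (b : Bool) (X : Cantor) : Cantor := prepend [b] X

theorem initSeg_consC (b : Bool) (X : Cantor) (k : ℕ) : initSeg (consC b X) (k+1) = b :: initSeg X k := by
  simp [consC, initSeg_prepend]

theorem prepend_consC (b : Bool) (ρ : List Bool) (X : Cantor) :
    prepend (b :: ρ) X = consC b (prepend ρ X) := by
  funext n
  cases n with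
  | zero => simp [consC, prepend]
  | succ n => simp [consC, prepend]

theorem exists_u0 : ∃ u0 : CodeO, (∀ X n, (evalO X u0 n).Dom ↔ ∃ k, (F0 (initSeg X k) n).isSome) := by
  obtain ⟨c, hc⟩ := builder (F := F0) (by fun_prop)
  refine ⟨c, fun X n => ⟨fun h => ?_, fun ⟨k, hk⟩ => (hc X n).2 k hk⟩⟩
  obtain ⟨k, hk⟩ := (hc X n).1 _ (Part.get_mem h)
  exact ⟨k, by rw [hk]; rfl⟩

noncomputable def u0 : CodeO := exists_u0.choose
theorem u0_spec (X : Cantor) (n : ℕ) : (evalO X u0 n).Dom ↔ ∃ k, (F0 (initSeg X k) n).isSome :=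
  exists_u0.choose_spec X n

theorem OM_real {g : List Bool → ℕ → Bool} (hg : Primrec fun p : List Bool × ℕ => g p.1 p.2) :
    ∃ u, UniversalOM u ∧ (∀ X, domSet u (consC false X) = domSet u0 X) ∧
      ∀ Z, domSet u (consC true Z) = {n | ∃ k, g (initSeg Z k) n = true} := by
  obtain ⟨u, hu⟩ := builder (F := F1 g) (by unfold F1; fun_prop)
  have hd : ∀ X n, (evalO X u n).Dom ↔ ∃ k, (F1 g (initSeg X k) n).isSome := by
    refine fun X n => ⟨fun h => ?_, fun ⟨k, hk⟩ => (hu X n).2 k hk⟩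
    obtain ⟨k, hk⟩ := (hu X n).1 _ (Part.get_mem h)
    exact ⟨k, by rw [hk]; rfl⟩
  have f0 : ∀ X k n, F1 g (initSeg (consC false X) (k+1)) n = F0 (initSeg X k) n := by
    intro X k n
    rw [initSeg_consC]; simp [F1]
  have f1 : ∀ X k n, F1 g (initSeg (consC true X) (k+1)) n =
      if g (initSeg X k) n = true then some 0 else none := by
    intro X k n
    rw [initSeg_consC]; simp [F1]
  have fz : ∀ X n, F1 g (initSeg X 0) n = none := by
    intro X n; simp [initSeg, F1]
  refine ⟨u, ⟨fun c => false :: onesZ c.encode, ⟨fun e => Encodable.encode (false :: onesZ e),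
    (show Primrec _ by fun_prop).to_comp, fun c => rfl⟩, ?_, ?_⟩, ?_, ?_⟩
  · rintro _ ⟨c, rfl⟩ _ ⟨d, rfl⟩ h
    obtain ⟨ρ, h⟩ := h
    have h' : onesZ c.encode ++ ρ = onesZ d.encode ++ [] := by
      simpa using h
    simp [onesZ_inj h']
  · intro c X n
    rw [prepend_consC]
    have key : ∀ k, F1 g (initSeg (consC false (prepend (onesZ c.encode) X)) (k + (c.encode+1) + 1)) n
        = phi c.encode (initSeg X k) n := by
      intro k
      rw [f0, F0_seg, if_pos (by omega)]
      rw [Nat.add_sub_cancel]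
    have key' : ∀ k v, F1 g (initSeg (consC false (prepend (onesZ c.encode) X)) k) n = some v →
        v ∈ evalO X c n := by
      intro k v h
      rcases k with _ | k
      · rw [fz] at h; simp at h
      · rw [f0, F0_seg] at h
        split_ifs at h
        exact phi_sound h
    apply Part.ext
    intro v
    constructor
    · intro h
      obtain ⟨k, hk⟩ := (hu _ n).1 _ h
      exact key' k v hk
    · intro h
      obtain ⟨k, hk⟩ := phi_complete h
      have h2 := (hu (consC false (prepend (onesZ c.encode) X)) n).2 (k + (c.encode+1) + 1)
        (by rw [key, hk k le_rfl]; rfl)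
      have h3 := Part.get_mem h2
      obtain ⟨k', hk'⟩ := (hu _ n).1 _ h3
      have := Part.mem_unique (key' k' _ hk') h
      rwa [this] at h3
  · intro X
    ext n
    simp only [domSet, Set.mem_ofPred_eq, hd, u0_spec]
    constructor
    · rintro ⟨k, hk⟩
      rcases k with _ | k
      · rw [fz] at hk; simp at hk
      · rw [f0] at hk; exact ⟨k, hk⟩
    · rintro ⟨k, hk⟩
      exact ⟨k+1, by rwa [f0]⟩
  · intro X
    ext n
    simp only [domSet, Set.mem_ofPred_eq, hd]
    constructor
    · rintro ⟨k, hk⟩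
      rcases k with _ | k
      · rw [fz] at hk; simp at hk
      · rw [f1] at hk
        refine ⟨k, ?_⟩
        by_contra hn
        simp [hn] at hk
    · rintro ⟨k, hk⟩
      exact ⟨k+1, by rw [f1, if_pos hk]; rfl⟩

end RandProb

end

section
namespace RandProb

/-! ### Module B: measure -/

theorem measurable_seg (k : ℕ) (R : List Bool → Prop) : MeasurableSet {X : Cantor | R (initSeg X k)} := by
  induction k generalizing R with
  | zero => simp [initSeg]
  | succ k ih =>
    have : {X : Cantor | R (initSeg X (k+1))} =
      ({X : Cantor | X k = true} ∩ {X | R (initSeg X k ++ [true])}) ∪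
      ({X : Cantor | X k = false} ∩ {X | R (initSeg X k ++ [false])}) := by
      ext X
      simp only [initSeg_succ, Set.mem_union, Set.mem_inter_iff, Set.mem_ofPred_eq]
      cases X k <;> simp
    rw [this]
    have hm : ∀ b, MeasurableSet {X : Cantor | X k = b} := fun b =>
      measurableSet_eq_fun (measurable_pi_apply k) measurable_const
    exact ((hm _).inter (ih fun σ => R (σ ++ [true]))).union ((hm _).inter (ih fun σ => R (σ ++ [false])))

theorem measurable_digits : Measurable digits := by
  refine measurable_pi_lambda _ fun n => ?_
  have h1 : Measurable fun x : ℝ => ⌊x * 2 ^ (n+1)⌋ := by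
    exact Int.measurable_floor.comp (measurable_id.mul_const _)
  have h2 : Measurable fun z : ℤ => decide (z % 2 = 1) := measurable_of_countable _
  exact h2.comp h1

instance mu_prob : IsProbabilityMeasure mu := by
  have : IsProbabilityMeasure (volume.restrict (Set.Ico (0:ℝ) 1)) := ⟨by simp⟩
  exact Measure.isProbabilityMeasure_map measurable_digits.aemeasurable

theorem mu_apply {S : Set Cantor} (hS : MeasurableSet S) :
    mu S = volume (digits ⁻¹' S ∩ Set.Ico (0:ℝ) 1) := by
  rw [mu, Measure.map_apply measurable_digits hS, Measure.restrict_apply (measurable_digits hS)]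

theorem digits_lo {x : ℝ} (h0 : 0 ≤ x) (h1 : x < 1/2) : digits x = consC false (digits (2*x)) := by
  funext n
  cases n with
  | zero =>
    have : ⌊x * 2^(0+1)⌋ = 0 := by rw [Int.floor_eq_zero_iff]; constructor <;> norm_num <;> linarith
    simp only [digits, this, consC, prepend]; simp
  | succ n =>
    have : 2 * x * 2^(n+1) = x * 2^(n+1+1) := by ring
    simp [digits, consC, prepend, this]

theorem digits_hi {x : ℝ} (h0 : 1/2 ≤ x) (h1 : x < 1) : digits x = consC true (digits (2*x-1)) := by
  funext n
  cases n with
  | zero =>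
    have : ⌊x * 2^(0+1)⌋ = 1 := by rw [Int.floor_eq_iff]; constructor <;> norm_num <;> linarith
    simp only [digits, this, consC, prepend]; simp
  | succ n =>
    have : x * 2^(n+1+1) = (2 * x - 1) * 2^(n+1) + ((2^(n+1) : ℤ) : ℝ) := by push_cast; ring
    simp only [digits, consC, prepend]
    rw [this, Int.floor_add_intCast]
    have h2 : (2:ℤ) ∣ 2^(n+1) := Dvd.intro_left _ (pow_succ 2 n).symm
    have : ∀ z : ℤ, (z + 2^(n+1)) % 2 = z % 2 := fun z => by
      rw [Int.add_emod, Int.emod_eq_zero_of_dvd h2]; simp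
    simp [this]

theorem measurable_consC (b : Bool) : Measurable (consC b) := by
  refine measurable_pi_lambda _ fun n => ?_
  cases n with
  | zero => simp [consC, prepend]
  | succ n => simpa [consC, prepend] using measurable_pi_apply n

theorem muR_half {S : Set Cantor} (hS : MeasurableSet S) :
    muR S = 1/2 * muR {Z | consC false Z ∈ S} + 1/2 * muR {Z | consC true Z ∈ S} := by
  have hm : ∀ b, MeasurableSet {Z | consC b Z ∈ S} := fun b => measurable_consC b hS
  have e1 : digits ⁻¹' S ∩ Set.Ico (0:ℝ) (1/2) =
      (fun x => 2 * x) ⁻¹' (digits ⁻¹' {Z | consC false Z ∈ S} ∩ Set.Ico (0:ℝ) 1) := by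
    ext x
    simp only [Set.mem_inter_iff, Set.mem_preimage, Set.mem_Ico, Set.mem_ofPred_eq]
    constructor
    · rintro ⟨h, h0, h1⟩
      rw [digits_lo h0 h1] at h
      exact ⟨h, by linarith, by linarith⟩
    · rintro ⟨h, h0, h1⟩
      have h0' : 0 ≤ x := by linarith
      have h1' : x < 1/2 := by linarith
      rw [digits_lo h0' h1']
      exact ⟨h, h0', h1'⟩
  have e2 : digits ⁻¹' S ∩ Set.Ico (1/2:ℝ) 1 =
      (fun x => 2 * x) ⁻¹' ((fun x => x - 1) ⁻¹' (digits ⁻¹' {Z | consC true Z ∈ S} ∩ Set.Ico (0:ℝ) 1)) := by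
    ext x
    simp only [Set.mem_inter_iff, Set.mem_preimage, Set.mem_Ico, Set.mem_ofPred_eq]
    constructor
    · rintro ⟨h, h0, h1⟩
      rw [digits_hi h0 h1] at h
      exact ⟨h, by linarith, by linarith⟩
    · rintro ⟨h, h0, h1⟩
      have h0' : 1/2 ≤ x := by linarith
      have h1' : x < 1 := by linarith
      rw [digits_hi h0' h1']
      exact ⟨h, h0', h1'⟩
  have e3 : digits ⁻¹' S ∩ Set.Ico (0:ℝ) 1 = (digits ⁻¹' S ∩ Set.Ico (0:ℝ) (1/2)) ∪
      (digits ⁻¹' S ∩ Set.Ico (1/2:ℝ) 1) := by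
    rw [← Set.inter_union_distrib_left, Set.Ico_union_Ico_eq_Ico] <;> norm_num
  have hd : Disjoint (digits ⁻¹' S ∩ Set.Ico (0:ℝ) (1/2)) (digits ⁻¹' S ∩ Set.Ico (1/2:ℝ) 1) := by
    rw [Set.disjoint_left]
    rintro x ⟨_, _, h⟩ ⟨_, h', _⟩
    linarith
  have hsub : ∀ A : Set ℝ, volume ((fun x => x - 1) ⁻¹' A) = volume A := fun A => by
    simpa only [sub_eq_add_neg] using measure_preimage_add_right volume (-1 : ℝ) A
  have key : mu S = ENNReal.ofReal (1/2) * mu {Z | consC false Z ∈ S} +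
      ENNReal.ofReal (1/2) * mu {Z | consC true Z ∈ S} := by
    rw [mu_apply hS, e3, measure_union hd ((measurable_digits hS).inter measurableSet_Ico), e1, e2,
      Real.volume_preimage_mul_left (by norm_num), Real.volume_preimage_mul_left (by norm_num),
      hsub, ← mu_apply (hm _), ← mu_apply (hm _)]
    norm_num
  rw [muR, key, ENNReal.toReal_add (ENNReal.mul_ne_top ENNReal.ofReal_ne_top (measure_ne_top _ _))
    (ENNReal.mul_ne_top ENNReal.ofReal_ne_top (measure_ne_top _ _)), ENNReal.toReal_mul,
    ENNReal.toReal_mul, ENNReal.toReal_ofReal (by norm_num)]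
  rfl

theorem muR_nonneg (S : Set Cantor) : 0 ≤ muR S := ENNReal.toReal_nonneg
theorem muR_le_one (S : Set Cantor) : muR S ≤ 1 := measureReal_le_one (μ := mu)
theorem muR_mono {S T : Set Cantor} (h : S ⊆ T) : muR S ≤ muR T := measureReal_mono (μ := mu) h
theorem muR_compl {S : Set Cantor} (hS : MeasurableSet S) : muR Sᶜ = 1 - muR S :=
  probReal_compl_eq_one_sub (μ := mu) hS

/-- all strings of length `k` -/
def strs : ℕ → List (List Bool)
  | 0 => [[]]
  | k+1 => (strs k).map (List.cons false) ++ (strs k).map (List.cons true)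

theorem mem_strs {k : ℕ} {σ : List Bool} : σ ∈ strs k ↔ σ.length = k := by
  induction k generalizing σ with
  | zero => simp [strs]
  | succ k ih =>
    cases σ with
    | nil => simp [strs]
    | cons b σ => cases b <;> simp [strs, ih]

theorem strs_rec (k : ℕ) : strs k = Nat.rec [[]] (fun _ l => l.map (fun x => false :: x) ++ l.map (fun x => true :: x)) k := by
  induction k with
  | zero => rfl
  | succ k ih => rw [strs, ih]

@[fun_prop] theorem fp_strs {α : Type} [Primcodable α] {f : α → ℕ} (hf : Primrec f) :
    Primrec fun x => strs (f x) := by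
  have : Primrec fun x => (Nat.rec [[]] (fun _ l => l.map (fun x => false :: x) ++ l.map (fun x => true :: x)) (f x) : List (List Bool)) := by
    fun_prop
  exact this.of_eq fun x => (strs_rec _).symm

theorem length_strs (k : ℕ) : (strs k).length = 2^k := by
  induction k with
  | zero => rfl
  | succ k ih => simp [strs, ih, pow_succ]; ring

theorem nodup_strs (k : ℕ) : (strs k).Nodup := by
  induction k with
  | zero => simp [strs]
  | succ k ih =>
    rw [strs, List.nodup_append]
    refine ⟨ih.map (List.cons_injective), ih.map (List.cons_injective), ?_⟩
    intro a ha b hb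
    simp only [List.mem_map] at ha hb
    obtain ⟨x, _, rfl⟩ := ha
    obtain ⟨y, _, rfl⟩ := hb
    simp

/-- number of strings of length `k` satisfying `R` -/
def cnt (k : ℕ) (R : List Bool → Bool) : ℕ := ((strs k).filter R).length

theorem cnt_succ (k : ℕ) (R : List Bool → Bool) :
    cnt (k+1) R = cnt k (fun σ => R (false :: σ)) + cnt k (fun σ => R (true :: σ)) := by
  simp [cnt, strs, List.filter_append, List.filter_map, Function.comp_def]

theorem muR_cnt (k : ℕ) (R : List Bool → Bool) :
    muR {X | R (initSeg X k) = true} = cnt k R / 2^k := by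
  induction k generalizing R with
  | zero =>
    cases h : R [] <;> simp [initSeg, h, cnt, strs, muR]
  | succ k ih =>
    rw [muR_half (measurable_seg _ fun σ => R σ = true)]
    simp only [Set.mem_ofPred_eq, initSeg_consC]
    rw [ih fun σ => R (false :: σ), ih fun σ => R (true :: σ), cnt_succ]
    push_cast
    rw [pow_succ]
    field_simp

/-- binary value -/
def bv (σ : List Bool) : ℕ := σ.foldl (fun a b => 2 * a + cond b 1 0) 0

@[fun_prop] theorem fp_bv {α : Type} [Primcodable α] {f : α → List Bool} (hf : Primrec f) :
    Primrec fun x => bv (f x) := by unfold bv; fun_prop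

theorem bv_concat (σ : List Bool) (b : Bool) : bv (σ ++ [b]) = 2 * bv σ + cond b 1 0 := by
  simp [bv]

theorem bv_lt (σ : List Bool) : bv σ < 2 ^ σ.length := by
  induction σ using List.reverseRecOn with
  | nil => simp [bv]
  | append_singleton σ b ih =>
    rw [bv_concat, List.length_append, List.length_singleton, pow_succ]
    cases b <;> simp <;> omega

theorem bv_inj {σ τ : List Bool} (hl : σ.length = τ.length) (h : bv σ = bv τ) : σ = τ := by
  induction σ using List.reverseRecOn generalizing τ with
  | nil => exact (List.length_eq_zero_iff.1 hl.symm).symm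
  | append_singleton σ b ih =>
    rcases List.eq_nil_or_concat' τ with rfl | ⟨τ', b', rfl⟩
    · simp at hl
    · rw [bv_concat, bv_concat] at h
      rw [List.length_append, List.length_append, List.length_singleton, List.length_singleton] at hl
      have hb : b = b' := by cases b <;> cases b' <;> simp at h ⊢ <;> omega
      subst hb
      rw [ih (τ := τ') (by omega) (by omega)]

theorem floor_digits {x : ℝ} (h0 : 0 ≤ x) (h1 : x < 1) (M : ℕ) :
    ⌊x * 2^M⌋ = bv (initSeg (digits x) M) := by
  induction M with
  | zero =>
    simp [initSeg, bv]
    exact ⟨h0, h1⟩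
  | succ M ih =>
    rw [initSeg_succ, bv_concat]
    push_cast
    rw [← ih]
    have e : x * 2^(M+1) = 2 * (x * 2^M) := by ring
    have h2 : ⌊2 * (x * 2^M)⌋ / 2 = ⌊x * 2^M⌋ := by
      have := Int.floor_div_natCast (2 * (x * 2^M)) 2
      push_cast at this
      rw [← this]; congr 1; ring
    rw [digits, e]
    have h3 := Int.emod_add_mul_ediv ⌊2 * (x * 2^M)⌋ 2
    rw [h2] at h3
    by_cases hp : ⌊2 * (x * 2^M)⌋ % 2 = 1
    · simp only [hp, decide_true, cond_true]
      push_cast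
      omega
    · simp only [hp, decide_false, cond_false]
      push_cast
      omega

theorem bv_bounds {x : ℝ} (h0 : 0 ≤ x) (h1 : x < 1) (M : ℕ) :
    (bv (initSeg (digits x) M) : ℝ) ≤ x * 2^M ∧ x * 2^M < bv (initSeg (digits x) M) + 1 := by
  have h := floor_digits h0 h1 M
  have h2 := Int.floor_le (x * 2^M)
  have h3 := Int.lt_floor_add_one (x * 2^M)
  rw [h] at h2 h3
  push_cast at h2 h3
  exact ⟨h2, h3⟩

end RandProb

end

section
namespace RandProb

theorem fp_cnt' {α : Type} [Primcodable α] {f : α → ℕ} {R : α → List Bool → Bool} (hf : Primrec f)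
    (hR : Primrec fun p : α × List Bool => R p.1 p.2) : Primrec fun x => cnt (f x) (R x) := by
  unfold cnt; fun_prop

@[fun_prop] theorem fp_cnt {α : Type} [Primcodable α] {f : α → ℕ} {R : α → List Bool → Bool} (hf : Primrec f)
    (hR : Primrec fun p : α × List Bool => R p.1 p.2) : Primrec fun x => cnt (f x) (fun σ => R x σ) :=
  fp_cnt' hf hR

theorem turing_ev_zero {X Y : Cantor} {N : ℕ} (h : ∀ n ≥ N, X n = false) : TuringLEf (oX X) (oX Y) := by
  refine turing_of_approx (F := fun _ n => some (cond ((initSeg X N).getD n false) 1 0)) (by fun_prop)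
    (fun n => ⟨0, rfl⟩) ?_
  intro n k v hv
  have hv := (Option.some.inj hv).symm
  rw [hv, oX]
  congr 1
  by_cases hn : n < N
  · rw [List.getD_eq_getElem?_getD, initSeg_get X N n hn]; rfl
  · rw [h n (by omega), List.getD_eq_default]; simp; omega

theorem turing_not (X : Cantor) : TuringLEf (oX fun n => !X n) (oX X) := by
  refine turing_of_approx (F := fun σ n => (σ[n]?).map fun b => cond b 0 1) (by fun_prop)
    (fun n => ⟨n+1, ?_⟩) ?_
  · rw [initSeg_get _ _ _ (by omega)]; rfl
  · intro n k v hv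
    by_cases hn : n < k
    · rw [initSeg_get _ _ _ hn] at hv
      simp at hv
      rw [← hv, oX]; cases X n <;> rfl
    · rw [List.getElem?_eq_none (by simp; omega)] at hv; simp at hv

theorem digits_compl (x : ℝ) : (∃ N, ∀ n ≥ N, digits x n = false) ∨
    ∀ n, digits (1-x) n = !digits x n := by
  by_cases h : ∃ (n : ℕ) (z : ℤ), x * 2^n = z
  · left
    obtain ⟨N, z, hz⟩ := h
    refine ⟨N, fun n hn => ?_⟩
    obtain ⟨d, rfl⟩ := Nat.exists_eq_add_of_le hn
    have : x * 2^(N+d+1) = ((2 * (z * 2^d) : ℤ) : ℝ) := by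
      push_cast; rw [← hz]; ring
    simp [digits, this]
    rw [show (2:ℝ) * (z * 2^d) = ((2 * (z * 2^d) : ℤ) : ℝ) by push_cast; ring, Int.floor_intCast]
    omega
  · right
    push Not at h
    intro n
    have h1 : (1-x) * 2^(n+1) = ((2 * 2^n : ℤ) : ℝ) - x * 2^(n+1) := by push_cast; ring
    have h2 : ⌊(1-x) * 2^(n+1)⌋ = 2 * 2^n - ⌊x * 2^(n+1)⌋ - 1 := by
      rw [h1, Int.floor_eq_iff]
      have ha := Int.floor_le (x * 2^(n+1))
      have hb := Int.lt_floor_add_one (x * 2^(n+1))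
      have hc := h (n+1) ⌊x * 2^(n+1)⌋
      have ha' := lt_of_le_of_ne ha (Ne.symm hc)
      push_cast
      constructor <;> linarith
    simp only [digits, h2]
    generalize ⌊x * 2^(n+1)⌋ = z
    generalize (2:ℤ)^n = w
    by_cases hz : z % 2 = 1
    · have : ¬ ((2 * w - z - 1) % 2 = 1) := by omega
      simp [hz, this]
    · have : ((2 * w - z - 1) % 2 = 1) := by omega
      simp [hz, this]

theorem TIncomp_compl {x y : ℝ} (h : TIncompReal x y) : TIncompReal (1-x) (1-y) := by
  have hx : ∀ n, digits (1-x) n = !digits x n := by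
    rcases digits_compl x with ⟨N, hN⟩ | h'
    · exact absurd (turing_ev_zero hN) h.1
    · exact h'
  have hy : ∀ n, digits (1-y) n = !digits y n := by
    rcases digits_compl y with ⟨N, hN⟩ | h'
    · exact absurd (turing_ev_zero hN) h.2
    · exact h'
  have hx' : digits (1-x) = fun n => !digits x n := funext hx
  have hy' : digits (1-y) = fun n => !digits y n := funext hy
  have e : ∀ X : Cantor, TuringLEf (oX X) (oX fun n => !X n) := fun X => by
    have := turing_not fun n => !X n
    simpa using this
  constructor
  · intro h2
    apply h.1
    unfold realOracle at *
    rw [hx', hy'] at h2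
    exact turing_trans (turing_trans (e _) h2) (turing_not _)
  · intro h2
    apply h.2
    unfold realOracle at *
    rw [hx', hy'] at h2
    exact turing_trans (turing_trans (e _) h2) (turing_not _)

end RandProb

end

section
namespace RandProb

/-! ### Module C: hierarchy of classes -/

def Sg : ℕ → ∀ {α : Type} [Primcodable α], (α → Cantor → Prop) → Prop
  | 0, α, _, P => ∃ R : α → List Bool → Bool, (Primrec fun p : α × List Bool => R p.1 p.2) ∧
      ∀ a X, P a X ↔ ∃ k, R a (initSeg X k) = true
  | m+1, α, _, P => ∃ Q : α × ℕ → Cantor → Prop, Sg m Q ∧ ∀ a X, P a X ↔ ∃ k, ¬ Q (a, k) X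

section
variable {α β : Type} [Primcodable α] [Primcodable β]

theorem Sg.congr {m : ℕ} {P P' : α → Cantor → Prop} (h : Sg m P) (e : ∀ a X, P' a X ↔ P a X) :
    Sg m P' := by
  have : P' = P := by funext a X; exact propext (e a X)
  rwa [this]

theorem Sg.subst {m : ℕ} {P : α → Cantor → Prop} (h : Sg m P) {f : β → α} (hf : Primrec f) :
    Sg m (fun b X => P (f b) X) := by
  induction m generalizing α β with
  | zero =>
    obtain ⟨R, hR, e⟩ := h
    exact ⟨fun b σ => R (f b) σ, by fun_prop, fun b X => e _ _⟩
  | succ m ih =>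
    obtain ⟨Q, hQ, e⟩ := h
    exact ⟨fun p X => Q (f p.1, p.2) X, ih hQ (f := fun p : β × ℕ => (f p.1, p.2)) (by fun_prop), fun b X => e _ _⟩

theorem Sg.primX {m : ℕ} {R : α → List Bool → Bool} {f : α → ℕ}
    (hR : Primrec fun p : α × List Bool => R p.1 p.2) (hf : Primrec f) :
    Sg m (fun a X => R a (initSeg X (f a)) = true) := by
  induction m generalizing α with
  | zero =>
    refine ⟨fun a σ => decide (f a ≤ σ.length) && R a (σ.take (f a)), by fun_prop, fun a X => ?_⟩
    constructor
    · intro h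
      exact ⟨f a, by simpa [initSeg_take] using h⟩
    · rintro ⟨k, hk⟩
      simp at hk
      rw [← initSeg_take X hk.1]; exact hk.2
  | succ m ih =>
    exact ⟨_, ih (α := α × ℕ) (R := fun p σ => !R p.1 σ) (f := fun p => f p.1) (by fun_prop) (by fun_prop),
      fun a X => by simp⟩

theorem Sg.prim {m : ℕ} {R : α → Prop} [DecidablePred R] (hR : Primrec fun a => decide (R a)) :
    Sg m (fun a (_ : Cantor) => R a) :=
  (Sg.primX (m := m) (R := fun a _ => decide (R a)) (f := fun _ => 0) (hR.comp Primrec.fst) (by fun_prop)).congr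
    fun a X => by simp

theorem Sg.not {m : ℕ} {P : α → Cantor → Prop} (h : Sg m P) : Sg (m+1) (fun a X => ¬ P a X) :=
  ⟨fun p X => P p.1 X, h.subst (by fun_prop), fun a X => by simp⟩

theorem Sg.lift {m : ℕ} {P : α → Cantor → Prop} (h : Sg m P) : Sg (m+1) P := by
  induction m generalizing α with
  | zero =>
    obtain ⟨R, hR, e⟩ := h
    exact ⟨_, Sg.primX (α := α × ℕ) (R := fun p σ => !R p.1 σ) (f := fun p => p.2) (by fun_prop) (by fun_prop),
      fun a X => by simp [e]⟩
  | succ m ih =>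
    obtain ⟨Q, hQ, e⟩ := h
    exact ⟨Q, ih hQ, e⟩

theorem Sg.le {m m' : ℕ} {P : α → Cantor → Prop} (h : Sg m P) (hm : m ≤ m') : Sg m' P := by
  induction hm with
  | refl => exact h
  | step _ ih => exact ih.lift

theorem exists_seg_iff {X : Cantor} {R : List Bool → Bool} :
    (∃ k, (List.range ((initSeg X k).length + 1)).any (fun i => R ((initSeg X k).take i)) = true) ↔
    ∃ k, R (initSeg X k) = true := by
  constructor
  · rintro ⟨k, hk⟩
    simp only [List.any_eq_true, List.mem_range, length_initSeg] at hk
    obtain ⟨i, hi, h⟩ := hk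
    rw [initSeg_take X (by omega)] at h
    exact ⟨i, h⟩
  · rintro ⟨k, hk⟩
    refine ⟨k, ?_⟩
    simp only [List.any_eq_true, List.mem_range, length_initSeg]
    exact ⟨k, by omega, by rwa [initSeg_take X le_rfl]⟩

/-- base level with monotone witness -/
theorem Sg.mono0 {P : α → Cantor → Prop} (h : Sg 0 P) :
    ∃ R : α → List Bool → Bool, (Primrec fun p : α × List Bool => R p.1 p.2) ∧
      (∀ a σ τ, σ <+: τ → R a σ = true → R a τ = true) ∧
      ∀ a X, P a X ↔ ∃ k, R a (initSeg X k) = true := by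
  obtain ⟨R, hR, e⟩ := h
  refine ⟨fun a σ => (List.range (σ.length + 1)).any fun i => R a (σ.take i), by fun_prop, ?_, ?_⟩
  · intro a σ τ hp h
    simp only [List.any_eq_true, List.mem_range] at h ⊢
    obtain ⟨i, hi, h⟩ := h
    obtain ⟨ρ, rfl⟩ := hp
    refine ⟨i, by simp; omega, ?_⟩
    rwa [List.take_append_of_le_length (by omega)]
  · intro a X
    rw [e]
    exact exists_seg_iff.symm

theorem Sg.andor {m : ℕ} : ∀ {α : Type} [Primcodable α] {P P' : α → Cantor → Prop}, Sg m P → Sg m P' →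
    Sg m (fun a X => P a X ∧ P' a X) ∧ Sg m (fun a X => P a X ∨ P' a X) := by
  induction m with
  | zero =>
    intro α _ P P' h h'
    obtain ⟨R, hR, hm, e⟩ := h.mono0
    obtain ⟨R', hR', hm', e'⟩ := h'.mono0
    refine ⟨⟨fun a σ => R a σ && R' a σ, by fun_prop, fun a X => ?_⟩,
      ⟨fun a σ => R a σ || R' a σ, by fun_prop, fun a X => ?_⟩⟩
    · simp only [e, e']
      constructor
      · rintro ⟨⟨k, hk⟩, k', hk'⟩
        refine ⟨max k k', ?_⟩
        simp [hm _ _ _ (initSeg_pfx X (le_max_left k k')) hk, hm' _ _ _ (initSeg_pfx X (le_max_right k k')) hk']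
      · rintro ⟨k, hk⟩
        simp at hk
        exact ⟨⟨k, hk.1⟩, k, hk.2⟩
    · simp only [e, e', ← exists_or]
      simp
  | succ m ih =>
    intro α _ P P' h h'
    obtain ⟨Q, hQ, e⟩ := h
    obtain ⟨Q', hQ', e'⟩ := h'
    have a1 : Sg m (fun (p : α × ℕ) X => Q (p.1, p.2.unpair.1) X) := hQ.subst (f := fun p : α × ℕ => (p.1, p.2.unpair.1)) (by fun_prop)
    have a2 : Sg m (fun (p : α × ℕ) X => Q' (p.1, p.2.unpair.2) X) := hQ'.subst (f := fun p : α × ℕ => (p.1, p.2.unpair.2)) (by fun_prop)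
    refine ⟨⟨_, (ih a1 a2).2, fun a X => ?_⟩, ⟨_, (ih hQ hQ').1, fun a X => ?_⟩⟩
    · simp only [e, e']
      constructor
      · rintro ⟨⟨k, hk⟩, k', hk'⟩
        exact ⟨Nat.pair k k', by simp [hk, hk']⟩
      · rintro ⟨k, hk⟩
        push Not at hk
        exact ⟨⟨_, hk.1⟩, _, hk.2⟩
    · simp only [e, e', ← exists_or]
      simp only [not_and_or]

theorem Sg.and {m : ℕ} {P P' : α → Cantor → Prop} (h : Sg m P) (h' : Sg m P') :
    Sg m (fun a X => P a X ∧ P' a X) := (Sg.andor h h').1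
theorem Sg.or {m : ℕ} {P P' : α → Cantor → Prop} (h : Sg m P) (h' : Sg m P') :
    Sg m (fun a X => P a X ∨ P' a X) := (Sg.andor h h').2

theorem Sg.ex {m : ℕ} {P : α × ℕ → Cantor → Prop} (h : Sg m P) :
    Sg m (fun a X => ∃ n, P (a, n) X) := by
  cases m with
  | zero =>
    obtain ⟨R, hR, hm, e⟩ := h.mono0
    refine ⟨fun a σ => (List.range (σ.length+1)).any fun n => R (a, n) σ, by fun_prop, fun a X => ?_⟩
    simp only [e, List.any_eq_true, List.mem_range, length_initSeg]
    constructor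
    · rintro ⟨n, k, h⟩
      exact ⟨max n k, n, by omega, hm _ _ _ (initSeg_pfx X (le_max_right n k)) h⟩
    · rintro ⟨k, n, _, h⟩
      exact ⟨n, k, h⟩
  | succ m =>
    obtain ⟨Q, hQ, e⟩ := h
    refine ⟨fun p X => Q ((p.1, p.2.unpair.1), p.2.unpair.2) X,
      hQ.subst (f := fun p : α × ℕ => ((p.1, p.2.unpair.1), p.2.unpair.2)) (by fun_prop), fun a X => ?_⟩
    simp only [e]
    constructor
    · rintro ⟨n, k, h⟩
      exact ⟨Nat.pair n k, by simpa using h⟩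
    · rintro ⟨k, h⟩
      exact ⟨_, _, h⟩

theorem Sg.exT [Inhabited β] {m : ℕ} {P : α × β → Cantor → Prop} (h : Sg m P) :
    Sg m (fun a X => ∃ n, P (a, n) X) := by
  have : Sg m (fun (p : α × ℕ) X => P (p.1, (Encodable.decode p.2).getD default) X) :=
    h.subst (f := fun p : α × ℕ => (p.1, ((Encodable.decode p.2 : Option β).getD default))) (by fun_prop)
  refine this.ex.congr fun a X => ?_
  constructor
  · rintro ⟨b, hb⟩
    exact ⟨Encodable.encode b, by simpa using hb⟩
  · rintro ⟨n, hn⟩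
    exact ⟨_, hn⟩

theorem Sg.ball {m : ℕ} {P : α × ℕ → Cantor → Prop} (h : Sg m P) {f : α → ℕ} (hf : Primrec f) :
    Sg m (fun a X => ∀ n < f a, P (a, n) X) := by
  cases m with
  | zero =>
    obtain ⟨R, hR, hm, e⟩ := h.mono0
    refine ⟨fun a σ => (List.range (f a)).all fun n => R (a, n) σ, by fun_prop, fun a X => ?_⟩
    simp only [e, List.all_eq_true, List.mem_range]
    constructor
    · intro h
      choose! k hk using h
      refine ⟨(Finset.range (f a)).sup k, fun n hn => ?_⟩
      exact hm _ _ _ (initSeg_pfx X (Finset.le_sup (Finset.mem_range.2 hn))) (hk n hn)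
    · rintro ⟨k, h⟩ n hn
      exact ⟨k, h n hn⟩
  | succ m =>
    obtain ⟨Q, hQ, e⟩ := h
    have a1 : Sg m (fun (p : (α × List ℕ) × ℕ) X => p.2 < f p.1.1 ∧ Q ((p.1.1, p.2), p.1.2.getD p.2 0) X) :=
      (Sg.prim (by fun_prop)).and (hQ.subst (f := fun (p : (α × List ℕ) × ℕ) => ((p.1.1, p.2), p.1.2.getD p.2 0)) (by fun_prop))
    refine a1.ex.not.exT.congr fun a X => ?_
    simp only [e]
    constructor
    · intro h
      choose! k hk using h
      refine ⟨(List.range (f a)).map k, ?_⟩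
      rintro ⟨n, hn, hq⟩
      apply hk n hn
      simpa [List.getD_eq_getElem?_getD, hn] using hq
    · rintro ⟨l, hl⟩ n hn
      exact ⟨_, fun hq => hl ⟨n, hn, hq⟩⟩

theorem Sg.measurable {m : ℕ} {P : α → Cantor → Prop} (h : Sg m P) (a : α) : MeasurableSet {X | P a X} := by
  induction m generalizing α with
  | zero =>
    obtain ⟨R, hR, e⟩ := h
    have : {X | P a X} = ⋃ k, {X | R a (initSeg X k) = true} := by ext X; simp [e]
    rw [this]
    exact MeasurableSet.iUnion fun k => measurable_seg k fun σ => R a σ = true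
  | succ m ih =>
    obtain ⟨Q, hQ, e⟩ := h
    have : {X | P a X} = ⋃ k, {X | Q (a, k) X}ᶜ := by ext X; simp [e]
    rw [this]
    exact MeasurableSet.iUnion fun k => (ih hQ (a, k)).compl

theorem muR_union_lt {S : ℕ → Set Cantor} (hS : Monotone S) (d : ℝ) :
    d < muR (⋃ k, S k) ↔ ∃ k, d < muR (S k) := by
  constructor
  · intro h
    have ht : Filter.Tendsto (fun k => muR (S k)) Filter.atTop (nhds (muR (⋃ k, S k))) :=
      (ENNReal.tendsto_toReal (measure_ne_top mu _)).comp (tendsto_measure_iUnion_atTop hS)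
    exact (ht.eventually (lt_mem_nhds h)).exists
  · rintro ⟨k, hk⟩
    exact hk.trans_le (muR_mono (Set.subset_iUnion S k))

theorem exists_dyadic {x y : ℝ} (h0 : 0 ≤ x) (h : x < y) : ∃ A j : ℕ, x ≤ (A : ℝ) / 2^j ∧ (A:ℝ) / 2^j < y := by
  obtain ⟨j, hj⟩ := exists_pow_lt_of_lt_one (sub_pos.2 h) (show (1/2 : ℝ) < 1 by norm_num)
  refine ⟨⌈x * 2^j⌉₊, j, ?_, ?_⟩
  · rw [le_div_iff₀ (by positivity)]; exact Nat.le_ceil _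
  · have := Nat.ceil_lt_add_one (show 0 ≤ x * 2^j by positivity)
    rw [div_lt_iff₀ (by positivity)]
    refine this.trans_le ?_
    have h2 : (1/2 : ℝ)^j * 2^j = 1 := by rw [← mul_pow]; norm_num
    nlinarith [show (0:ℝ) < 2^j by positivity]

theorem Sg.measure {m : ℕ} {P : α → Cantor → Prop} (h : Sg m P) :
    Sg m (fun (p : α × ℕ × ℕ) (_ : Cantor) => (p.2.1 : ℝ) / 2^p.2.2 < muR {X | P p.1 X}) := by
  induction m generalizing α with
  | zero =>
    obtain ⟨R, hR, hm, e⟩ := h.mono0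
    refine (Sg.prim (m := 0) (R := fun q : (α × ℕ × ℕ) × ℕ => q.1.2.1 * 2^q.2 < cnt q.2 (R q.1.1) * 2^q.1.2.2)
      (by
        have : Primrec fun q : (α × ℕ × ℕ) × ℕ => cnt q.2 (R q.1.1) := fp_cnt' (by fun_prop) (by fun_prop)
        fun_prop)).ex.congr fun p X => ?_
    have : {X | P p.1 X} = ⋃ k, {X | R p.1 (initSeg X k) = true} := by ext X; simp [e]
    rw [this, muR_union_lt]
    · refine exists_congr fun k => ?_
      rw [muR_cnt, div_lt_div_iff₀ (by positivity) (by positivity)]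
      norm_cast
    · intro i j hij X hX
      exact hm _ _ _ (initSeg_pfx X hij) hX
  | succ m ih =>
    obtain ⟨Q, hQ, e⟩ := h
    have hT : Sg m (fun (q : α × ℕ) X => ∀ k < q.2, Q (q.1, k) X) :=
      Sg.ball (P := fun (q : (α × ℕ) × ℕ) X => Q (q.1.1, q.2) X)
        (hQ.subst (f := fun (q : (α × ℕ) × ℕ) => (q.1.1, q.2)) (by fun_prop)) (f := fun q => q.2) (by fun_prop)
    have h2 := (((ih hT).not.subst (β := (α × ℕ × ℕ) × ℕ × ℕ × ℕ)
      (f := fun q => ((q.1.1, q.2.1), q.2.2.1, q.2.2.2)) (by fun_prop)).and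
      (Sg.prim (R := fun q : (α × ℕ × ℕ) × ℕ × ℕ × ℕ => q.1.2.1 * 2^q.2.2.2 + q.2.2.1 * 2^q.1.2.2 < 2^q.1.2.2 * 2^q.2.2.2)
        (by fun_prop))).exT
    refine h2.congr fun p X => ?_
    have : {X | P p.1 X} = ⋃ K, {X | ∀ k < K, Q (p.1, k) X}ᶜ := by
      ext X
      simp only [e, Set.mem_ofPred_eq, Set.mem_iUnion, Set.mem_compl_iff, not_forall]
      constructor
      · rintro ⟨k, hk⟩; exact ⟨k+1, k, by omega, hk⟩
      · rintro ⟨_, k, _, hk⟩; exact ⟨k, hk⟩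
    rw [this, muR_union_lt]
    swap
    · intro i j hij X hX hX'
      exact hX fun k hk => hX' k (by omega)
    simp only [Prod.exists]
    refine exists_congr fun K => ?_
    rw [muR_compl (hT.measurable (p.1, K))]
    have hc : ∀ A j : ℕ, (p.2.1 * 2^j + A * 2^p.2.2 < 2^p.2.2 * 2^j) ↔ (A : ℝ)/2^j < 1 - (p.2.1:ℝ)/2^p.2.2 := by
      intro A j
      have h1 : (0:ℝ) < 2^j := by positivity
      have h2 : (0:ℝ) < 2^p.2.2 := by positivity
      rw [lt_sub_iff_add_lt, div_add_div _ _ h1.ne' h2.ne', div_lt_one (by positivity)]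
      rw [← Nat.cast_lt (α := ℝ)]
      push_cast
      constructor <;> intro h <;> nlinarith
    simp only [hc, not_lt]
    constructor
    · intro h
      have := exists_dyadic (muR_nonneg {X | ∀ k < K, Q (p.1, k) X}) (y := 1 - (p.2.1:ℝ)/2^p.2.2) (by linarith)
      exact this
    · rintro ⟨A, j, h1, h2⟩
      linarith

/-- extracting the matrix of an X-independent Σ₂ predicate -/
theorem Sg.matrix1 {P : α → Cantor → Prop} (h : Sg 1 P) :
    ∃ R : α → ℕ → ℕ → Bool, (Primrec fun p : α × ℕ × ℕ => R p.1 p.2.1 p.2.2) ∧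
      ∀ a, P a X0 ↔ ∃ y, ∀ l, R a y l = false := by
  obtain ⟨Q, ⟨R, hR, e⟩, e'⟩ := h
  refine ⟨fun a y l => R (a, y) (List.replicate l false), by fun_prop, fun a => ?_⟩
  simp [e', e, initSeg_X0]

theorem Sg.matrix2 {P : α → Cantor → Prop} (h : Sg 2 P) :
    ∃ R : α → ℕ → ℕ → ℕ → Bool, (Primrec fun p : α × ℕ × ℕ × ℕ => R p.1 p.2.1 p.2.2.1 p.2.2.2) ∧
      ∀ a, P a X0 ↔ ∃ y, ∀ z, ∃ l, R a y z l = true := by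
  obtain ⟨Q, ⟨Q', ⟨R, hR, e⟩, e'⟩, e''⟩ := h
  refine ⟨fun a y z l => R ((a, y), z) (List.replicate l false), by fun_prop, fun a => ?_⟩
  simp [e', e, e'', initSeg_X0]

end

end RandProb

end

section
namespace RandProb

/-- bounded search -/
def lf (t : ℕ) (p : ℕ → Bool) : ℕ := ((List.range t).find? p).getD t

theorem fp_lf' {α : Type} [Primcodable α] {f : α → ℕ} {R : α → ℕ → Bool} (hf : Primrec f)
    (hR : Primrec fun p : α × ℕ => R p.1 p.2) : Primrec fun x => lf (f x) (R x) := by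
  unfold lf; fun_prop

@[fun_prop] theorem fp_lf {α : Type} [Primcodable α] {f : α → ℕ} {R : α → ℕ → Bool} (hf : Primrec f)
    (hR : Primrec fun p : α × ℕ => R p.1 p.2) : Primrec fun x => lf (f x) (fun n => R x n) :=
  fp_lf' hf hR

theorem lf_spec (t : ℕ) (p : ℕ → Bool) : lf t p ≤ t ∧ (∀ z < lf t p, p z = false) ∧
    (lf t p < t → p (lf t p) = true) := by
  unfold lf
  cases h : (List.range t).find? p with
  | none =>
    simp only [Option.getD_none]
    refine ⟨le_rfl, fun z hz => ?_, fun h => absurd h (lt_irrefl _)⟩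
    have := List.find?_eq_none.1 h z (List.mem_range.2 hz)
    simpa using this
  | some x =>
    simp only [Option.getD_some]
    have h1 := List.find?_some h
    have h2 := List.mem_range.1 (List.mem_of_find?_eq_some h)
    refine ⟨h2.le, fun z hz => ?_, fun _ => h1⟩
    rw [List.find?_range_eq_some] at h
    have := h.2.2 z hz
    simpa using this

theorem lf_le_of {t z : ℕ} {p : ℕ → Bool} (h : p z = true) : lf t p ≤ z := by
  by_contra hc
  push Not at hc
  have := (lf_spec t p).2.1 z hc
  simp [h] at this

theorem lf_le (t : ℕ) (p : ℕ → Bool) : lf t p ≤ t := (lf_spec t p).1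
theorem lf_min {t z : ℕ} {p : ℕ → Bool} (h : z < lf t p) : p z = false := (lf_spec t p).2.1 z h
theorem lf_true {t : ℕ} {p : ℕ → Bool} (h : lf t p < t) : p (lf t p) = true := (lf_spec t p).2.2 h
theorem le_lf {t z : ℕ} {p : ℕ → Bool} (h : ∀ y < z, p y = false) (hz : z ≤ t) : z ≤ lf t p := by
  by_contra hc
  push Not at hc
  have := lf_true (lt_of_lt_of_le hc hz)
  rw [h _ hc] at this
  cases this

/-- some value is taken infinitely often -/
def Rec (h : ℕ → ℕ) : Prop := ∃ v, ∀ N, ∃ t ≥ N, h t = v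

theorem rec_of_bdd {h : ℕ → ℕ} {y : ℕ} (hy : ∀ N, ∃ t ≥ N, h t ≤ y) : Rec h := by
  by_contra hc
  unfold Rec at hc
  push Not at hc
  choose N hN using hc
  obtain ⟨t, ht, hty⟩ := hy ((Finset.range (y+1)).sup N)
  exact hN (h t) t (le_trans (Finset.le_sup (f := N) (Finset.mem_range.2 (by omega))) ht) rfl

theorem not_rec {h : ℕ → ℕ} (hr : ¬ Rec h) (y : ℕ) : ∃ N, ∀ t ≥ N, y < h t := by
  by_contra hc
  push Not at hc
  exact hr (rec_of_bdd hc)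

section
variable {α : Type} [Primcodable α]

def evc (R : ℕ → ℕ → Bool) (t : ℕ) : ℕ := lf t fun z => !((List.range t).any fun l => R z l)

theorem evc_mono (R : ℕ → ℕ → Bool) : Monotone (evc R) := by
  refine monotone_nat_of_le_succ fun t => ?_
  unfold evc
  refine le_lf (fun y hy => ?_) ((lf_le _ _).trans (by omega))
  have := lf_min hy
  simp only [Bool.not_eq_false', List.any_eq_true, List.mem_range] at this ⊢
  obtain ⟨l, hl, h⟩ := this
  exact ⟨l, by omega, h⟩

theorem evc_unb (R : ℕ → ℕ → Bool) : (∀ N, ∃ t, N < evc R t) ↔ ∀ z, ∃ l, R z l = true := by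
  constructor
  · intro h z
    obtain ⟨t, ht⟩ := h z
    have := lf_min ht
    simp only [Bool.not_eq_false', List.any_eq_true, List.mem_range] at this
    obtain ⟨l, _, h⟩ := this
    exact ⟨l, h⟩
  · intro h N
    choose l hl using h
    refine ⟨max (N+1) ((Finset.range (N+1)).sup l + 1), ?_⟩
    refine le_lf (z := N+1) (fun y hy => ?_) (le_max_left _ _)
    simp only [Bool.not_eq_false', List.any_eq_true, List.mem_range]
    have := Finset.le_sup (f := l) (Finset.mem_range.2 hy)
    exact ⟨l y, by omega, hl y⟩

theorem evc_inc (R : ℕ → ℕ → Bool) : (∀ N, ∃ t ≥ N, evc R t < evc R (t+1)) ↔ (∀ N, ∃ t, N < evc R t) := by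
  constructor
  · intro h N
    induction N with
    | zero => obtain ⟨t, _, h⟩ := h 0; exact ⟨t+1, by omega⟩
    | succ N ih =>
      obtain ⟨t, ht⟩ := ih
      obtain ⟨t', h1, h2⟩ := h t
      have := evc_mono R h1
      exact ⟨t'+1, by omega⟩
  · intro h N
    by_contra hc
    push Not at hc
    obtain ⟨t, ht⟩ := h (evc R N)
    have : ∀ d, evc R (N + d) ≤ evc R N := by
      intro d
      induction d with
      | zero => exact le_rfl
      | succ d ih => exact (hc (N+d) (by omega)).trans ih
    have h2 := this t
    have h3 := evc_mono R (show t ≤ N + t by omega)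
    omega

theorem Sg.EV {P : α → Cantor → Prop} (h : Sg 2 P) :
    ∃ h : α → ℕ → ℕ, (Primrec fun p : α × ℕ => h p.1 p.2) ∧ ∀ a, P a X0 ↔ Rec (h a) := by
  obtain ⟨R, hR, e⟩ := h.matrix2
  refine ⟨fun a t => lf t fun y => decide (evc (R a y) t < evc (R a y) (t+1)), ?_, fun a => ?_⟩
  · unfold evc; fun_prop
  · rw [e]
    constructor
    · rintro ⟨y, hy⟩
      refine rec_of_bdd (y := y) fun N => ?_
      obtain ⟨t, ht, h⟩ := (evc_inc _).2 ((evc_unb _).2 hy) N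
      exact ⟨t, ht, lf_le_of (by simpa using h)⟩
    · rintro ⟨v, hv⟩
      refine ⟨v, (evc_unb _).1 ((evc_inc _).1 fun N => ?_)⟩
      obtain ⟨t, ht, h⟩ := hv (max N (v+1))
      dsimp only at h
      refine ⟨t, (le_max_left _ _).trans ht, ?_⟩
      have := lf_true (t := t) (p := fun y => decide (evc (R a y) t < evc (R a y) (t+1)))
        (by rw [h]; omega)
      simp only [decide_eq_true_eq] at this
      rw [h] at this
      exact this

end

end RandProb

end

section
namespace RandProb

/-! ### Module D: the core construction -/

def Nv (τ : List Bool) : ℕ := τ.foldl (fun a b => 4 * a + cond b 1 0) 0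

@[fun_prop] theorem fp_Nv {α : Type} [Primcodable α] {f : α → List Bool} (hf : Primrec f) :
    Primrec fun x => Nv (f x) := by unfold Nv; fun_prop

theorem Nv_concat (σ : List Bool) (b : Bool) : Nv (σ ++ [b]) = 4 * Nv σ + cond b 1 0 := by
  simp [Nv]

theorem Nv_inj {σ τ : List Bool} (hl : σ.length = τ.length) (h : Nv σ = Nv τ) : σ = τ := by
  induction σ using List.reverseRecOn generalizing τ with
  | nil => exact (List.length_eq_zero_iff.1 hl.symm).symm
  | append_singleton σ b ih =>
    rcases List.eq_nil_or_concat' τ with rfl | ⟨τ', b', rfl⟩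
    · simp at hl
    · rw [Nv_concat, Nv_concat] at h
      rw [List.length_append, List.length_append, List.length_singleton, List.length_singleton] at hl
      have hb : b = b' := by cases b <;> cases b' <;> simp at h ⊢ <;> omega
      subst hb
      rw [ih (τ := τ') (by omega) (by omega)]

/-- difference test: `p = 0`: `(o - x)/4 = v`; else `(x - o)/4 = v`. -/
def dtest (p x o v : ℕ) : Bool :=
  if p = 0 then decide (x ≤ o) && decide ((o - x) / 4 = v) else decide (o ≤ x) && decide ((x - o) / 4 = v)

noncomputable def outw (e M : ℕ) (σ : List Bool) : List Bool :=
  (List.range M).map fun n => decide (phi e σ n = some 1)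

noncomputable def bits (e M : ℕ) (σ : List Bool) : Bool :=
  (List.range M).all fun n => decide (phi e σ n = some 0) || decide (phi e σ n = some 1)

noncomputable def U (s : ℕ) (τ σ : List Bool) : Bool :=
  decide (2 * τ.length + 4 ≤ σ.length) && (bits (s/2) (2 * τ.length + 4) σ &&
    dtest (s % 2) (bv (σ.take (2 * τ.length + 4))) (bv (outw (s/2) (2 * τ.length + 4) σ)) (Nv τ))

@[fun_prop] theorem fp_U {α : Type} [Primcodable α] {s : α → ℕ} {τ σ : α → List Bool} (hs : Primrec s)
    (ht : Primrec τ) (hσ : Primrec σ) : Primrec fun x => U (s x) (τ x) (σ x) := by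
  unfold U bits outw dtest; fun_prop

theorem bits_mono {e M : ℕ} {σ σ' : List Bool} (h : σ <+: σ') (hb : bits e M σ = true) :
    bits e M σ' = true ∧ outw e M σ' = outw e M σ := by
  simp only [bits, List.all_eq_true, List.mem_range, Bool.or_eq_true, decide_eq_true_eq] at hb ⊢
  constructor
  · intro n hn
    rcases hb n hn with h' | h'
    · left; exact phi_mono h h'
    · right; exact phi_mono h h'
  · unfold outw
    refine List.map_congr_left fun n hn => ?_
    rcases hb n (List.mem_range.1 hn) with h' | h' <;> rw [phi_mono h h', h']

theorem U_mono {s : ℕ} {τ σ σ' : List Bool} (h : σ <+: σ') (hU : U s τ σ = true) : U s τ σ' = true := by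
  unfold U at *
  simp only [Bool.and_eq_true, decide_eq_true_eq] at hU ⊢
  obtain ⟨h1, h2, h3⟩ := hU
  obtain ⟨b1, b2⟩ := bits_mono h h2
  refine ⟨h1.trans h.length_le, b1, ?_⟩
  rw [b2]
  obtain ⟨ρ, rfl⟩ := h
  rwa [List.take_append_of_le_length h1]

theorem U_uniq {s : ℕ} {τ τ' σ : List Bool} (hl : τ.length = τ'.length) (h : U s τ σ = true)
    (h' : U s τ' σ = true) : τ = τ' := by
  unfold U dtest at *
  simp only [Bool.and_eq_true, decide_eq_true_eq] at h h'
  obtain ⟨h1, h2, h3⟩ := h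
  obtain ⟨h1', h2', h3'⟩ := h'
  rw [← hl] at h3'
  refine Nv_inj hl ?_
  split_ifs at h3 h3'
  · simp only [Bool.and_eq_true, decide_eq_true_eq] at h3 h3'
    omega
  · simp only [Bool.and_eq_true, decide_eq_true_eq] at h3 h3'
    omega

noncomputable def pick (s : ℕ) (τ : List Bool) (k : ℕ) : List Bool :=
  ((strs (s+6)).find? fun κ => decide (cnt k (fun σ => U s (τ ++ κ) σ) * 2^(s+6) ≤ 2^k)).getD
    (List.replicate (s+6) false)

noncomputable def tau : ℕ → ℕ → List Bool
  | 0, _ => []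
  | s+1, k => tau s k ++ pick s (tau s k) k

theorem fp_pick {α : Type} [Primcodable α] {s k : α → ℕ} {τ : α → List Bool} (hs : Primrec s)
    (ht : Primrec τ) (hk : Primrec k) : Primrec fun x => pick (s x) (τ x) (k x) := by
  unfold pick; fun_prop

@[fun_prop] theorem fp_tau {α : Type} [Primcodable α] {s k : α → ℕ} (hs : Primrec s)
    (hk : Primrec k) : Primrec fun x => tau (s x) (k x) := by
  have h1 : Primrec fun p : α × ℕ × List Bool => pick p.2.1 p.2.2 (k p.1) := fp_pick (by fun_prop) (by fun_prop) (by fun_prop)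
  have : Primrec fun x => (Nat.rec [] (fun s τ => τ ++ pick s τ (k x)) (s x) : List Bool) := by
    fun_prop
  refine this.of_eq fun x => ?_
  induction s x with
  | zero => rfl
  | succ n ih => rw [tau, ← ih]

theorem cnt_le_pow (k : ℕ) (R : List Bool → Bool) : cnt k R ≤ 2^k := by
  rw [← length_strs k]; exact List.length_filter_le _ _

theorem cnt_mono_step {R : List Bool → Bool} (hR : ∀ σ σ', σ <+: σ' → R σ = true → R σ' = true) {k k' : ℕ}
    (h : k ≤ k') : (cnt k R : ℝ) / 2^k ≤ cnt k' R / 2^k' := by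
  rw [← muR_cnt, ← muR_cnt]
  exact muR_mono fun X hX => hR _ _ (initSeg_pfx X h) hX

/-- pigeonhole -/
theorem pick_exists (s : ℕ) (τ : List Bool) (k : ℕ) :
    ∃ κ ∈ strs (s+6), cnt k (fun σ => U s (τ ++ κ) σ) * 2^(s+6) ≤ 2^k := by
  by_contra hc
  push Not at hc
  have h1 : ((strs (s+6)).map fun κ => cnt k (fun σ => U s (τ ++ κ) σ)).sum ≤ 2^k := by
    have key : ∀ l : List (List Bool), l.Nodup → (∀ κ ∈ l, κ.length = s+6) →
        (l.map fun κ => cnt k (fun σ => U s (τ ++ κ) σ)).sum = cnt k (fun σ => l.any fun κ => U s (τ ++ κ) σ) := by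
      intro l hn hl
      induction l with
      | nil => simp [cnt]
      | cons κ l ih =>
        rw [List.map_cons, List.sum_cons, ih hn.of_cons (fun κ h => hl κ (List.mem_cons_of_mem _ h))]
        unfold cnt
        simp only [List.any_cons]
        have : ∀ L : List (List Bool), (L.filter fun σ => U s (τ ++ κ) σ).length +
            (L.filter fun σ => l.any fun κ => U s (τ ++ κ) σ).length =
            (L.filter fun σ => U s (τ ++ κ) σ || l.any fun κ => U s (τ ++ κ) σ).length := by
          intro L
          induction L with
          | nil => rfl
          | cons σ L ihL =>
            simp only [List.filter_cons]
            have hdisj : ¬ (U s (τ ++ κ) σ = true ∧ (l.any fun κ => U s (τ ++ κ) σ) = true) := by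
              rintro ⟨h1, h2⟩
              simp only [List.any_eq_true] at h2
              obtain ⟨κ', hκ', h2⟩ := h2
              have := U_uniq (by simp [hl κ (List.mem_cons_self), hl κ' (List.mem_cons_of_mem _ hκ')]) h1 h2
              have := List.append_cancel_left this
              subst this
              exact (List.nodup_cons.1 hn).1 hκ'
            cases h1 : U s (τ ++ κ) σ <;> cases h2 : (l.any fun κ => U s (τ ++ κ) σ) <;>
              simp [h1, h2] at hdisj ⊢ <;> omega
        exact this _
    rw [key _ (nodup_strs _) (fun κ h => mem_strs.1 h)]
    exact cnt_le_pow _ _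
  have h2 : (strs (s+6)).length * (2^k + 1) ≤ ((strs (s+6)).map fun κ => cnt k (fun σ => U s (τ ++ κ) σ) * 2^(s+6)).sum := by
    have := List.card_nsmul_le_sum ((strs (s+6)).map fun κ => cnt k (fun σ => U s (τ ++ κ) σ) * 2^(s+6)) (2^k+1)
      (by
        intro x hx
        obtain ⟨κ, hκ, rfl⟩ := List.mem_map.1 hx
        exact hc κ hκ)
    simpa using this
  rw [List.sum_map_mul_right, length_strs] at h2
  have h3 : 0 < 2^(s+6) := by positivity
  nlinarith

theorem pick_spec (s : ℕ) (τ : List Bool) (k : ℕ) : (pick s τ k).length = s + 6 ∧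
    cnt k (fun σ => U s (τ ++ pick s τ k) σ) * 2^(s+6) ≤ 2^k := by
  unfold pick
  cases h : (strs (s+6)).find? fun κ => decide (cnt k (fun σ => U s (τ ++ κ) σ) * 2^(s+6) ≤ 2^k) with
  | none =>
    obtain ⟨κ, hκ, h'⟩ := pick_exists s τ k
    have := List.find?_eq_none.1 h κ hκ
    simp at this
    omega
  | some κ =>
    simp only [Option.getD_some]
    have h1 := List.find?_some h
    have h2 := mem_strs.1 (List.mem_of_find?_eq_some h)
    exact ⟨h2, by simpa using h1⟩

theorem ev_list {β : Type} (l : List β) {P : ℕ → β → Prop} (h : ∀ x ∈ l, ∃ K, ∀ k ≥ K, P k x) :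
    ∃ K, ∀ k ≥ K, ∀ x ∈ l, P k x := by
  induction l with
  | nil => exact ⟨0, by simp⟩
  | cons a l ih =>
    obtain ⟨K, hK⟩ := ih fun x hx => h x (List.mem_cons_of_mem _ hx)
    obtain ⟨K', hK'⟩ := h a List.mem_cons_self
    refine ⟨max K K', fun k hk x hx => ?_⟩
    rcases List.mem_cons.1 hx with rfl | hx
    · exact hK' k (le_of_max_le_right hk)
    · exact hK k (le_of_max_le_left hk) x hx

theorem pick_conv (s : ℕ) (τ : List Bool) : ∃ κ K, ∀ k ≥ K, pick s τ k = κ := by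
  have h : ∀ κ ∈ strs (s+6), ∃ K, ∀ k ≥ K,
      decide (cnt k (fun σ => U s (τ ++ κ) σ) * 2^(s+6) ≤ 2^k) =
      decide (∀ k, cnt k (fun σ => U s (τ ++ κ) σ) * 2^(s+6) ≤ 2^k) := by
    intro κ _
    by_cases hb : ∀ k, cnt k (fun σ => U s (τ ++ κ) σ) * 2^(s+6) ≤ 2^k
    · exact ⟨0, fun k _ => by simp [hb]⟩
    · obtain ⟨K, hK⟩ := not_forall.1 hb
      refine ⟨K, fun k hk => ?_⟩
      have : ¬ cnt k (fun σ => U s (τ ++ κ) σ) * 2^(s+6) ≤ 2^k := by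
        intro h2
        apply hK
        have h3 := cnt_mono_step (R := fun σ => U s (τ ++ κ) σ) (fun σ σ' h h' => U_mono h h') hk
        have h4 : (cnt k (fun σ => U s (τ ++ κ) σ) : ℝ) * 2^(s+6) ≤ 2^k := by exact_mod_cast h2
        rw [← Nat.cast_le (α := ℝ)]
        push_cast
        rw [div_le_div_iff₀ (by positivity) (by positivity)] at h3
        have p1 : (0:ℝ) < 2^k := by positivity
        have p2 : (0:ℝ) < 2^K := by positivity
        have p3 : (0:ℝ) < 2^(s+6) := by positivity
        refine le_of_mul_le_mul_right ?_ p1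
        calc _ = ((cnt K fun σ => U s (τ ++ κ) σ : ℝ) * 2^k) * 2^(s+6) := by ring
          _ ≤ ((cnt k fun σ => U s (τ ++ κ) σ : ℝ) * 2^K) * 2^(s+6) := by gcongr
          _ = ((cnt k fun σ => U s (τ ++ κ) σ : ℝ) * 2^(s+6)) * 2^K := by ring
          _ ≤ 2^k * 2^K := by gcongr
          _ = _ := by ring
      simp [this, hb]
  obtain ⟨K, hK⟩ := ev_list _ h
  refine ⟨pick s τ K, K, fun k hk => ?_⟩
  unfold pick
  congr 1
  have e : ∀ l : List (List Bool), ∀ p q : List Bool → Bool, (∀ x ∈ l, p x = q x) → l.find? p = l.find? q := by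
    intro l p q h
    induction l with
    | nil => rfl
    | cons a l ih =>
      rw [List.find?_cons, List.find?_cons, h a List.mem_cons_self, ih fun x hx => h x (List.mem_cons_of_mem _ hx)]
  exact e _ _ _ fun x hx => (hK k hk x hx).trans (hK K le_rfl x hx).symm

theorem tau_conv (s : ℕ) : ∃ τ K, ∀ k ≥ K, tau s k = τ := by
  induction s with
  | zero => exact ⟨[], 0, fun _ _ => rfl⟩
  | succ s ih =>
    obtain ⟨τ, K, hK⟩ := ih
    obtain ⟨κ, K', hK'⟩ := pick_conv s τ
    exact ⟨τ ++ κ, max K K', fun k hk => by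
      rw [tau, hK k (le_of_max_le_left hk), hK' k (le_of_max_le_right hk)]⟩

noncomputable def tl (s : ℕ) : List Bool := (tau_conv s).choose

theorem tl_spec (s : ℕ) : ∃ K, ∀ k ≥ K, tau s k = tl s := (tau_conv s).choose_spec

def TT : ℕ → ℕ
  | 0 => 0
  | s+1 => TT s + (s+6)

theorem TT_ge (s : ℕ) : s ≤ TT s := by
  induction s with
  | zero => simp [TT]
  | succ s ih => rw [TT]; omega

theorem length_tau (s k : ℕ) : (tau s k).length = TT s := by
  induction s with
  | zero => rfl
  | succ s ih => rw [tau, List.length_append, ih, (pick_spec _ _ _).1, TT]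

theorem length_tl (s : ℕ) : (tl s).length = TT s := by
  obtain ⟨K, hK⟩ := tl_spec s
  rw [← hK K le_rfl, length_tau]

theorem tl_succ (s : ℕ) : tl s <+: tl (s+1) := by
  obtain ⟨K, hK⟩ := tl_spec s
  obtain ⟨K', hK'⟩ := tl_spec (s+1)
  rw [← hK (max K K') (le_max_left _ _), ← hK' (max K K') (le_max_right _ _), tau]
  exact List.prefix_append _ _

theorem tl_le {s s' : ℕ} (h : s ≤ s') : tl s <+: tl s' := by
  induction h with
  | refl => exact List.prefix_rfl
  | step _ ih => exact ih.trans (tl_succ _)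

/-- the limit real -/
noncomputable def bet : Cantor := fun j => (tl (j+1)).getD j false

theorem tl_get (s j : ℕ) (h : j < TT s) : (tl s)[j]? = some (bet j) := by
  have h1 : j < (tl (j+1)).length := by rw [length_tl]; exact TT_ge (j+1)
  have h2 : j < (tl s).length := by rwa [length_tl]
  have e : (tl s)[j]? = (tl (j+1))[j]? := by
    rcases le_total s (j+1) with h' | h'
    · obtain ⟨ρ, hρ⟩ := tl_le h'
      rw [← hρ, List.getElem?_append_left h2]
    · obtain ⟨ρ, hρ⟩ := tl_le h'
      rw [← hρ, List.getElem?_append_left h1]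
  rw [e, bet, List.getD_eq_getElem?_getD, List.getElem?_eq_getElem h1]
  rfl

theorem tl_eq (s : ℕ) : tl s = initSeg bet (TT s) := by
  refine List.ext_getElem? fun j => ?_
  by_cases h : j < TT s
  · rw [tl_get s j h, initSeg_get _ _ _ h]
  · rw [List.getElem?_eq_none (by rw [length_tl]; omega), List.getElem?_eq_none (by simp; omega)]

theorem tl_cnt (s : ℕ) : ∃ K, ∀ k ≥ K, cnt k (fun σ => U s (tl (s+1)) σ) * 2^(s+6) ≤ 2^k := by
  obtain ⟨K, hK⟩ := tl_spec (s+1)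
  refine ⟨K, fun k hk => ?_⟩
  rw [← hK k hk, tau]
  exact (pick_spec s (tau s k) k).2

theorem tl_mu (s k : ℕ) : muR {X | U s (tl (s+1)) (initSeg X k) = true} ≤ (1/2)^(s+6) := by
  obtain ⟨K, hK⟩ := tl_cnt s
  have h := hK (max K k) (le_max_left _ _)
  have h1 : muR {X | U s (tl (s+1)) (initSeg X k) = true} ≤
      muR {X | (fun σ => U s (tl (s+1)) σ) (initSeg X (max K k)) = true} :=
    muR_mono fun X hX => U_mono (initSeg_pfx X (le_max_right _ _)) hX
  refine h1.trans ?_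
  rw [muR_cnt]
  rw [div_le_iff₀ (by positivity), one_div, inv_pow, inv_mul_eq_div, le_div_iff₀ (by positivity)]
  exact_mod_cast h

end RandProb

end

section
namespace RandProb

section jump
variable (G : ℕ → Prop) (a l : ℕ → ℝ) (c : ℝ)

def sl (L : List ℕ) : ℝ := (L.map l).sum

def Der : List ℕ → Prop
  | [] => True
  | i :: L => Der L ∧ i ∉ L ∧ G i ∧ a i < c + sl l L

def JJ (i : ℕ) : Prop := ∃ L, Der G a l c L ∧ i ∈ L

variable {G a l c}

theorem Der.nodup {L : List ℕ} (h : Der G a l c L) : L.Nodup := by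
  induction L with
  | nil => simp
  | cons i L ih => exact List.nodup_cons.2 ⟨h.2.1, ih h.1⟩

theorem Der.mem_G {L : List ℕ} (h : Der G a l c L) : ∀ i ∈ L, G i := by
  induction L with
  | nil => simp
  | cons i L ih =>
    intro j hj
    rcases List.mem_cons.1 hj with rfl | hj
    · exact h.2.2.1
    · exact ih h.1 j hj

theorem JJ.mem_G {i : ℕ} (h : JJ G a l c i) : G i := by
  obtain ⟨L, hL, hi⟩ := h
  exact hL.mem_G i hi

theorem sl_eq {L : List ℕ} (h : L.Nodup) : sl l L = ∑ x ∈ L.toFinset, l x :=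
  (List.sum_toFinset l h).symm

theorem sl_mono (hl : ∀ i, 0 ≤ l i) {L L' : List ℕ} (h : L.Nodup) (h' : L'.Nodup) (hs : L ⊆ L') : sl l L ≤ sl l L' := by
  rw [sl_eq h, sl_eq h']
  refine Finset.sum_le_sum_of_subset_of_nonneg ?_ fun i _ _ => hl i
  intro x hx
  simp only [List.mem_toFinset] at hx ⊢
  exact hs hx

theorem Der.merge (hl : ∀ i, 0 ≤ l i) {L1 L2 : List ℕ} (h1 : Der G a l c L1) (h2 : Der G a l c L2) :
    ∃ L, Der G a l c L ∧ L1 ⊆ L ∧ L2 ⊆ L := by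
  induction L1 with
  | nil => exact ⟨L2, h2, by simp, by simp⟩
  | cons i L1 ih =>
    obtain ⟨L, hL, s1, s2⟩ := ih h1.1
    by_cases hi : i ∈ L
    · exact ⟨L, hL, by simp [hi, s1], s2⟩
    · refine ⟨i :: L, ⟨hL, hi, h1.2.2.1, ?_⟩, List.cons_subset_cons _ s1, fun x hx => List.mem_cons_of_mem _ (s2 hx)⟩
      have := sl_mono hl h1.1.nodup hL.nodup s1
      linarith [h1.2.2.2]

theorem JJ_fin (hl : ∀ i, 0 ≤ l i) (F : Finset ℕ) (h : ∀ i ∈ F, JJ G a l c i) :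
    ∃ L, Der G a l c L ∧ ∀ i ∈ F, i ∈ L := by
  induction F using Finset.induction_on with
  | empty => exact ⟨[], trivial, by simp⟩
  | insert i F hi ih =>
    obtain ⟨L, hL, h1⟩ := ih fun i hi => h i (Finset.mem_insert_of_mem hi)
    obtain ⟨L', hL', h2⟩ := h i (Finset.mem_insert_self _ _)
    obtain ⟨L'', hL'', s1, s2⟩ := hL.merge hl hL'
    refine ⟨L'', hL'', fun j hj => ?_⟩
    rcases Finset.mem_insert.1 hj with rfl | hj
    · exact s2 h2
    · exact s1 (h1 j hj)

theorem Der.gap (hl : ∀ i, 0 ≤ l i) {L : List ℕ} (h : Der G a l c L) : ∀ i ∈ L, a i + l i < c + sl l L := by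
  induction L with
  | nil => simp
  | cons i L ih =>
    intro j hj
    have e : sl l (i :: L) = l i + sl l L := by simp [sl]
    rcases List.mem_cons.1 hj with rfl | hj
    · linarith [h.2.2.2]
    · linarith [ih h.1 j hj, hl i]

theorem JJ_avoid (hl : ∀ i, 0 ≤ l i) (hs : Summable fun i => if JJ G a l c i then l i else 0) {i : ℕ} (hG : G i) :
    ¬ (a i < c + ∑' i, (if JJ G a l c i then l i else 0) ∧
      c + (∑' i, if JJ G a l c i then l i else 0) < a i + l i) := by
  rintro ⟨h1, h2⟩
  have hle : ∀ L, Der G a l c L → sl l L ≤ ∑' i, if JJ G a l c i then l i else 0 := by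
    intro L hL
    rw [sl_eq hL.nodup]
    refine le_trans (le_of_eq ?_) (hs.sum_le_tsum L.toFinset fun i _ => by split_ifs; exacts [hl i, le_rfl])
    refine Finset.sum_congr rfl fun x hx => ?_
    rw [if_pos ⟨L, hL, List.mem_toFinset.1 hx⟩]
  by_cases hi : JJ G a l c i
  · obtain ⟨L, hL, hiL⟩ := hi
    have := hL.gap hl i hiL
    linarith [hle L hL]
  · have : ∑' i, (if JJ G a l c i then l i else 0) ≤ a i - c := by
      refine hs.tsum_le_of_sum_le fun F => ?_
      rw [← Finset.sum_filter]
      obtain ⟨L, hL, h3⟩ := JJ_fin hl (F.filter fun i => JJ G a l c i) fun i hi => (Finset.mem_filter.1 hi).2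
      have h4 : ∑ x ∈ F.filter (fun i => JJ G a l c i), l x ≤ sl l L := by
        rw [sl_eq hL.nodup]
        exact Finset.sum_le_sum_of_subset_of_nonneg (fun x hx => List.mem_toFinset.2 (h3 x hx)) fun i _ _ => hl i
      by_contra hc
      push Not at hc
      exact hi ⟨i :: L, ⟨hL, fun hiL => hi ⟨L, hL, hiL⟩, hG, by linarith⟩, List.mem_cons_self⟩
    linarith

theorem Der_iff {L : List ℕ} : Der G a l c L ↔ ∀ n < L.length, (L.getD n 0 ∉ L.drop (n+1)) ∧
    (G (L.getD n 0) ∧ a (L.getD n 0) < c + sl l (L.drop (n+1))) := by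
  induction L with
  | nil => simp [Der]
  | cons i L ih =>
    rw [Der, ih]
    constructor
    · rintro ⟨h, h2⟩ n hn
      cases n with
      | zero => simpa using h2
      | succ n => simpa using h n (by simpa using hn)
    · intro h
      exact ⟨fun n hn => by simpa using h (n+1) (by simpa using hn), by simpa using h 0 (by simp)⟩

end jump

/-! ### indices -/

abbrev Quad := ℕ × List Bool × List Bool × ℕ

def quad (i : ℕ) : Quad := ((Encodable.decode (i/2) : Option Quad).getD (0, [], [], 0))

@[fun_prop] theorem fp_quad {α : Type} [Primcodable α] {f : α → ℕ} (hf : Primrec f) :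
    Primrec fun x => quad (f x) := by unfold quad; fun_prop

theorem encode_len (q : Quad) : q.2.2.1.length ≤ Encodable.encode q := by
  obtain ⟨s, τ, σ, b⟩ := q
  rw [Encodable.encode_prod_val, Encodable.encode_prod_val, Encodable.encode_prod_val]
  refine le_trans ?_ (Nat.right_le_pair _ _)
  refine le_trans ?_ (Nat.right_le_pair _ _)
  refine le_trans ?_ (Nat.left_le_pair _ _)
  exact Encodable.length_le_encode _

theorem quad_encode (q : Quad) : quad (2 * Encodable.encode q) = q := by
  unfold quad
  rw [Nat.mul_div_cancel_left _ (by norm_num), Encodable.encodek, Option.getD_some]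

attribute [irreducible] quad

noncomputable def bshift (s : ℕ) (m : ℕ) (τ : List Bool) : ℕ := (s % 2) * (Nv τ * 2^m / 4^(m+1))

@[fun_prop] theorem fp_bshift {α : Type} [Primcodable α] {f g : α → ℕ} {h : α → List Bool} (hf : Primrec f) (hg : Primrec g)
    (hh : Primrec h) : Primrec fun x => bshift (f x) (g x) (h x) := by unfold bshift; fun_prop

noncomputable def act (i k : ℕ) : Bool :=
  decide (i % 2 = 1) ||
  (decide (Encodable.encode (quad i) = i/2) && (decide ((quad i).2.1 = tau ((quad i).1 + 1) k) &&
   (U (quad i).1 (quad i).2.1 (quad i).2.2.1 && (!U (quad i).1 (quad i).2.1 (quad i).2.2.1.dropLast &&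
    decide ((quad i).2.2.2 = bshift (quad i).1 (quad i).2.2.1.length
      ((tau (quad i).2.2.1.length k).take (quad i).2.2.1.length))))))

@[fun_prop] theorem fp_act {α : Type} [Primcodable α] {f g : α → ℕ} (hf : Primrec f) (hg : Primrec g) :
    Primrec fun x => act (f x) (g x) := by unfold act; fun_prop

/-- eventually active -/
def Act (i : ℕ) : Prop := ∃ K, ∀ k ≥ K, act i k = true

def lenI (i : ℕ) : ℕ := if i % 2 = 1 then i + 2 else (quad i).2.2.1.length - 3

@[fun_prop] theorem fp_lenI {α : Type} [Primcodable α] {f : α → ℕ} (hf : Primrec f) :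
    Primrec fun x => lenI (f x) := by unfold lenI; fun_prop

theorem tl_take (m : ℕ) : (tl m).take m = initSeg bet m := by
  rw [tl_eq, initSeg_take _ (TT_ge m)]

theorem act_conv (i : ℕ) : ∃ K, ∀ k ≥ K, act i k = act i K := by
  obtain ⟨K1, h1⟩ := tl_spec ((quad i).1 + 1)
  obtain ⟨K2, h2⟩ := tl_spec (quad i).2.2.1.length
  refine ⟨max K1 K2, fun k hk => ?_⟩
  unfold act
  rw [h1 k (le_of_max_le_left hk), h2 k (le_of_max_le_right hk), h1 _ (le_max_left _ _), h2 _ (le_max_right _ _)]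

theorem act_conv' (i : ℕ) : ∃ K, ∀ k ≥ K, act i k = decide (Act i) := by
  obtain ⟨K, hK⟩ := act_conv i
  refine ⟨K, fun k hk => ?_⟩
  rw [hK k hk]
  by_cases h : Act i
  · obtain ⟨K', hK'⟩ := id h
    have := hK' (max K K') (le_max_right _ _)
    rw [hK _ (le_max_left _ _)] at this
    simp [this, h]
  · simp only [h, decide_false]
    by_contra hc
    exact h ⟨K, fun k hk => by rw [hK k hk]; simpa using hc⟩

theorem Act_odd {i : ℕ} (h : i % 2 = 1) : Act i := ⟨0, fun k _ => by simp [act, h]⟩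

theorem Act_even {i : ℕ} (h : i % 2 = 0) : Act i ↔ Encodable.encode (quad i) = i/2 ∧
    (quad i).2.1 = tl ((quad i).1 + 1) ∧ U (quad i).1 (quad i).2.1 (quad i).2.2.1 = true ∧
    U (quad i).1 (quad i).2.1 (quad i).2.2.1.dropLast = false ∧
    (quad i).2.2.2 = bshift (quad i).1 (quad i).2.2.1.length (initSeg bet (quad i).2.2.1.length) := by
  obtain ⟨K1, h1⟩ := tl_spec ((quad i).1 + 1)
  obtain ⟨K2, h2⟩ := tl_spec (quad i).2.2.1.length
  have e : ∀ k ≥ max K1 K2, (act i k = true ↔ Encodable.encode (quad i) = i/2 ∧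
    (quad i).2.1 = tl ((quad i).1 + 1) ∧ U (quad i).1 (quad i).2.1 (quad i).2.2.1 = true ∧
    U (quad i).1 (quad i).2.1 (quad i).2.2.1.dropLast = false ∧
    (quad i).2.2.2 = bshift (quad i).1 (quad i).2.2.1.length (initSeg bet (quad i).2.2.1.length)) := by
    intro k hk
    unfold act
    rw [h1 k (le_of_max_le_left hk), h2 k (le_of_max_le_right hk), tl_take]
    simp [h]
  constructor
  · rintro ⟨K, hK⟩
    exact (e (max K (max K1 K2)) (le_max_right _ _)).1 (hK _ (le_max_left _ _))
  · intro h'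
    exact ⟨_, fun k hk => (e k hk).2 h'⟩

theorem Act_len {i : ℕ} (h : i % 2 = 0) (hA : Act i) : 3 ≤ (quad i).2.2.1.length := by
  rw [Act_even h] at hA
  have := hA.2.2.1
  unfold U at this
  simp only [Bool.and_eq_true, decide_eq_true_eq] at this
  omega

theorem lenI_le (i : ℕ) (hA : Act i) : lenI i ≤ i + 2 := by
  unfold lenI
  split_ifs with h
  · exact le_rfl
  · have h' : i % 2 = 0 := by omega
    have h1 := ((Act_even h').1 hA).1
    have h2 : (quad i).2.2.1.length ≤ Encodable.encode (quad i) := encode_len _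
    omega

noncomputable def LI (i : ℕ) : ℝ := (1/2)^(lenI i)

theorem LI_pos (i : ℕ) : 0 < LI i := by unfold LI; positivity

theorem muR_cyl (σ : List Bool) : muR {X | initSeg X σ.length = σ} = (1/2)^σ.length := by
  have h := muR_cnt σ.length (fun τ => decide (τ = σ))
  simp only [decide_eq_true_eq] at h
  rw [h]
  have : cnt σ.length (fun τ => decide (τ = σ)) = 1 := by
    unfold cnt
    have h2 : (strs σ.length).filter (fun τ => decide (τ = σ)) = (strs σ.length).filter (· == σ) :=
      List.filter_congr fun x _ => by by_cases h : x = σ <;> simp [h]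
    rw [h2, List.filter_beq, List.length_replicate]
    exact List.count_eq_one_of_mem (nodup_strs _) (mem_strs.2 rfl)
  rw [this]; simp

/-- the active even indices of test `s` have small total weight -/
theorem sum_test (s : ℕ) (F : Finset ℕ) (hF : ∀ i ∈ F, i % 2 = 0 ∧ Act i ∧ (quad i).1 = s) :
    ∑ i ∈ F, LI i ≤ (1/2)^(s+3) := by
  have hm : ∀ i, MeasurableSet {X : Cantor | initSeg X (quad i).2.2.1.length = (quad i).2.2.1} := fun i =>
    measurable_seg _ fun τ => τ = (quad i).2.2.1
  have e : ∀ i ∈ F, LI i = 8 * muR {X | initSeg X (quad i).2.2.1.length = (quad i).2.2.1} := by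
    intro i hi
    obtain ⟨h1, h2, h3⟩ := hF i hi
    have h4 := Act_len h1 h2
    rw [muR_cyl, LI, lenI, if_neg (by omega)]
    obtain ⟨d, hd⟩ := Nat.exists_eq_add_of_le h4
    rw [hd, Nat.add_sub_cancel_left, pow_add]; norm_num; ring
  rw [Finset.sum_congr rfl e, ← Finset.mul_sum]
  have hU : ∑ i ∈ F, muR {X | initSeg X (quad i).2.2.1.length = (quad i).2.2.1} =
      muR (⋃ i ∈ F, {X | initSeg X (quad i).2.2.1.length = (quad i).2.2.1}) := by
    symm
    refine measureReal_biUnion_finset (μ := mu) ?_ fun i _ => hm i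
    intro i hi j hj hij
    show Disjoint _ _
    rw [Set.disjoint_left]
    intro X hX hX'
    simp only [Set.mem_ofPred_eq] at hX hX'
    obtain ⟨i1, i2, i3⟩ := hF i hi
    obtain ⟨j1, j2, j3⟩ := hF j hj
    rw [Act_even i1, i3] at i2
    rw [Act_even j1, j3] at j2
    obtain ⟨a1, a2, a3, a4, a5⟩ := i2
    obtain ⟨b1, b2, b3, b4, b5⟩ := j2
    have key : ∀ σ σ' : List Bool, initSeg X σ.length = σ → initSeg X σ'.length = σ' →
        U s (tl (s+1)) σ = true → U s (tl (s+1)) σ'.dropLast = false → σ'.length ≤ σ.length := by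
      intro σ σ' h1 h2 h3 h4
      by_contra hc
      push Not at hc
      have : σ <+: σ'.dropLast := by
        rw [← h1, ← h2, List.dropLast_eq_take, initSeg_take X (by simp)]
        exact initSeg_pfx X (by simp; omega)
      rw [U_mono this h3] at h4
      cases h4
    rw [a2] at a3 a4
    rw [b2] at b3 b4
    have l1 := key _ _ hX hX' a3 b4
    have l2 := key _ _ hX' hX b3 a4
    have hσ : (quad i).2.2.1 = (quad j).2.2.1 := by
      rw [← hX, ← hX', le_antisymm l2 l1]
    have hq : quad i = quad j := by
      refine Prod.ext (i3.trans j3.symm) (Prod.ext (a2.trans b2.symm) (Prod.ext hσ ?_))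
      rw [a5, b5, hσ]
    rw [hq, b1] at a1
    apply hij
    omega
  rw [hU]
  have h8 : (1/2:ℝ)^(s+3) = 8 * (1/2)^(s+6) := by rw [pow_add, pow_add]; norm_num; ring
  rw [h8]
  refine mul_le_mul_of_nonneg_left ?_ (by norm_num)
  refine le_trans (muR_mono ?_) (tl_mu s (F.sup fun i => (quad i).2.2.1.length))
  intro X hX
  simp only [Set.mem_iUnion] at hX
  obtain ⟨i, hi, hX⟩ := hX
  obtain ⟨i1, i2, i3⟩ := hF i hi
  rw [Act_even i1, i3] at i2
  have := i2.2.2.1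
  rw [i2.2.1, ← hX] at this
  exact U_mono (initSeg_pfx X (Finset.le_sup (f := fun i => (quad i).2.2.1.length) hi)) this

theorem sum_half (N c : ℕ) : ∑ i ∈ Finset.range N, (1/2:ℝ)^(i+c+1) ≤ (1/2)^c := by
  have : ∑ i ∈ Finset.range N, (1/2:ℝ)^(i+c+1) = (1/2)^c - (1/2)^(N+c) := by
    induction N with
    | zero => simp
    | succ N ih =>
      rw [Finset.sum_range_succ, ih]
      ring
  rw [this]
  have : (0:ℝ) ≤ (1/2)^(N+c) := by positivity
  linarith

theorem sum_Act (F : Finset ℕ) : ∑ i ∈ F, (if Act i then LI i else 0) ≤ 3/4 := by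
  rw [← Finset.sum_filter, ← Finset.sum_filter_add_sum_filter_not (F.filter fun i => Act i) fun i => i % 2 = 1]
  have h1 : ∑ x ∈ (F.filter fun i => Act i) with x % 2 = 1, LI x ≤ 1/2 := by
    obtain ⟨N, hN⟩ := ((F.filter fun i => Act i).filter fun x => x % 2 = 1).exists_nat_subset_range
    have := sum_half N 1
    rw [pow_one] at this
    refine le_trans ?_ this
    rw [Finset.sum_congr rfl (g := fun i => (1/2:ℝ)^(i+1+1))]
    · exact Finset.sum_le_sum_of_subset_of_nonneg hN fun i _ _ => by positivity
    · intro i hi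
      rw [LI, lenI, if_pos (Finset.mem_filter.1 hi).2]
  have h2 : ∑ x ∈ (F.filter fun i => Act i) with ¬ x % 2 = 1, LI x ≤ 1/4 := by
    set E := (F.filter fun i => Act i).filter fun x => ¬ x % 2 = 1 with hE
    obtain ⟨N, hN⟩ := (E.image fun i => (quad i).1).exists_nat_subset_range
    rw [← Finset.sum_fiberwise_of_maps_to (g := fun i => (quad i).1) (t := Finset.range N)
      fun i hi => hN (Finset.mem_image_of_mem _ hi)]
    have := sum_half N 2
    refine le_trans ?_ (this.trans (by norm_num))
    refine Finset.sum_le_sum fun s _ => sum_test s _ fun i hi => ?_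
    simp only [hE, Finset.mem_filter] at hi
    exact ⟨by omega, hi.1.1.2, hi.2⟩
  linarith

end RandProb

end

section
namespace RandProb

noncomputable def ell (i : ℕ) : ℝ := LI i / 2
noncomputable def aI (i : ℕ) : ℝ := ((bv (quad i).2.2.1 : ℝ) - (quad i).2.2.2 - 2) / 2^(quad i).2.2.1.length
def GI (i : ℕ) : Prop := i % 2 = 0 ∧ Act i
def J1 (ρ : ℝ) : ℕ → Prop := JJ GI aI ell (ρ/2)
def BJ (i : ℕ) : Prop := i % 2 = 1 ∧ bet (i/2) = true
def J2 (ρ : ℝ) (i : ℕ) : Prop := J1 ρ i ∨ BJ i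
noncomputable def Wt (J : ℕ → Prop) : ℝ := ∑' i, if J i then LI i else 0

theorem J1_act {ρ : ℝ} {i : ℕ} (h : J1 ρ i) : Act i := (JJ.mem_G h).2
theorem J2_act {ρ : ℝ} {i : ℕ} (h : J2 ρ i) : Act i := h.elim J1_act fun h => Act_odd h.1

theorem LI_sum_le {J : ℕ → Prop} (h : ∀ i, J i → Act i) (F : Finset ℕ) :
    ∑ i ∈ F, (if J i then LI i else 0) ≤ 3/4 := by
  refine le_trans (Finset.sum_le_sum fun i _ => ?_) (sum_Act F)
  by_cases hJ : J i
  · rw [if_pos hJ, if_pos (h i hJ)]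
  · rw [if_neg hJ]; split_ifs; exacts [(LI_pos i).le, le_rfl]

theorem ite_LI_nonneg (J : ℕ → Prop) (i : ℕ) : 0 ≤ if J i then LI i else 0 := by
  split_ifs; exacts [(LI_pos i).le, le_rfl]

theorem LI_summable {J : ℕ → Prop} (h : ∀ i, J i → Act i) : Summable fun i => if J i then LI i else 0 :=
  summable_of_sum_le (ite_LI_nonneg J) (LI_sum_le h)

theorem Wt_le {J : ℕ → Prop} (h : ∀ i, J i → Act i) : Wt J ≤ 3/4 :=
  (LI_summable h).tsum_le_of_sum_le (LI_sum_le h)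

theorem Wt_nonneg (J : ℕ → Prop) : 0 ≤ Wt J := tsum_nonneg (ite_LI_nonneg J)

noncomputable def bp : ℝ := Wt BJ / 2

theorem Wt_J2 (ρ : ℝ) : Wt (J2 ρ) / 2 = Wt (J1 ρ) / 2 + bp := by
  have h : Wt (J2 ρ) = Wt (J1 ρ) + Wt BJ := by
    unfold Wt
    rw [← (LI_summable (J := J1 ρ) fun i => J1_act).tsum_add (LI_summable (J := BJ) fun i h => Act_odd h.1)]
    refine tsum_congr fun i => ?_
    by_cases h1 : J1 ρ i
    · have : i % 2 = 0 := (JJ.mem_G h1).1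
      have h2 : ¬ BJ i := fun h => by have := h.1; omega
      have h3 : J2 ρ i := Or.inl h1
      rw [if_pos h3, if_pos h1, if_neg h2, add_zero]
    · by_cases h2 : BJ i
      · have h3 : J2 ρ i := Or.inr h2
        rw [if_pos h3, if_neg h1, if_pos h2, zero_add]
      · have h3 : ¬ J2 ρ i := not_or.2 ⟨h1, h2⟩
        rw [if_neg h3, if_neg h1, if_neg h2, zero_add]
  rw [h, bp]; ring

theorem Nv_sum (n : ℕ) : ∑ i ∈ Finset.range (2*n), (if BJ i then LI i else 0) =
    2 * (Nv (initSeg bet n) / 4^(n+1)) := by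
  induction n with
  | zero => simp [initSeg, Nv]
  | succ n ih =>
    rw [show 2*(n+1) = 2*n+1+1 by ring, Finset.sum_range_succ, Finset.sum_range_succ, ih, initSeg_succ, Nv_concat,
      if_neg (fun h : BJ (2*n) => by have := h.1; omega)]
    have e : (2*n+1)/2 = n := by omega
    have e2 : LI (2*n+1) = 2 * (1 / 4^(n+1+1)) := by
      rw [LI, lenI, if_pos (by omega), show 2*n+1+2 = 2*(n+1)+1 by ring, pow_succ, pow_mul, pow_succ (4:ℝ)]
      rw [show ((1:ℝ)/2)^2 = 1/4 by norm_num, div_pow, one_pow]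
      have : (4:ℝ)^(n+1) ≠ 0 := by positivity
      field_simp; norm_num
    have h4 : (4:ℝ)^(n+1+1) = 4 * 4^(n+1) := by ring
    have h5 : (4:ℝ)^(n+1) ≠ 0 := by positivity
    cases hb : bet n
    · rw [if_neg (fun h : BJ (2*n+1) => by have := h.2; rw [e, hb] at this; cases this), h4]
      push_cast; simp only [Bool.cond_false, Nat.cast_zero]; field_simp; ring
    · rw [if_pos (show BJ (2*n+1) from ⟨by omega, by rw [e]; exact hb⟩), e2, h4]
      push_cast; simp only [Bool.cond_true, Nat.cast_one]; field_simp; ring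

theorem bp_lo (n : ℕ) : (Nv (initSeg bet n) : ℝ) ≤ bp * 4^(n+1) := by
  have h := (LI_summable (J := BJ) fun i h => Act_odd h.1).sum_le_tsum
    (Finset.range (2*n)) fun i _ => ite_LI_nonneg _ i
  rw [Nv_sum] at h
  have h2 : (Nv (initSeg bet n) : ℝ) / 4^(n+1) ≤ bp := by rw [bp, Wt]; linarith
  rwa [div_le_iff₀ (by positivity)] at h2

theorem Nv_grow (n d : ℕ) : 3 * (Nv (initSeg bet (n+d)) : ℝ) + 1 ≤ (3 * Nv (initSeg bet n) + 1) * 4^d := by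
  induction d with
  | zero => simp
  | succ d ih =>
    rw [← add_assoc, initSeg_succ, Nv_concat, pow_succ]
    have : ((cond (bet (n+d)) 1 0 : ℕ) : ℝ) ≤ 1 := by cases bet (n+d) <;> simp
    push_cast
    linarith

theorem bp_hi (n : ℕ) : bp * 4^(n+1) ≤ Nv (initSeg bet n) + 1/3 := by
  rw [← le_div_iff₀ (by positivity), bp]
  rw [div_le_iff₀ (by norm_num)]
  refine (LI_summable (J := BJ) fun i h => Act_odd h.1).tsum_le_of_sum_le fun F => ?_
  obtain ⟨N, hN⟩ := F.exists_nat_subset_range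
  have h1 : F ⊆ Finset.range (2*(n+N)) := hN.trans (Finset.range_mono (by omega))
  refine le_trans (Finset.sum_le_sum_of_subset_of_nonneg h1 fun i _ _ => ite_LI_nonneg _ i) ?_
  rw [Nv_sum, mul_comm]
  refine mul_le_mul_of_nonneg_right ?_ (by norm_num)
  rw [div_le_div_iff₀ (by positivity) (by positivity)]
  have h := Nv_grow n N
  have h4 : (4:ℝ)^(n+N+1) = 4^(n+1) * 4^N := by ring
  have h5 : (0:ℝ) < 4^(n+1) := by positivity
  rw [h4]
  nlinarith

theorem bp_nonneg : 0 ≤ bp := div_nonneg (Wt_nonneg _) (by norm_num)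

theorem bits_true {c : CodeO} {x y : ℝ} (h : ∀ n, c.eval (realOracle x) n = Part.some (realOracle y n)) (M : ℕ) :
    ∃ k0, ∀ k ≥ k0, bits c.encode M (initSeg (digits x) k) = true ∧
      outw c.encode M (initSeg (digits x) k) = initSeg (digits y) M := by
  obtain ⟨K, hK⟩ := ev_list (List.range M) (P := fun k n => phi c.encode (initSeg (digits x) k) n = some (realOracle y n))
    fun n _ => (turing_phi (X := digits x) h n).2
  refine ⟨K, fun k hk => ⟨?_, ?_⟩⟩
  · simp only [bits, List.all_eq_true, Bool.or_eq_true, decide_eq_true_eq]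
    intro n hn
    rw [hK k hk n hn, realOracle, oX]
    cases digits y n <;> simp
  · unfold outw initSeg
    refine List.map_congr_left fun n hn => ?_
    have := hK k hk n hn
    unfold initSeg at this
    rw [this, realOracle, oX]
    cases digits y n <;> simp

theorem U_true {c : CodeO} {x y : ℝ} (h : ∀ n, c.eval (realOracle x) n = Part.some (realOracle y n)) {p : ℕ} (hp : p < 2)
    {τ : List Bool}
    (hd : dtest p (bv (initSeg (digits x) (2 * τ.length + 4))) (bv (initSeg (digits y) (2 * τ.length + 4))) (Nv τ) = true) :
    ∃ k, U (2 * c.encode + p) τ (initSeg (digits x) k) = true := by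
  obtain ⟨K, hK⟩ := bits_true h (2 * τ.length + 4)
  refine ⟨max K (2 * τ.length + 4), ?_⟩
  obtain ⟨h1, h2⟩ := hK _ (le_max_left K (2 * τ.length + 4))
  unfold U
  rw [show (2 * c.encode + p) / 2 = c.encode by omega, show (2 * c.encode + p) % 2 = p by omega, h1, h2,
    initSeg_take _ (le_max_right _ _), hd]
  simp

theorem U_len {s : ℕ} {τ σ : List Bool} (h : U s τ σ = true) : 0 < σ.length := by
  unfold U at h
  simp only [Bool.and_eq_true, decide_eq_true_eq] at h
  omega

theorem exists_index {s : ℕ} {X : Cantor} (h : ∃ k, U s (tl (s+1)) (initSeg X k) = true) :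
    ∃ i k, GI i ∧ ell i = 4 / 2^k ∧ aI i = ((bv (initSeg X k) : ℝ) - bshift s k (initSeg bet k) - 2) / 2^k := by
  classical
  obtain ⟨k, hk, hmin⟩ : ∃ k, U s (tl (s+1)) (initSeg X k) = true ∧ ∀ j < k, ¬ U s (tl (s+1)) (initSeg X j) = true :=
    ⟨Nat.find h, Nat.find_spec h, fun j hj => Nat.find_min h hj⟩
  let q : Quad := (s, tl (s+1), initSeg X k, bshift s k (initSeg bet k))
  have hq : quad (2 * Encodable.encode q) = q := quad_encode q
  have hk0 := U_len hk
  rw [length_initSeg] at hk0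
  have hA : Act (2 * Encodable.encode q) := by
    rw [Act_even (by omega), hq]
    refine ⟨by omega, rfl, hk, ?_, ?_⟩
    · have := hmin (k-1) (by omega)
      simp only [q]
      rw [List.dropLast_eq_take, length_initSeg, initSeg_take X (by omega)]
      simpa using this
    · simp only [q, length_initSeg]
  refine ⟨2 * Encodable.encode q, k, ⟨by omega, hA⟩, ?_, ?_⟩
  · have h3 := Act_len (by omega) hA
    rw [hq] at h3
    simp only [q, length_initSeg] at h3
    rw [ell, LI, lenI, if_neg (by omega), hq]
    simp only [q, length_initSeg]
    obtain ⟨d, rfl⟩ := Nat.exists_eq_add_of_le h3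
    rw [Nat.add_sub_cancel_left, pow_add, div_pow, one_pow]
    field_simp; norm_num
  · rw [aI, hq]
    simp only [q, length_initSeg]

theorem incomp_core {ρ : ℝ} (h0 : 0 ≤ ρ) (h1 : ρ ≤ 1) :
    TIncompReal (1/2 * ρ + 1/2 * Wt (J1 ρ)) (1/2 * ρ + 1/2 * Wt (J2 ρ)) := by
  set x := 1/2 * ρ + 1/2 * Wt (J1 ρ) with hx
  set y := 1/2 * ρ + 1/2 * Wt (J2 ρ) with hy
  have hxy : y = x + bp := by have := Wt_J2 ρ; rw [hx, hy]; linarith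
  have hx0 : 0 ≤ x := by have := Wt_nonneg (J1 ρ); rw [hx]; linarith
  have hb0 := bp_nonneg
  have hy1 : y < 1 := by have := Wt_le (J := J2 ρ) fun i => J2_act; rw [hy]; linarith
  have hx1 : x < 1 := by linarith
  have hy0 : 0 ≤ y := by linarith
  have hs : Summable fun i => if J1 ρ i then ell i else 0 := by
    have := (LI_summable (J := J1 ρ) fun i => J1_act).div_const 2
    refine this.congr fun i => ?_
    simp only [ell]; split_ifs <;> simp
  have hxe : x = ρ/2 + ∑' i, if J1 ρ i then ell i else 0 := by
    rw [hx, Wt]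
    have : (∑' i, if J1 ρ i then ell i else 0) = (∑' i, if J1 ρ i then LI i else 0) / 2 := by
      rw [← tsum_div_const]
      refine tsum_congr fun i => ?_
      simp only [ell]; split_ifs <;> simp
    rw [this]; ring
  have avoid : ∀ i, GI i → ¬ (aI i < x ∧ x < aI i + ell i) := by
    intro i hi
    rw [hxe]
    exact JJ_avoid (fun i => by have := LI_pos i; unfold ell; linarith) hs hi
  -- digit comparison
  have dig : ∀ s : ℕ, ∃ d : ℕ, d ≤ 2 ∧ bv (initSeg (digits y) (2 * (tl s).length + 4)) =
      bv (initSeg (digits x) (2 * (tl s).length + 4)) + 4 * Nv (tl s) + d := by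
    intro s
    have b1 := bv_bounds hx0 hx1 (2 * (tl s).length + 4)
    have b2 := bv_bounds hy0 hy1 (2 * (tl s).length + 4)
    have l1 := bp_lo (TT s)
    have l2 := bp_hi (TT s)
    rw [← tl_eq] at l1 l2
    rw [length_tl] at *
    have e4 : (2:ℝ)^(2 * TT s + 4) = 4 * 4^(TT s+1) := by
      rw [pow_add, pow_mul]; norm_num; ring
    rw [hxy, add_mul] at b2
    have e5 : bp * 2^(2 * TT s + 4) = 4 * (bp * 4^(TT s+1)) := by rw [e4]; ring
    rw [e5, ← hxy] at b2
    generalize bv (initSeg (digits x) (2 * TT s + 4)) = X at *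
    generalize bv (initSeg (digits y) (2 * TT s + 4)) = Y at *
    generalize Nv (tl s) = N at *
    have c1 : X + 4 * N < Y + 1 := by
      have : (X:ℝ) + 4 * N < Y + 1 := by linarith
      exact_mod_cast this
    have c2 : Y < X + 4 * N + 3 := by
      have : (Y:ℝ) < X + 4 * N + 3 := by linarith
      exact_mod_cast this
    exact ⟨Y - (X + 4 * N), by omega, by omega⟩
  constructor
  · -- x from y
    rintro ⟨c, hc⟩
    obtain ⟨d, hd, he⟩ := dig (2 * c.encode + 1 + 1)
    obtain ⟨i, k, hi, h2, h3⟩ := exists_index (U_true hc (p := 1) (τ := tl (2 * c.encode + 1 + 1)) (by norm_num) (by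
      unfold dtest
      rw [he, if_neg (by norm_num)]
      simp only [Bool.and_eq_true, decide_eq_true_eq]
      omega))
    refine avoid i hi ?_
    rw [h2, h3]
    have b2 := bv_bounds hy0 hy1 k
    have l1 := bp_lo k
    have l2 := bp_hi k
    have hb : bshift (2 * c.encode + 1) k (initSeg bet k) = Nv (initSeg bet k) * 2^k / 4^(k+1) := by
      rw [bshift, show (2 * c.encode + 1) % 2 = 1 by omega, one_mul]
    rw [hb]
    generalize Nv (initSeg bet k) = N at *
    generalize bv (initSeg (digits y) k) = Y at *
    have f1 := Nat.div_mul_le_self (N * 2^k) (4^(k+1))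
    have f2 : N * 2^k < (N * 2^k / 4^(k+1) + 1) * 4^(k+1) := Nat.lt_mul_of_div_lt (Nat.lt_succ_self _) (by positivity)
    generalize N * 2^k / 4^(k+1) = b at *
    have f1' : (b:ℝ) * 4^(k+1) ≤ N * 2^k := by exact_mod_cast f1
    have f2' : (N:ℝ) * 2^k < (b + 1) * 4^(k+1) := by exact_mod_cast f2
    have p2 : (0:ℝ) < 2^k := by positivity
    have p4 : (0:ℝ) < 4^(k+1) := by positivity
    have p24 : (2:ℝ)^k ≤ 4^(k+1) := by
      calc (2:ℝ)^k ≤ 4^k := pow_le_pow_left₀ (by norm_num) (by norm_num) _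
        _ ≤ 4^(k+1) := pow_le_pow_right₀ (by norm_num) (by omega)
    have g1 : (b:ℝ) ≤ bp * 2^k := by
      have : (b:ℝ) * 4^(k+1) ≤ bp * 2^k * 4^(k+1) := by nlinarith
      exact le_of_mul_le_mul_right this p4
    have g2 : bp * 2^k < b + 4/3 := by
      have : bp * 2^k * 4^(k+1) < (b + 4/3) * 4^(k+1) := by nlinarith
      exact lt_of_mul_lt_mul_right this p4.le
    rw [hxy, add_mul] at b2
    rw [← add_div, div_lt_iff₀ p2, lt_div_iff₀ p2]
    constructor <;> linarith
  · rintro ⟨c, hc⟩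
    obtain ⟨d, hd, he⟩ := dig (2 * c.encode + 0 + 1)
    obtain ⟨i, k, hi, h2, h3⟩ := exists_index (U_true hc (p := 0) (τ := tl (2 * c.encode + 0 + 1)) (by norm_num) (by
      unfold dtest
      rw [he, if_pos rfl]
      simp only [Bool.and_eq_true, decide_eq_true_eq]
      omega))
    refine avoid i hi ?_
    rw [h2, h3]
    have b1 := bv_bounds hx0 hx1 k
    have hb : bshift (2 * c.encode + 0) k (initSeg bet k) = 0 := by
      rw [bshift, show (2 * c.encode + 0) % 2 = 0 by omega, zero_mul]
    have p2 : (0:ℝ) < 2^k := by positivity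
    rw [hb, ← add_div, div_lt_iff₀ p2, lt_div_iff₀ p2]
    push_cast
    constructor <;> linarith

end RandProb

end

section
namespace RandProb

theorem act_len_le {i k : ℕ} (hA : act i k = true) : lenI i ≤ i + 2 := by
  unfold lenI
  split_ifs with h
  · exact le_rfl
  · have h1 : Encodable.encode (quad i) = i/2 := by
      unfold act at hA
      simp only [Bool.or_eq_true, Bool.and_eq_true, decide_eq_true_eq] at hA
      exact (hA.resolve_left h).1
    have := encode_len (quad i)
    omega

noncomputable def Nb (i k : ℕ) : ℕ :=
  (List.range i).foldl (fun acc i' => acc + if act i' k = true then 2^(i+3-lenI i') else 0) 0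

@[fun_prop] theorem fp_Nb {α : Type} [Primcodable α] {f g : α → ℕ} (hf : Primrec f) (hg : Primrec g) :
    Primrec fun x => Nb (f x) (g x) := by unfold Nb; fun_prop

noncomputable def st (i k : ℕ) : ℝ := ∑ i' ∈ Finset.range i, if act i' k = true then LI i' else 0

theorem foldl_add_range (g : ℕ → ℕ) (n : ℕ) : (List.range n).foldl (fun acc i => acc + g i) 0 = ∑ i ∈ Finset.range n, g i := by
  induction n with
  | zero => simp
  | succ n ih => rw [List.range_succ, List.foldl_append, ih, Finset.sum_range_succ]; rfl

theorem pow_sub_len {a b : ℕ} (h : b ≤ a) : ((2^(a-b) : ℕ) : ℝ) = (1/2)^b * 2^a := by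
  obtain ⟨d, rfl⟩ := Nat.exists_eq_add_of_le h
  rw [Nat.add_sub_cancel_left, pow_add, div_pow, one_pow]
  push_cast
  have : (2:ℝ)^b ≠ 0 := by positivity
  field_simp

theorem Nb_eq (i k : ℕ) : (Nb i k : ℝ) = st i k * 2^(i+3) := by
  rw [Nb, foldl_add_range, st, Finset.sum_mul]
  push_cast
  refine Finset.sum_congr rfl fun j hj => ?_
  have := Finset.mem_range.1 hj
  by_cases h : act j k = true
  · have h2 := act_len_le h
    rw [if_pos h, if_pos h, LI, ← pow_sub_len (by omega)]
    push_cast; rfl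
  · rw [if_neg h, if_neg h]; simp

noncomputable def con (i k : ℕ) (σ : List Bool) : Bool :=
  decide (Nb i k * 2^σ.length ≤ bv σ * 2^(i+3)) &&
    decide ((bv σ + 1) * 2^(i+3) ≤ (Nb i k + 2^(i+3-lenI i)) * 2^σ.length)

noncomputable def tst (i k : ℕ) (σ : List Bool) : Bool := act i k && con i k σ

@[fun_prop] theorem fp_tst {α : Type} [Primcodable α] {f g : α → ℕ} {h : α → List Bool} (hf : Primrec f) (hg : Primrec g)
    (hh : Primrec h) : Primrec fun x => tst (f x) (g x) (h x) := by unfold tst con; fun_prop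

noncomputable def FF (σ : List Bool) : ℕ := lf σ.length fun i => tst i σ.length σ

@[fun_prop] theorem fp_FF {α : Type} [Primcodable α] {h : α → List Bool} 
    (hh : Primrec h) : Primrec fun x => FF (h x) := by unfold FF; fun_prop

noncomputable def lo (σ : List Bool) : ℝ := bv σ / 2^σ.length
noncomputable def hi (σ : List Bool) : ℝ := (bv σ + 1) / 2^σ.length

theorem lo_lt_hi (σ : List Bool) : lo σ < hi σ := by
  unfold lo hi
  exact div_lt_div_of_pos_right (by linarith) (by positivity)

theorem cell_nest {σ τ : List Bool} (h : σ <+: τ) : lo σ ≤ lo τ ∧ hi τ ≤ hi σ := by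
  obtain ⟨ρ, rfl⟩ := h
  induction ρ using List.reverseRecOn with
  | nil => simp
  | append_singleton ρ b ih =>
    have e : lo (σ ++ ρ) ≤ lo (σ ++ (ρ ++ [b])) ∧ hi (σ ++ (ρ ++ [b])) ≤ hi (σ ++ ρ) := by
      rw [← List.append_assoc]
      generalize σ ++ ρ = τ
      unfold lo hi
      rw [bv_concat, List.length_append, List.length_singleton, pow_succ]
      have p : (0:ℝ) < 2^τ.length := by positivity
      rw [div_le_div_iff₀ p (by positivity), div_le_div_iff₀ (by positivity) p]
      push_cast
      cases b <;> simp <;> constructor <;> nlinarith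
    exact ⟨ih.1.trans e.1, e.2.trans ih.2⟩

theorem tst_iff {i k : ℕ} {σ : List Bool} : tst i k σ = true ↔ act i k = true ∧ st i k ≤ lo σ ∧ hi σ ≤ st i k + LI i := by
  unfold tst con
  simp only [Bool.and_eq_true, decide_eq_true_eq]
  refine and_congr_right fun hA => and_congr ?_ ?_
  · rw [lo, le_div_iff₀ (by positivity), ← Nat.cast_le (α := ℝ)]
    push_cast
    rw [Nb_eq]
    have p : (0:ℝ) < 2^(i+3) := by positivity
    rw [show st i k * 2^(i+3) * 2^σ.length = st i k * 2^σ.length * 2^(i+3) by ring]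
    exact mul_le_mul_iff_left₀ p
  · rw [hi, div_le_iff₀ (by positivity), ← Nat.cast_le (α := ℝ)]
    have h2 := act_len_le hA
    rw [Nat.cast_mul, Nat.cast_mul, Nat.cast_add, Nat.cast_add, pow_sub_len (by omega)]
    push_cast
    rw [Nb_eq, ← LI]
    have p : (0:ℝ) < 2^(i+3) := by positivity
    rw [show (st i k * 2^(i+3) + LI i * 2^(i+3)) * 2^σ.length = (st i k + LI i) * 2^σ.length * 2^(i+3) by ring]
    exact mul_le_mul_iff_left₀ p

theorem tst_mono {i k : ℕ} {σ τ : List Bool} (h : σ <+: τ) (ht : tst i k σ = true) : tst i k τ = true := by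
  rw [tst_iff] at *
  have := cell_nest h
  exact ⟨ht.1, by linarith, by linarith⟩

theorem tst_lt {i i' k : ℕ} {σ : List Bool} (h : tst i k σ = true) (h' : tst i' k σ = true) : ¬ i < i' := by
  intro hlt
  rw [tst_iff] at *
  have h1 : st i k + LI i ≤ st i' k := by
    have : st i k + LI i = st (i+1) k := by rw [st, st, Finset.sum_range_succ, if_pos h.1]
    rw [this]
    refine Finset.sum_le_sum_of_subset_of_nonneg (Finset.range_mono (by omega)) fun j _ _ => ?_
    split_ifs; exacts [(LI_pos j).le, le_rfl]
  have := lo_lt_hi σ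
  linarith

theorem tst_uniq {i i' k : ℕ} {σ : List Bool} (h : tst i k σ = true) (h' : tst i' k σ = true) : i = i' := by
  have := tst_lt h h'
  have := tst_lt h' h
  omega

def QQ (i : ℕ) (σ : List Bool) : Prop := ∃ K, ∀ k ≥ K, tst i k σ = true

noncomputable def stl (i : ℕ) : ℝ := ∑ i' ∈ Finset.range i, if Act i' then LI i' else 0

theorem st_conv (i : ℕ) : ∃ K, ∀ k ≥ K, act i k = decide (Act i) ∧ st i k = stl i := by
  obtain ⟨K, hK⟩ := ev_list (List.range (i+1)) (P := fun k i => act i k = decide (Act i)) fun i _ => act_conv' i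
  refine ⟨K, fun k hk => ⟨hK k hk i (by simp), ?_⟩⟩
  rw [st, stl]
  refine Finset.sum_congr rfl fun j hj => ?_
  have := Finset.mem_range.1 hj
  rw [hK k hk j (by simp; omega)]
  simp

theorem tst_conv (i : ℕ) : ∃ K, ∀ k ≥ K, ∀ σ, (tst i k σ = true ↔ Act i ∧ stl i ≤ lo σ ∧ hi σ ≤ stl i + LI i) := by
  obtain ⟨K, hK⟩ := st_conv i
  refine ⟨K, fun k hk σ => ?_⟩
  rw [tst_iff, (hK k hk).1, (hK k hk).2]; simp

theorem QQ_iff {i : ℕ} {σ : List Bool} : QQ i σ ↔ Act i ∧ stl i ≤ lo σ ∧ hi σ ≤ stl i + LI i := by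
  obtain ⟨K, hK⟩ := tst_conv i
  constructor
  · rintro ⟨K', h⟩
    exact (hK _ (le_max_left K K') σ).1 (h _ (le_max_right K K'))
  · intro h
    exact ⟨K, fun k hk => (hK k hk σ).2 h⟩

def Cv (Z : Cantor) (i : ℕ) : Prop := ∃ k0, ∀ k ≥ k0, FF (initSeg Z k) = i

theorem Cv_uniq {Z : Cantor} {i j : ℕ} (h : Cv Z i) (h' : Cv Z j) : i = j := by
  obtain ⟨k, hk⟩ := h
  obtain ⟨k', hk'⟩ := h'
  rw [← hk _ (le_max_left k k'), hk' _ (le_max_right k k')]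

theorem Cv_iff {Z : Cantor} {i : ℕ} : Cv Z i ↔ ∃ j, QQ i (initSeg Z j) := by
  constructor
  · rintro ⟨k0, h0⟩
    obtain ⟨K, hK⟩ := tst_conv i
    have h1 := h0 (max k0 (max K (i+1))) (le_max_left _ _)
    have h2 : i + 1 ≤ max k0 (max K (i+1)) := by omega
    have h3 : K ≤ max k0 (max K (i+1)) := by omega
    generalize max k0 (max K (i+1)) = k at *
    unfold FF at h1
    rw [length_initSeg] at h1
    have h4 := lf_true (t := k) (p := fun i => tst i k (initSeg Z k)) (by omega)
    rw [h1] at h4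
    exact ⟨k, QQ_iff.2 ((hK k h3 _).1 h4)⟩
  · rintro ⟨j, K, hK⟩
    refine ⟨max K (max j (i+1)), fun k hk => ?_⟩
    have h1 : tst i k (initSeg Z k) = true := tst_mono (initSeg_pfx Z (by omega)) (hK k (by omega))
    unfold FF
    rw [length_initSeg]
    have h2 := lf_le_of (t := k) (p := fun i => tst i k (initSeg Z k)) h1
    have h3 := lf_true (t := k) (p := fun i => tst i k (initSeg Z k)) (by omega)
    exact tst_uniq h3 h1

theorem Cv_meas (i : ℕ) : MeasurableSet {Z | Cv Z i} := by
  have : {Z | Cv Z i} = ⋃ j, {Z | QQ i (initSeg Z j)} := by ext Z; simp [Cv_iff]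
  rw [this]
  exact MeasurableSet.iUnion fun j => measurable_seg j fun σ => QQ i σ

theorem Cv_mu (i : ℕ) : mu {Z | Cv Z i} = ENNReal.ofReal (if Act i then LI i else 0) := by
  by_cases hA : Act i
  · rw [if_pos hA, mu_apply (Cv_meas i)]
    have hS0 : 0 ≤ stl i := Finset.sum_nonneg fun j _ => ite_LI_nonneg Act j
    have hS1 : stl i + LI i ≤ 3/4 := by
      have := sum_Act (Finset.range (i+1))
      rwa [Finset.sum_range_succ, if_pos hA] at this
    have hb : ∀ x : ℝ, 0 ≤ x → x < 1 → ∀ j, lo (initSeg (digits x) j) ≤ x ∧ x < hi (initSeg (digits x) j) := by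
      intro x h0 h1 j
      have := bv_bounds h0 h1 j
      unfold lo hi
      rw [length_initSeg, div_le_iff₀ (by positivity), lt_div_iff₀ (by positivity)]
      exact this
    refine le_antisymm ?_ ?_
    · refine le_trans (measure_mono (t := Set.Ico (stl i) (stl i + LI i)) ?_) (by rw [Real.volume_Ico]; simp)
      rintro x ⟨hx, h0, h1⟩
      simp only [Set.mem_preimage, Set.mem_ofPred_eq] at hx
      obtain ⟨j, hj⟩ := Cv_iff.1 hx
      have h2 := (QQ_iff.1 hj).2
      have h3 := hb x h0 h1 j
      exact ⟨by linarith, by linarith⟩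
    · refine le_trans (by rw [Real.volume_Ioo]; simp) (measure_mono (s := Set.Ioo (stl i) (stl i + LI i)) ?_)
      rintro x ⟨hx1, hx2⟩
      have h0 : 0 ≤ x := by linarith
      have h1 : x < 1 := by linarith
      refine ⟨?_, h0, h1⟩
      simp only [Set.mem_preimage, Set.mem_ofPred_eq]
      rw [Cv_iff]
      obtain ⟨j, hj⟩ := exists_pow_lt_of_lt_one (lt_min (sub_pos.2 hx1) (sub_pos.2 hx2)) (show (1/2 : ℝ) < 1 by norm_num)
      refine ⟨j, QQ_iff.2 ⟨hA, ?_⟩⟩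
      have h3 := hb x h0 h1 j
      have h4 : hi (initSeg (digits x) j) = lo (initSeg (digits x) j) + (1/2)^j := by
        unfold hi lo; rw [length_initSeg, add_div, div_pow, one_pow]
      have h5 := lt_min_iff.1 hj
      constructor <;> linarith
  · rw [if_neg hA]
    have : {Z | Cv Z i} = ∅ := by
      ext Z
      simp only [Set.mem_ofPred_eq, Set.mem_empty_iff_false, iff_false, Cv_iff, not_exists]
      exact fun j h => hA (QQ_iff.1 h).1
    rw [this]; simp

def DJ (J : ℕ → Prop) : Set Cantor := {Z | ∃ i, J i ∧ Cv Z i}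

theorem DJ_eq (J : ℕ → Prop) : DJ J = ⋃ i, {Z | J i ∧ Cv Z i} := by ext Z; simp [DJ]

theorem JCv_meas (J : ℕ → Prop) (i : ℕ) : MeasurableSet {Z | J i ∧ Cv Z i} := by
  by_cases h : J i
  · simpa [h] using Cv_meas i
  · simp [h]

theorem DJ_meas (J : ℕ → Prop) : MeasurableSet (DJ J) := by
  rw [DJ_eq]
  exact MeasurableSet.iUnion (JCv_meas J)

theorem DJ_mu {J : ℕ → Prop} (hJ : ∀ i, J i → Act i) : muR (DJ J) = Wt J := by
  rw [muR, DJ_eq, measure_iUnion ?_ (JCv_meas J)]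
  · have : ∀ i, mu {Z | J i ∧ Cv Z i} = ENNReal.ofReal (if J i then LI i else 0) := by
      intro i
      by_cases h : J i
      · have e := Cv_mu i
        rw [if_pos (hJ i h)] at e
        simp only [h, true_and, if_true]
        exact e
      · simp [h]
    rw [tsum_congr this, ← ENNReal.ofReal_tsum_of_nonneg (ite_LI_nonneg J) (LI_summable hJ), ENNReal.toReal_ofReal]
    · rfl
    · exact Wt_nonneg J
  · intro i j hij
    show Disjoint _ _
    rw [Set.disjoint_left]
    intro Z h h'
    exact hij (Cv_uniq h.2 h'.2)

end RandProb

end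

section
namespace RandProb

theorem Sg.ev {α : Type} [Primcodable α] {m : ℕ} (hm : 1 ≤ m) {R : α → ℕ → Bool} (hR : Primrec fun p : α × ℕ => R p.1 p.2) :
    Sg m (fun a (_ : Cantor) => ∃ K, ∀ k ≥ K, R a k = true) := by
  have h : Sg 0 (fun (p : (α × ℕ) × ℕ) (_ : Cantor) => R p.1.1 (p.1.2 + p.2) = false) := Sg.prim (by fun_prop)
  refine (h.ex.not.ex.le hm).congr fun a X => ?_
  constructor
  · rintro ⟨K, h⟩
    exact ⟨K, by rintro ⟨n, hn⟩; simp [h (K + n) (by omega)] at hn⟩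
  · rintro ⟨K, h⟩
    refine ⟨K, fun k hk => ?_⟩
    by_contra hc
    exact h ⟨k - K, by simpa [Nat.add_sub_cancel' hk] using hc⟩

theorem Sg_Act {m : ℕ} (hm : 1 ≤ m) : Sg m (fun (i : ℕ) (_ : Cantor) => Act i) := Sg.ev hm (R := act) (by fun_prop)

theorem Sg_QQ {m : ℕ} (hm : 1 ≤ m) : Sg m (fun (p : ℕ × List Bool) (_ : Cantor) => QQ p.1 p.2) :=
  Sg.ev hm (R := fun (p : ℕ × List Bool) k => tst p.1 k p.2) (by fun_prop)

theorem Sg_BJ {m : ℕ} (hm : 1 ≤ m) : Sg m (fun (i : ℕ) (_ : Cantor) => BJ i) := by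
  have h1 : Sg m (fun (i : ℕ) (_ : Cantor) => ∃ K, ∀ k ≥ K, (tau (i/2+1) k).getD (i/2) false = true) :=
    Sg.ev hm (R := fun i k => (tau (i/2+1) k).getD (i/2) false) (by fun_prop)
  have h2 : Sg m (fun (i : ℕ) (_ : Cantor) => i % 2 = 1) := Sg.prim (by fun_prop)
  refine (h2.and h1).congr fun i X => ?_
  unfold BJ
  refine and_congr_right fun _ => ?_
  obtain ⟨K, hK⟩ := tl_spec (i/2+1)
  constructor
  · intro h
    exact ⟨K, fun k hk => by rw [hK k hk]; exact h⟩
  · rintro ⟨K', h⟩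
    have := h _ (le_max_left K' K)
    rw [hK _ (le_max_right K' K)] at this
    exact this

def Hh (L : List ℕ) : ℕ := L.foldl (fun acc x => acc + lenI x) 0
def Ss (H : ℕ) (L : List ℕ) : ℕ := L.foldl (fun acc x => acc + 2^(H - lenI x)) 0

@[fun_prop] theorem fp_Hh {α : Type} [Primcodable α] {f : α → List ℕ} (hf : Primrec f) :
    Primrec fun x => Hh (f x) := by unfold Hh; fun_prop
@[fun_prop] theorem fp_Ss {α : Type} [Primcodable α] {g : α → ℕ} {f : α → List ℕ} (hg : Primrec g) (hf : Primrec f) :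
    Primrec fun x => Ss (g x) (f x) := by unfold Ss; fun_prop

theorem foldl_add_list (g : ℕ → ℕ) (L : List ℕ) (c : ℕ) : L.foldl (fun acc x => acc + g x) c = c + (L.map g).sum := by
  induction L generalizing c with
  | nil => simp
  | cons x L ih => rw [List.foldl_cons, ih, List.map_cons, List.sum_cons, add_assoc]

theorem Ss_eq {H : ℕ} {L : List ℕ} (h : ∀ x ∈ L, lenI x ≤ H) : (Ss H L : ℝ) = 2 * sl ell L * 2^H := by
  rw [Ss, foldl_add_list, zero_add, sl]
  induction L with
  | nil => simp
  | cons x L ih =>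
    rw [List.map_cons, List.sum_cons, List.map_cons, List.sum_cons, Nat.cast_add, ih fun y hy => h y (List.mem_cons_of_mem _ hy),
      pow_sub_len (h x List.mem_cons_self), ell, LI]
    ring

theorem le_Hh {L : List ℕ} {x : ℕ} (h : x ∈ L) : lenI x ≤ Hh L := by
  rw [Hh, foldl_add_list, zero_add]
  exact List.single_le_sum (fun _ _ => Nat.zero_le _) _ (List.mem_map_of_mem h)

def thA (i : ℕ) (L : List ℕ) : ℕ := 2 * bv (quad i).2.2.1 * 2^(Hh L)
def thB (i : ℕ) (L : List ℕ) : ℕ := (2 * (quad i).2.2.2 + 4) * 2^(Hh L) + Ss (Hh L) L * 2^(quad i).2.2.1.length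

@[fun_prop] theorem fp_thA {α : Type} [Primcodable α] {g : α → ℕ} {f : α → List ℕ} (hg : Primrec g) (hf : Primrec f) :
    Primrec fun x => thA (g x) (f x) := by unfold thA; fun_prop
@[fun_prop] theorem fp_thB {α : Type} [Primcodable α] {g : α → ℕ} {f : α → List ℕ} (hg : Primrec g) (hf : Primrec f) :
    Primrec fun x => thB (g x) (f x) := by unfold thB; fun_prop

theorem th_iff {ρ : ℝ} (h0 : 0 ≤ ρ) (i : ℕ) (L : List ℕ) : aI i < ρ/2 + sl ell L ↔
    thA i L < thB i L ∨ ((thA i L - thB i L : ℕ) : ℝ) / 2^((quad i).2.2.1.length + Hh L) < ρ := by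
  have e : aI i < ρ/2 + sl ell L ↔ ((thA i L : ℝ) - thB i L) / 2^((quad i).2.2.1.length + Hh L) < ρ := by
    rw [aI, thA, thB]
    push_cast
    rw [Ss_eq fun x => le_Hh, pow_add, div_lt_iff₀ (by positivity), div_lt_iff₀ (by positivity)]
    have pH : (0:ℝ) < 2^(Hh L) := by positivity
    generalize (2:ℝ)^(Hh L) = H at *
    generalize (2:ℝ)^(quad i).2.2.1.length = M at *
    constructor
    · intro h; nlinarith
    · intro h
      have : (2 * ((bv (quad i).2.2.1 : ℝ) - (quad i).2.2.2 - 2)) * H < (2 * ((ρ/2 + sl ell L) * M)) * H := by nlinarith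
      have := lt_of_mul_lt_mul_right this pH.le
      linarith
  rw [e]
  by_cases hAB : thA i L < thB i L
  · simp only [hAB, true_or, iff_true]
    refine lt_of_lt_of_le (div_neg_of_neg_of_pos ?_ (by positivity)) h0
    have : (thA i L : ℝ) < thB i L := by exact_mod_cast hAB
    linarith
  · push Not at hAB
    rw [Nat.cast_sub hAB]
    simp [not_lt.2 hAB]

theorem Sg_J1 {m : ℕ} (hm : 1 ≤ m) {ρ : ℝ} (h0 : 0 ≤ ρ)
    (hρ : Sg m (fun (p : ℕ × ℕ) (_ : Cantor) => (p.1:ℝ)/2^p.2 < ρ)) :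
    Sg m (fun (i : ℕ) (_ : Cantor) => J1 ρ i) := by
  have hT : Sg m (fun (p : ℕ × List ℕ) (_ : Cantor) => aI p.1 < ρ/2 + sl ell p.2) := by
    have h1 : Sg m (fun (p : ℕ × List ℕ) (_ : Cantor) => thA p.1 p.2 < thB p.1 p.2) := Sg.prim (by fun_prop)
    have h2 := hρ.subst (f := fun p : ℕ × List ℕ => (thA p.1 p.2 - thB p.1 p.2, (quad p.1).2.2.1.length + Hh p.2)) (by fun_prop)
    exact (h1.or h2).congr fun p X => th_iff h0 p.1 p.2
  have hD : Sg m (fun (L : List ℕ) (_ : Cantor) => Der GI aI ell (ρ/2) L) := by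
    have h1 : Sg m (fun (p : List ℕ × ℕ) (_ : Cantor) =>
        ((p.1.drop (p.2+1)).any fun x => decide (x = p.1.getD p.2 0)) = false) := Sg.prim (by fun_prop)
    have h2 : Sg m (fun (p : List ℕ × ℕ) (_ : Cantor) => (p.1.getD p.2 0) % 2 = 0) := Sg.prim (by fun_prop)
    have h3 := (Sg_Act hm).subst (f := fun p : List ℕ × ℕ => p.1.getD p.2 0) (by fun_prop)
    have h4 := hT.subst (f := fun p : List ℕ × ℕ => (p.1.getD p.2 0, p.1.drop (p.2+1))) (by fun_prop)
    refine ((h1.and ((h2.and h3).and h4)).ball (f := fun L => L.length) (by fun_prop)).congr fun L X => ?_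
    rw [Der_iff]
    refine forall₂_congr fun n hn => and_congr ?_ Iff.rfl
    simp [List.any_eq_false]
    constructor
    · intro h x hx he; subst he; exact h hx
    · intro h hx; exact h _ hx rfl
  have hM : Sg m (fun (p : ℕ × List ℕ) (_ : Cantor) => (p.2.any fun x => decide (x = p.1)) = true) := Sg.prim (by fun_prop)
  refine ((hD.subst (f := fun p : ℕ × List ℕ => p.2) (by fun_prop)).and hM).exT.congr fun i X => ?_
  unfold J1 JJ
  refine exists_congr fun L => and_congr Iff.rfl ?_
  simp

theorem core {m : ℕ} (hm : 1 ≤ m) {ρ : ℝ} (h0 : 0 ≤ ρ) (h1 : ρ ≤ 1)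
    (hρ : Sg m (fun (p : ℕ × ℕ) (_ : Cantor) => (p.1:ℝ)/2^p.2 < ρ)) :
    ∃ J J' : ℕ → Prop, Sg m (fun (i : ℕ) (_ : Cantor) => J i) ∧ Sg m (fun (i : ℕ) (_ : Cantor) => J' i) ∧
      TIncompReal (1/2 * ρ + 1/2 * muR (DJ J)) (1/2 * ρ + 1/2 * muR (DJ J')) := by
  refine ⟨J1 ρ, J2 ρ, Sg_J1 hm h0 hρ, (Sg_J1 hm h0 hρ).or (Sg_BJ hm), ?_⟩
  rw [DJ_mu fun i => J1_act, DJ_mu fun i => J2_act]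
  exact incomp_core h0 h1

/-- string version of `J` -/
def EJ (J : ℕ → Prop) (σ : List Bool) : Prop := ∃ i, J i ∧ QQ i σ

theorem Sg_EJ {m : ℕ} (hm : 1 ≤ m) {J : ℕ → Prop} (hJ : Sg m (fun (i : ℕ) (_ : Cantor) => J i)) :
    Sg m (fun (σ : List Bool) (_ : Cantor) => EJ J σ) := by
  have h1 := hJ.subst (f := fun p : List Bool × ℕ => p.2) (by fun_prop)
  have h2 := (Sg_QQ hm).subst (f := fun p : List Bool × ℕ => (p.2, p.1)) (by fun_prop)
  exact (h1.and h2).ex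

theorem DJ_iff {J : ℕ → Prop} {Z : Cantor} : Z ∈ DJ J ↔ ∃ j, EJ J (initSeg Z j) := by
  simp only [DJ, EJ, Set.mem_ofPred_eq, Cv_iff]
  constructor
  · rintro ⟨i, h, j, h'⟩; exact ⟨j, i, h, h'⟩
  · rintro ⟨j, i, h, h'⟩; exact ⟨i, h, j, h'⟩

end RandProb

end

section
namespace RandProb

theorem Sg_dom (u : CodeO) : Sg 0 (fun (n : ℕ) X => n ∈ domSet u X) :=
  ⟨fun n σ => (phi u.encode σ n).isSome, by fun_prop, fun n X => dom_iff_phi⟩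

theorem om_variance {C : Set ℕ → Prop} {m : ℕ} (hm : 1 ≤ m) (hC : ∀ u, Sg m (fun (_ : Unit) X => C (domSet u X)))
    (real : ∀ J : ℕ → Prop, Sg m (fun (i : ℕ) (_ : Cantor) => J i) →
      ∃ g : List Bool → ℕ → Bool, (Primrec fun p : List Bool × ℕ => g p.1 p.2) ∧
        ∀ Z, C {n | ∃ k, g (initSeg Z k) n = true} ↔ Z ∈ DJ J) :
    ∃ u v, UniversalOM u ∧ UniversalOM v ∧ TIncompReal (muR {X | C (domSet u X)}) (muR {X | C (domSet v X)}) := by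
  obtain ⟨J, J', hJ, hJ', h⟩ := core hm (muR_nonneg {X | C (domSet u0 X)}) (muR_le_one _)
    ((hC u0).measure.subst (f := fun p : ℕ × ℕ => ((), p)) (by fun_prop))
  have key : ∀ J : ℕ → Prop, Sg m (fun (i : ℕ) (_ : Cantor) => J i) → ∃ u, UniversalOM u ∧
      muR {X | C (domSet u X)} = 1/2 * muR {X | C (domSet u0 X)} + 1/2 * muR (DJ J) := by
    intro J hJ
    obtain ⟨g, hg, hgZ⟩ := real J hJ
    obtain ⟨u, hu, h1, h2⟩ := OM_real hg
    refine ⟨u, hu, ?_⟩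
    rw [muR_half ((hC u).measurable ())]
    simp only [Set.mem_ofPred_eq, h1, h2, hgZ]
    rfl
  obtain ⟨u, hu, e⟩ := key J hJ
  obtain ⟨v, hv, e'⟩ := key J' hJ'
  rw [← e, ← e'] at h
  exact ⟨u, v, hu, hv, h⟩

theorem real1 {J : ℕ → Prop} (hJ : Sg 1 (fun (i : ℕ) (_ : Cantor) => J i)) :
    ∃ g : List Bool → ℕ → Bool, (Primrec fun p : List Bool × ℕ => g p.1 p.2) ∧
      (∀ Z ∈ DJ J, ∃ N, ∀ n ≥ N, ¬ ∃ k, g (initSeg Z k) n = true) ∧ ∀ Z ∉ DJ J, ∀ n, ∃ k, g (initSeg Z k) n = true := by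
  obtain ⟨R, hR, e⟩ := (Sg_EJ le_rfl hJ).matrix1
  have hR' : Primrec fun p : List Bool × ℕ × ℕ => R p.1 p.2.1 p.2.2 := hR
  refine ⟨fun σ n => (List.range (n+1)).all fun w => decide (w.unpair.1 ≤ σ.length) &&
    (List.range σ.length).any fun l => R (σ.take w.unpair.1) w.unpair.2 l, ?_, ?_, ?_⟩
  · fun_prop
  · intro Z hZ
    obtain ⟨j, hj⟩ := DJ_iff.1 hZ
    obtain ⟨y, hy⟩ := (e _).1 hj
    refine ⟨Nat.pair j y, fun n hn => ?_⟩
    rintro ⟨k, hk⟩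
    simp only [List.all_eq_true, List.mem_range, Bool.and_eq_true, decide_eq_true_eq, List.any_eq_true] at hk
    obtain ⟨h1, l, _, h2⟩ := hk (Nat.pair j y) (by omega)
    rw [Nat.unpair_pair] at h1 h2
    simp only [length_initSeg] at h1 h2
    rw [initSeg_take Z h1, hy] at h2
    cases h2
  · intro Z hZ n
    rw [DJ_iff] at hZ
    push Not at hZ
    have h1 : ∀ w : ℕ, ∃ l, R (initSeg Z w.unpair.1) w.unpair.2 l = true := by
      intro w
      by_contra hc
      push Not at hc
      exact hZ _ ((e _).2 ⟨_, fun l => by simpa using hc l⟩)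
    choose l hl using h1
    refine ⟨(Finset.range (n+1)).sup (fun w => w.unpair.1 + l w + 1), ?_⟩
    simp only [List.all_eq_true, List.mem_range, Bool.and_eq_true, decide_eq_true_eq, List.any_eq_true, length_initSeg]
    intro w hw
    have := Finset.le_sup (f := fun w => w.unpair.1 + l w + 1) (Finset.mem_range.2 hw)
    refine ⟨by omega, l w, by omega, ?_⟩
    rw [initSeg_take Z (by omega)]
    exact hl w

theorem tot_variance : ∃ u v : CodeO, UniversalOM u ∧ UniversalOM v ∧ TIncompReal (muR (TOT u)) (muR (TOT v)) := by
  have hC : ∀ u, Sg 1 (fun (_ : Unit) X => ¬ ∀ n, n ∈ domSet u X) := fun u =>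
    ((Sg_dom u).subst (f := fun p : Unit × ℕ => p.2) (by fun_prop)).not.ex.congr fun a X => by simp
  obtain ⟨u, v, hu, hv, h⟩ := om_variance (C := fun S => ¬ ∀ n, n ∈ S) le_rfl hC (by
    intro J hJ
    obtain ⟨g, hg, h1, h2⟩ := real1 hJ
    refine ⟨g, hg, fun Z => ⟨fun h => ?_, fun h => ?_⟩⟩
    · by_contra hc
      exact h (h2 Z hc)
    · obtain ⟨N, hN⟩ := h1 Z h
      exact fun h => hN N le_rfl (h N))
  refine ⟨u, v, hu, hv, ?_⟩
  have e : ∀ u, muR {X | ¬ ∀ n, n ∈ domSet u X} = 1 - muR (TOT u) := fun u => by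
    rw [← muR_compl]
    · rfl
    · exact MeasurableSet.of_compl ((hC u).measurable ())
  have := TIncomp_compl h
  simpa only [e, sub_sub_cancel] using this

theorem inf_variance : ∃ u v : CodeO, UniversalOM u ∧ UniversalOM v ∧ TIncompReal (muR (INF u)) (muR (INF v)) := by
  have hC : ∀ u, Sg 1 (fun (_ : Unit) X => ¬ (domSet u X).Infinite) := fun u => by
    have h1 : Sg 0 (fun (p : (Unit × ℕ) × ℕ) X => (p.1.2 + p.2) ∈ domSet u X) :=
      (Sg_dom u).subst (f := fun p : (Unit × ℕ) × ℕ => p.1.2 + p.2) (by fun_prop)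
    refine h1.ex.not.ex.congr fun a X => ?_
    rw [Set.infinite_iff_exists_gt]
    push Not
    constructor
    · rintro ⟨N, h⟩
      exact ⟨N+1, fun n hn => by have := h _ hn; dsimp only at this; omega⟩
    · rintro ⟨N, h⟩
      refine ⟨N, fun n hn => ?_⟩
      by_contra hc
      refine h (n - N) ?_
      dsimp only
      rwa [Nat.add_sub_cancel' (by omega)]
  obtain ⟨u, v, hu, hv, h⟩ := om_variance (C := fun S => ¬ S.Infinite) le_rfl hC (by
    intro J hJ
    obtain ⟨g, hg, h1, h2⟩ := real1 hJ
    refine ⟨g, hg, fun Z => ⟨fun h => ?_, fun h => ?_⟩⟩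
    · by_contra hc
      apply h
      have : {n | ∃ k, g (initSeg Z k) n = true} = Set.univ := Set.eq_univ_of_forall (h2 Z hc)
      rw [this]; exact Set.infinite_univ
    · obtain ⟨N, hN⟩ := h1 Z h
      rw [Set.not_infinite]
      refine (Set.finite_lt_nat N).subset fun n hn => ?_
      by_contra hc
      exact hN n (by simpa using hc) hn)
  refine ⟨u, v, hu, hv, ?_⟩
  have e : ∀ u, muR {X | ¬ (domSet u X).Infinite} = 1 - muR (INF u) := fun u => by
    rw [← muR_compl]
    · rfl
    · exact MeasurableSet.of_compl ((hC u).measurable ())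
  have := TIncomp_compl h
  simpa only [e, sub_sub_cancel] using this

end RandProb

end

section
open Nat.Partrec (Code)
namespace RandProb

noncomputable def kap (t : ℕ) : ℕ := lf t fun x => KB (t+1) x && !KB t x

@[fun_prop] theorem fp_kap {α : Type} [Primcodable α] {f : α → ℕ} (hf : Primrec f) : Primrec fun x => kap (f x) := by
  unfold kap; fun_prop

theorem kap_search {x s0 s : ℕ} (h : ∀ t ≥ s0, x < kap t) (hs : s0 ≤ s) (hx : x ∈ HaltingSet) : KB s x = true := by
  by_contra hc
  have h1 : ∃ t, KB t x = true := mem_K.1 hx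
  have h2 := Nat.find_spec h1
  have h3 : s < Nat.find h1 := by
    by_contra h4
    push Not at h4
    exact hc (KB_mono h4 h2)
  obtain ⟨t, ht⟩ : ∃ t, Nat.find h1 = t + 1 := ⟨Nat.find h1 - 1, by omega⟩
  have h5 : ¬ KB t x = true := Nat.find_min h1 (by omega)
  rw [ht] at h2
  have := h t (by omega)
  have h6 : kap t ≤ x := lf_le_of (by simp [h2, h5])
  omega

theorem kap_unb (x : ℕ) : ∃ N, ∀ t ≥ N, x < kap t := by
  have h : ∀ y, ∃ N, ∀ t ≥ N, (KB (t+1) y && !KB t y) = false := by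
    intro y
    by_cases hy : ∃ N, KB N y = true
    · obtain ⟨N, hN⟩ := hy
      exact ⟨N, fun t ht => by simp [KB_mono ht hN]⟩
    · push Not at hy
      exact ⟨0, fun t ht => by simp [hy]⟩
  choose N hN using h
  refine ⟨max (x+1) ((Finset.range (x+1)).sup N), fun t ht => ?_⟩
  refine le_lf (fun y hy => ?_) (by omega)
  have := Finset.le_sup (f := N) (Finset.mem_range.2 hy)
  exact hN y t (le_trans this (le_trans (le_max_right _ _) ht))

def Wset (h : ℕ → ℕ) : Set ℕ := {n | n.unpair.2 ≠ h n.unpair.1 ∨ ∃ t > n.unpair.1, h t ≤ h n.unpair.1}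

theorem Wset_cof {h : ℕ → ℕ} (hr : Rec h) : (Wset h)ᶜ.Finite := by
  obtain ⟨v, hv⟩ := hr
  have hb : ∀ n ∈ (Wset h)ᶜ, n.unpair.2 = h n.unpair.1 ∧ ∀ t > n.unpair.1, h n.unpair.1 < h t := by
    intro n hn
    simp only [Wset, Set.mem_compl_iff, Set.mem_ofPred_eq] at hn
    push Not at hn
    exact hn
  refine Set.Finite.of_finite_image (f := fun n => n.unpair.2) ?_ ?_
  · refine (Set.finite_lt_nat v).subset ?_
    rintro _ ⟨n, hn, rfl⟩
    obtain ⟨h1, h2⟩ := hb n hn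
    obtain ⟨t, ht, e⟩ := hv (n.unpair.1 + 1)
    have := h2 t (by omega)
    dsimp only [Set.mem_ofPred_eq]
    omega
  · intro n hn n' hn' e
    obtain ⟨h1, h2⟩ := hb n hn
    obtain ⟨h3, h4⟩ := hb n' hn'
    dsimp only at e
    have : n.unpair.1 = n'.unpair.1 := by
      rcases lt_trichotomy n.unpair.1 n'.unpair.1 with hl | hl | hl
      · have := h2 _ hl; omega
      · exact hl
      · have := h4 _ hl; omega
    rw [← Nat.pair_unpair n, ← Nat.pair_unpair n', this, e]

theorem exists_last {h : ℕ → ℕ} (hr : ¬ Rec h) (N x : ℕ) : ∃ s ≥ N, x < h s ∧ ∀ t > s, h s < h t := by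
  obtain ⟨N1, hN1⟩ := not_rec hr x
  set M := max N N1 with hM
  have h1 : ∃ v, ∃ t ≥ M, h t = v := ⟨_, M, le_rfl, rfl⟩
  obtain ⟨t0, ht0, e0⟩ := Nat.find_spec h1
  have hmin : ∀ t ≥ M, h t0 ≤ h t := fun t ht => by rw [e0]; exact Nat.find_le ⟨t, ht, rfl⟩
  obtain ⟨N2, hN2⟩ := not_rec hr (h t0)
  have hs := Nat.sSup_mem (s := {t | t ≥ M ∧ h t = h t0}) ⟨t0, ht0, rfl⟩ ⟨N2, fun t ht => by
    by_contra hc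
    have := hN2 t (by omega)
    rw [ht.2] at this
    omega⟩
  have hb : ∀ t, t ≥ M ∧ h t = h t0 → t ≤ sSup {t | t ≥ M ∧ h t = h t0} := fun t ht => le_csSup ⟨N2, fun t ht => by
    by_contra hc
    have := hN2 t (by omega)
    rw [ht.2] at this
    omega⟩ ht
  set s := sSup {t | t ≥ M ∧ h t = h t0}
  refine ⟨s, by have := hs.1; omega, hN1 s (by have := hs.1; omega), fun t ht => ?_⟩
  have h5 := hmin t (by have := hs.1; omega)
  rw [hs.2]
  refine lt_of_le_of_ne h5 fun e => ?_
  have := hb t ⟨by have := hs.1; omega, e.symm⟩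
  omega

theorem Wset_nc {h : ℕ → ℕ} (hr : ¬ Rec h) (hk : ∀ t, h t ≤ kap t) : ¬ ComputablePred fun n => n ∈ Wset h := by
  intro hW
  refine K_search (P := fun x s => ¬ ((s-1) ∈ Wset h ∨ s = 0 ∨ (s-1).unpair.2 ≤ x)) ?_ ?_ ?_
  · obtain ⟨inst, hc⟩ := hW
    refine ⟨inferInstance, ?_⟩
    have h1 : Computable fun p : ℕ × ℕ => decide ((p.2 - 1) ∈ Wset h) :=
      (Computable.of_eq hc fun p => decide_eq_decide.2 Iff.rfl).comp
        (f := fun n => decide (n ∈ Wset h)) (g := fun p : ℕ × ℕ => p.2 - 1) (by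
          exact Primrec.to_comp (by fun_prop))
    have h2 : Computable fun p : ℕ × ℕ => (p, decide ((p.2 - 1) ∈ Wset h)) := Computable.id.pair h1
    have h3 : Primrec fun q : (ℕ × ℕ) × Bool => !(q.2 || (decide (q.1.2 = 0) || decide ((q.1.2-1).unpair.2 ≤ q.1.1))) := by
      fun_prop
    refine (h3.to_comp.comp h2).of_eq fun p => ?_
    by_cases h4 : (p.2 - 1) ∈ Wset h <;> by_cases h5 : p.2 = 0 <;> by_cases h6 : (p.2 - 1).unpair.2 ≤ p.1 <;> simp [h4, h5, h6]
  · intro x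
    obtain ⟨s, -, h1, h2⟩ := exists_last hr 0 x
    refine ⟨Nat.pair s (h s) + 1, ?_⟩
    simp only [Nat.add_sub_cancel, Nat.unpair_pair, Wset, Set.mem_ofPred_eq]
    push Not
    exact ⟨⟨rfl, h2⟩, by omega, h1⟩
  · intro x s hP hx
    simp only [Wset, Set.mem_ofPred_eq] at hP
    push Not at hP
    obtain ⟨⟨h1, h2⟩, h3, h4⟩ := hP
    refine kap_search (s0 := (s-1).unpair.1 + 1) (fun t ht => ?_) ?_ hx
    · have := h2 t (by omega)
      have := hk t
      omega
    · have := Nat.unpair_left_le (s-1)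
      omega

theorem real2 {J : ℕ → Prop} (hJ : Sg 2 (fun (i : ℕ) (_ : Cantor) => J i)) :
    ∃ g : List Bool → ℕ → Bool, (Primrec fun p : List Bool × ℕ => g p.1 p.2) ∧
      ∀ Z, ∃ h : ℕ → ℕ, {n | ∃ k, g (initSeg Z k) n = true} = Wset h ∧ (∀ t, h t ≤ kap t) ∧
        (Z ∈ DJ J ↔ Rec h) := by
  obtain ⟨h, hh, e⟩ := (Sg_EJ (by norm_num) hJ).EV
  have hh' : Primrec fun p : List Bool × ℕ => h p.1 p.2 := hh
  let hS : List Bool → ℕ → ℕ := fun σ t => min (Nat.pair t.unpair.1 (h (σ.take t.unpair.1) t.unpair.2)) (kap t)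
  have hhS : Primrec fun p : List Bool × ℕ => hS p.1 p.2 := by
    dsimp only [hS]; fun_prop
  refine ⟨fun σ n => decide (n.unpair.1 < σ.length) && (!decide (n.unpair.2 = hS σ n.unpair.1) ||
    (List.range σ.length).any fun t => decide (n.unpair.1 < t) && decide (hS σ t ≤ hS σ n.unpair.1)), ?_, ?_⟩
  · fun_prop
  · intro Z
    let hZ : ℕ → ℕ := fun t => min (Nat.pair t.unpair.1 (h (initSeg Z t.unpair.1) t.unpair.2)) (kap t)
    have hSZ : ∀ k t, t < k → hS (initSeg Z k) t = hZ t := by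
      intro k t ht
      have := Nat.unpair_left_le t
      simp only [hS, hZ, initSeg_take Z (show t.unpair.1 ≤ k by omega)]
    refine ⟨hZ, ?_, fun t => min_le_right _ _, ?_⟩
    · ext n
      simp only [Wset, Set.mem_ofPred_eq, Bool.and_eq_true, decide_eq_true_eq, Bool.or_eq_true, Bool.not_eq_true',
        decide_eq_false_iff_not, List.any_eq_true, List.mem_range, length_initSeg]
      constructor
      · rintro ⟨k, hk, h1⟩
        rw [hSZ k _ hk] at h1
        rcases h1 with h1 | ⟨t, ht, h2, h3⟩
        · exact Or.inl h1
        · rw [hSZ k t ht] at h3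
          exact Or.inr ⟨t, h2, h3⟩
      · rintro (h1 | ⟨t, h2, h3⟩)
        · refine ⟨n.unpair.1 + 1, by omega, Or.inl ?_⟩
          rwa [hSZ _ _ (by omega)]
        · refine ⟨t + 1, by omega, Or.inr ⟨t, by omega, h2, ?_⟩⟩
          rwa [hSZ _ _ (by omega), hSZ _ _ (by omega)]
    · rw [DJ_iff]
      constructor
      · rintro ⟨j, hj⟩
        obtain ⟨v, hv⟩ := (e _).1 hj
        refine rec_of_bdd (y := Nat.pair j v) fun N => ?_
        obtain ⟨t, ht, e1⟩ := hv N
        refine ⟨Nat.pair j t, le_trans ht (Nat.right_le_pair j t), ?_⟩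
        simp only [hZ, Nat.unpair_pair, e1]
        exact min_le_left _ _
      · rintro ⟨v, hv⟩
        by_contra hc
        push Not at hc
        have h1 : ∀ j, ∃ N, ∀ t ≥ N, v < h (initSeg Z j) t := fun j =>
          not_rec (fun hr => hc j ((e _).2 hr)) v
        choose N hN using h1
        obtain ⟨N1, hN1⟩ := kap_unb v
        set B := (Finset.range (v+1)).sup N
        obtain ⟨t, ht, e1⟩ := hv (max N1 (Nat.pair (v+1) (B+1)))
        have h2 := hN1 t (by omega)
        simp only [hZ] at e1
        have h3 : Nat.pair t.unpair.1 (h (initSeg Z t.unpair.1) t.unpair.2) = v := by omega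
        have h4 := Nat.left_le_pair t.unpair.1 (h (initSeg Z t.unpair.1) t.unpair.2)
        have h5 := Nat.right_le_pair t.unpair.1 (h (initSeg Z t.unpair.1) t.unpair.2)
        have h6 := Finset.le_sup (f := N) (Finset.mem_range.2 (show t.unpair.1 < v + 1 by omega))
        by_cases h7 : B ≤ t.unpair.2
        · have := hN t.unpair.1 t.unpair.2 (le_trans h6 h7)
          omega
        · have h8 : t < Nat.pair (v+1) (B+1) := by
            conv_lhs => rw [← Nat.pair_unpair t]
            exact lt_trans (Nat.pair_lt_pair_left _ (by omega)) (Nat.pair_lt_pair_right _ (by omega))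
          omega

theorem comp_of_cof {S : Set ℕ} (hf : Sᶜ.Finite) : ComputablePred fun n => n ∈ S := by
  refine ⟨inferInstance, ?_⟩
  have h1 : Primrec fun n : ℕ => !(hf.toFinset.toList.any fun y => decide (y = n)) := by fun_prop
  refine h1.to_comp.of_eq fun n => ?_
  by_cases hn : n ∈ S
  · simp only [hn, decide_true, Bool.not_eq_true', List.any_eq_false, Finset.mem_toList, Set.Finite.mem_toFinset]
    rintro x hx
    simp only [decide_eq_true_eq]
    rintro rfl
    exact hx hn
  · simp [hn]

theorem cof_variance : ∃ u v : CodeO, UniversalOM u ∧ UniversalOM v ∧ TIncompReal (muR (COF u)) (muR (COF v)) := by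
  have hC : ∀ u, Sg 2 (fun (_ : Unit) X => (domSet u X)ᶜ.Finite) := fun u => by
    have h1 : Sg 0 (fun (p : (Unit × ℕ) × ℕ) X => (p.1.2 + p.2) ∈ domSet u X) :=
      (Sg_dom u).subst (f := fun p : (Unit × ℕ) × ℕ => p.1.2 + p.2) (by fun_prop)
    refine h1.not.ex.not.ex.congr fun a X => ?_
    constructor
    · intro h
      obtain ⟨N, hN⟩ := h.bddAbove
      refine ⟨N+1, ?_⟩
      rintro ⟨n, hn⟩
      have := hN hn
      dsimp only at this
      omega
    · rintro ⟨N, hN⟩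
      push Not at hN
      refine (Set.finite_lt_nat N).subset fun n hn => ?_
      by_contra hc
      simp only [Set.mem_ofPred_eq, not_lt] at hc
      have := hN (n - N)
      dsimp only at this
      rw [Nat.add_sub_cancel' (by omega)] at this
      exact hn this
  refine om_variance (C := fun S => Sᶜ.Finite) (by norm_num) hC ?_
  intro J hJ
  obtain ⟨g, hg, h⟩ := real2 hJ
  refine ⟨g, hg, fun Z => ?_⟩
  obtain ⟨h, e, hk, hr⟩ := h Z
  rw [e, hr]
  refine ⟨fun hf => ?_, Wset_cof⟩
  by_contra hc
  refine Wset_nc hc hk ?_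
  exact comp_of_cof hf

def HH (e n : ℕ) : Prop := ∃ k, (Code.evaln k (Denumerable.ofNat Code e) n).isSome

theorem HH_iff {e n : ℕ} : HH e n ↔ ((Denumerable.ofNat Code e).eval n).Dom := by
  rw [Part.dom_iff_mem]
  simp only [HH, Option.isSome_iff_exists, Code.evaln_complete, Option.mem_def]
  exact exists_comm

theorem RE_iff {p : ℕ → Prop} : REPred p ↔ ∃ e, ∀ n, p n ↔ HH e n := by
  constructor
  · intro h
    have h' : Partrec fun n => ((Part.assert (p n) fun _ => Part.some ()).map fun _ => 0 : Part ℕ) :=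
      Partrec.map h ((Computable.const 0).to₂)
    obtain ⟨c, hc⟩ := Code.exists_code.1 (Partrec.nat_iff.1 h')
    refine ⟨Encodable.encode c, fun n => ?_⟩
    rw [HH_iff, Denumerable.ofNat_encode, hc]
    simp only [Part.map_Dom]
    exact ⟨fun h => ⟨h, trivial⟩, fun h => h.1⟩
  · rintro ⟨e, he⟩
    have : Partrec fun n => (Denumerable.ofNat Code e).eval n := 
      Partrec.nat_iff.2 (Code.exists_code.2 ⟨_, rfl⟩)
    exact this.dom_re.of_eq fun n => by rw [he, HH_iff]

theorem Sg_HH {α : Type} [Primcodable α] {m : ℕ} {f g : α → ℕ} (hf : Primrec f) (hg : Primrec g) :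
    Sg m (fun (a : α) _ => HH (f a) (g a)) := by
  have hd : Primrec (Denumerable.ofNat Code) := Primrec.ofNat Code
  have h1 : Sg 0 (fun (p : α × ℕ) (_ : Cantor) => (Code.evaln p.2 (Denumerable.ofNat Code (f p.1)) (g p.1)).isSome = true) := by
    refine Sg.prim ?_
    have : Primrec fun p : α × ℕ => (Code.evaln p.2 (Denumerable.ofNat Code (f p.1)) (g p.1)).isSome := by
      refine Primrec.option_isSome.comp (fp_evaln (by fun_prop) (hd.comp (by fun_prop)) (by fun_prop))
    simpa using this
  exact h1.ex.le (Nat.zero_le _)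

theorem com_variance : ∃ u v : CodeO, UniversalOM u ∧ UniversalOM v ∧ TIncompReal (muR (COM u)) (muR (COM v)) := by
  have hC : ∀ u, Sg 2 (fun (_ : Unit) X => ComputablePred fun n => n ∈ domSet u X) := fun u => by
    have hd : Sg 0 (fun (p : (Unit × ℕ) × ℕ) X => p.2 ∈ domSet u X) :=
      (Sg_dom u).subst (f := fun p : (Unit × ℕ) × ℕ => p.2) (by fun_prop)
    have h1 : Sg 0 (fun (p : (Unit × ℕ) × ℕ) (_ : Cantor) => HH p.1.2.unpair.1 p.2) := Sg_HH (by fun_prop) (by fun_prop)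
    have h2 : Sg 0 (fun (p : (Unit × ℕ) × ℕ) (_ : Cantor) => HH p.1.2.unpair.2 p.2) := Sg_HH (by fun_prop) (by fun_prop)
    have h3 := ((hd.or h2).not.ex.not).and (((h1.or h2).not.ex.not).and ((((hd.or h1).and h2).ex.not).lift))
    refine h3.ex.congr fun a X => ?_
    rw [ComputablePred.computable_iff_re_compl_re]
    simp only [RE_iff]
    push Not
    constructor
    · rintro ⟨⟨e1, he1⟩, ⟨e2, he2⟩⟩
      refine ⟨Nat.pair e1 e2, ?_⟩
      simp only [Nat.unpair_pair]
      refine ⟨fun n => ?_, fun n => ?_, fun n => ?_⟩ <;> rw [← he2 n] <;> try rw [← he1 n]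
      all_goals tauto
    · rintro ⟨e, h1, h2, h3⟩
      refine ⟨⟨e.unpair.1, fun n => ?_⟩, ⟨e.unpair.2, fun n => ?_⟩⟩ <;> have := h1 n <;> have := h2 n <;> have := h3 n <;> tauto
  refine om_variance (C := fun S => ComputablePred fun n => n ∈ S) (by norm_num) hC ?_
  intro J hJ
  obtain ⟨g, hg, h⟩ := real2 hJ
  refine ⟨g, hg, fun Z => ?_⟩
  obtain ⟨h, e, hk, hr⟩ := h Z
  rw [e, hr]
  refine ⟨fun hf => ?_, fun hf => comp_of_cof (Wset_cof hf)⟩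
  by_contra hc
  exact Wset_nc hc hk hf

end RandProb

end

section
open Nat.Partrec (Code)
namespace RandProb

def pfx (σ τ : List Bool) : Bool := decide (σ = τ.take σ.length)

theorem pfx_iff {σ τ : List Bool} : pfx σ τ = true ↔ σ <+: τ := by
  rw [pfx, decide_eq_true_eq, ← List.prefix_iff_eq_take]

@[fun_prop] theorem fp_pfx {α : Type} [Primcodable α] {f g : α → List Bool} (hf : Primrec f) (hg : Primrec g) :
    Primrec fun x => pfx (f x) (g x) := by
  unfold pfx; fun_prop

@[fun_prop] theorem fp_ofNatCode {α : Type} [Primcodable α] {f : α → ℕ} (hf : Primrec f) :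
    Primrec fun x => Denumerable.ofNat Code (f x) := (Primrec.ofNat Code).comp hf

def mval (e s n : ℕ) : Option (List Bool) :=
  (Code.evaln s (Denumerable.ofNat Code e) n).bind fun v => (Encodable.decode v : Option (List Bool))

@[fun_prop] theorem fp_mval {α : Type} [Primcodable α] {f g h : α → ℕ} (hf : Primrec f) (hg : Primrec g) (hh : Primrec h) :
    Primrec fun x => mval (f x) (g x) (h x) := by
  unfold mval; fun_prop

theorem mval_mono {e s s' n : ℕ} {a : List Bool} (h : s ≤ s') (ha : mval e s n = some a) : mval e s' n = some a := by
  simp only [mval, Option.bind_eq_some_iff] at ha ⊢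
  obtain ⟨v, h1, h2⟩ := ha
  exact ⟨v, Code.evaln_mono h h1, h2⟩

theorem mval_lt {e s n : ℕ} {a : List Bool} (ha : mval e s n = some a) : n < s := by
  simp only [mval, Option.bind_eq_some_iff] at ha
  obtain ⟨v, h1, h2⟩ := ha
  exact Code.evaln_bound h1

def mok (e s : ℕ) (τ a : List Bool) (n : ℕ) : Bool :=
  ((Encodable.decode n : Option (List Bool)).bind fun τ' => (mval e s n).map fun a' =>
    (!pfx τ' τ || pfx a' a) && (!pfx τ τ' || pfx a a')).getD true

def mg (e : ℕ) (τ : List Bool) (s : ℕ) : Option (List Bool) :=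
  (mval e s (Encodable.encode τ)).bind fun a => if ((List.range s).all fun n => mok e s τ a n) = true then some a else none

@[fun_prop] theorem fp_mg {α : Type} [Primcodable α] {f h : α → ℕ} {g : α → List Bool} (hf : Primrec f) (hg : Primrec g) (hh : Primrec h) :
    Primrec fun x => mg (f x) (g x) (h x) := by
  unfold mg mok; fun_prop

theorem mg_iff {e s : ℕ} {τ a : List Bool} : mg e τ s = some a ↔
    mval e s (Encodable.encode τ) = some a ∧ ∀ n < s, mok e s τ a n = true := by
  simp only [mg, Option.bind_eq_some_iff, List.all_eq_true, List.mem_range]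
  constructor
  · rintro ⟨b, h1, h2⟩
    split_ifs at h2 with h3
    cases h2
    exact ⟨h1, h3⟩
  · rintro ⟨h1, h2⟩
    exact ⟨a, h1, by rw [if_pos h2]⟩

theorem mok_use {e s : ℕ} {τ τ' a a' : List Bool} (h : ∀ n < s, mok e s τ a n = true)
    (h' : mval e s (Encodable.encode τ') = some a') : (τ' <+: τ → a' <+: a) ∧ (τ <+: τ' → a <+: a') := by
  have := h _ (mval_lt h')
  simp only [mok, Encodable.encodek, h', Option.bind_some, Option.map_some, Option.getD_some, Bool.and_eq_true,
    Bool.or_eq_true, Bool.not_eq_true', pfx_iff, ← Bool.not_eq_true] at this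
  tauto

theorem mg_mono (e : ℕ) {σ τ : List Bool} {s s' : ℕ} {a b : List Bool} (h : σ <+: τ) (ha : mg e σ s = some a)
    (hb : mg e τ s' = some b) : a <+: b := by
  rw [mg_iff] at ha hb
  rcases le_total s s' with hl | hl
  · exact (mok_use hb.2 (mval_mono hl ha.1)).1 h
  · exact (mok_use ha.2 (mval_mono hl hb.1)).2 h

/-- monotone machine from stage approximations -/
def mkM (G : List Bool → ℕ → Option (List Bool)) (hG : Primrec fun p : List Bool × ℕ => G p.1 p.2)
    (hm : ∀ {σ τ : List Bool} {s s' : ℕ} {a b : List Bool}, σ <+: τ → G σ s = some a → G τ s' = some b → a <+: b) :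
    MonoMachine where
  f := fun σ => Nat.rfindOpt (G σ)
  partrec := Partrec.rfindOpt (Primrec.to_comp hG).to₂
  mono := by
    intro σ τ a b h ha hb
    obtain ⟨s, hs⟩ := Nat.rfindOpt_spec ha
    obtain ⟨s', hs'⟩ := Nat.rfindOpt_spec hb
    exact hm h hs hs'

theorem rfO_iff {G : ℕ → Option (List Bool)} (hu : ∀ {s s' a b}, G s = some a → G s' = some b → a <+: b) {a} :
    a ∈ Nat.rfindOpt G ↔ ∃ s, G s = some a := by
  refine ⟨Nat.rfindOpt_spec, ?_⟩
  rintro ⟨s, hs⟩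
  have hd := Nat.rfindOpt_dom.2 ⟨s, a, hs⟩
  obtain ⟨s', hs'⟩ := Nat.rfindOpt_spec (Part.get_mem hd)
  have h1 := hu hs hs'
  have h2 := hu hs' hs
  have : a = (Nat.rfindOpt G).get hd := h1.eq_of_length (le_antisymm h1.length_le h2.length_le)
  rw [this]; exact Part.get_mem hd

theorem prefix_self (σ : List Bool) : σ <+: σ := ⟨[], by simp⟩

def Mm (e : ℕ) : MonoMachine := mkM (mg e) (by fun_prop) (mg_mono e)

theorem Mm_all (V : MonoMachine) : ∃ e, (Mm e).f = V.f := by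
  obtain ⟨c, hc⟩ := Code.exists_code.1 V.partrec
  have hev : ∀ n τ, (Encodable.decode n : Option (List Bool)) = some τ → c.eval n = (V.f τ).map Encodable.encode := by
    intro n τ h
    rw [hc]
    simp [h]
  have hval : ∀ s n τ a, (Encodable.decode n : Option (List Bool)) = some τ → mval (Encodable.encode c) s n = some a →
      a ∈ V.f τ := by
    intro s n τ a h h1
    simp only [mval, Denumerable.ofNat_encode, Option.bind_eq_some_iff] at h1
    obtain ⟨v, h2, h3⟩ := h1
    have h4 := Code.evaln_sound h2
    rw [hev n τ h, Part.mem_map_iff] at h4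
    obtain ⟨a', h5, rfl⟩ := h4
    rw [Encodable.encodek] at h3
    cases h3
    exact h5
  refine ⟨Encodable.encode c, ?_⟩
  funext τ
  ext a
  show a ∈ Nat.rfindOpt (mg (Encodable.encode c) τ) ↔ _
  rw [rfO_iff (fun h h' => mg_mono _ (prefix_self τ) h h')]
  constructor
  · rintro ⟨s, hs⟩
    exact hval s _ τ a (Encodable.encodek τ) (mg_iff.1 hs).1
  · intro ha
    have h1 : Encodable.encode a ∈ c.eval (Encodable.encode τ) := by
      rw [hev _ τ (Encodable.encodek τ)]
      exact Part.mem_map _ ha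
    obtain ⟨s, hs⟩ := Code.evaln_complete.1 h1
    refine ⟨s, mg_iff.2 ⟨?_, fun n hn => ?_⟩⟩
    · simp only [mval, Denumerable.ofNat_encode, Option.bind_eq_some_iff]
      exact ⟨_, hs, Encodable.encodek a⟩
    · unfold mok
      cases h2 : (Encodable.decode n : Option (List Bool)) with
      | none => rfl
      | some τ' =>
        cases h3 : mval (Encodable.encode c) s n with
        | none => rfl
        | some a' =>
          have h4 := hval s n τ' a' h2 h3
          simp only [Option.bind_some, Option.map_some, Option.getD_some, Bool.and_eq_true,
            Bool.or_eq_true, Bool.not_eq_true', pfx_iff, ← Bool.not_eq_true]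
          have h5 : τ' <+: τ → a' <+: a := fun h => V.mono h h4 ha
          have h6 : τ <+: τ' → a <+: a' := fun h => V.mono h ha h4
          tauto

/-- decoder of the standard universal monotone machine -/
def G0 (σ : List Bool) (s : ℕ) : Option (List Bool) :=
  if lead σ < σ.length then mg (lead σ) (σ.drop (lead σ + 1)) s else none

@[fun_prop] theorem fp_G0 {α : Type} [Primcodable α] {f : α → List Bool} {g : α → ℕ} (hf : Primrec f) (hg : Primrec g) :
    Primrec fun x => G0 (f x) (g x) := by unfold G0; fun_prop

theorem lead_lt {σ : List Bool} (h : lead σ < σ.length) : ∃ τ, σ = onesZ (lead σ) ++ τ := by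
  induction σ with
  | nil => simp at h
  | cons b σ ih =>
    cases b with
    | false => exact ⟨σ, by simp [lead, onesZ]⟩
    | true =>
      have e : lead (true :: σ) = lead σ + 1 := rfl
      rw [e] at h ⊢
      obtain ⟨τ, hτ⟩ := ih (by simpa using h)
      exact ⟨τ, by rw [onesZ, List.replicate_succ, List.cons_append, List.cons_append, ← onesZ, ← hτ]⟩

theorem lead_onesZ (e : ℕ) (τ : List Bool) : lead (onesZ e ++ τ) = e := by
  rw [onesZ, List.append_assoc]; exact lead_ones _ _

theorem length_onesZ (e : ℕ) : (onesZ e).length = e + 1 := by simp [onesZ]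

theorem G0_onesZ (e : ℕ) (τ : List Bool) : G0 (onesZ e ++ τ) = mg e τ := by
  funext s
  rw [G0, lead_onesZ, if_pos (by simp [length_onesZ]; omega), ← length_onesZ, List.drop_left]

theorem G0_mono {σ τ : List Bool} {s s' : ℕ} {a b : List Bool} (h : σ <+: τ) (ha : G0 σ s = some a)
    (hb : G0 τ s' = some b) : a <+: b := by
  have h1 : lead σ < σ.length := by
    by_contra hc
    rw [G0, if_neg hc] at ha
    cases ha
  obtain ⟨σ', e⟩ := lead_lt h1
  obtain ⟨ρ, rfl⟩ := h
  rw [e, G0_onesZ] at ha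
  rw [e, List.append_assoc, G0_onesZ] at hb
  exact mg_mono _ (List.prefix_append _ _) ha hb

def GU (d : List Bool → List Bool) (σ : List Bool) (s : ℕ) : Option (List Bool) :=
  if σ.length = 0 then none else
  if σ[0]? = some false then G0 (σ.drop 1) s else some (d (σ.drop 1))

theorem mono_real {d : List Bool → List Bool} (hd : Primrec d) (hm : ∀ {σ τ : List Bool}, σ <+: τ → d σ <+: d τ) :
    ∃ U : MonoMachine, UniversalMono U ∧ 
      (∀ X, consC false X ∈ MonoINF U ↔ ∀ k, ∃ n s a, G0 (initSeg X n) s = some a ∧ k ≤ a.length) ∧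
      (∀ X, consC true X ∈ MonoINF U ↔ ∀ k, ∃ n, k ≤ (d (initSeg X n)).length) ∧
      (∀ X, X ∈ MonoINF U ↔ ∀ k, ∃ n s a, GU d (initSeg X n) s = some a ∧ k ≤ a.length) := by
  have hf : ∀ σ s, GU d (false :: σ) s = G0 σ s := fun σ s => by simp [GU]
  have ht : ∀ σ s, GU d (true :: σ) s = some (d σ) := fun σ s => by simp [GU]
  have hn : ∀ s, GU d [] s = none := fun s => by simp [GU]
  have hmm : ∀ {σ τ : List Bool} {s s' : ℕ} {a b : List Bool}, σ <+: τ → GU d σ s = some a → GU d τ s' = some b → a <+: b := by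
    intro σ τ s s' a b h ha hb
    obtain ⟨ρ, rfl⟩ := h
    cases σ with
    | nil => rw [hn] at ha; cases ha
    | cons x σ =>
      cases x with
      | false =>
        rw [hf] at ha
        rw [List.cons_append, hf] at hb
        exact G0_mono (List.prefix_append _ _) ha hb
      | true =>
        rw [ht] at ha
        rw [List.cons_append, ht] at hb
        cases ha; cases hb
        exact hm (List.prefix_append _ _)
  let U := mkM (GU d) (by unfold GU; fun_prop) hmm
  have hU : ∀ σ a, a ∈ U.f σ ↔ ∃ s, GU d σ s = some a := fun σ a =>
    rfO_iff (fun h h' => hmm (prefix_self σ) h h')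
  have hI : ∀ X, X ∈ MonoINF U ↔ ∀ k, ∃ n s a, GU d (initSeg X n) s = some a ∧ k ≤ a.length := by
    intro X
    simp only [MonoINF, Set.mem_ofPred_eq, hU]
    refine forall_congr' fun k => ⟨?_, ?_⟩
    · rintro ⟨n, a, ⟨s, h⟩, h'⟩
      exact ⟨n, s, a, h, h'⟩
    · rintro ⟨n, s, a, h, h'⟩
      exact ⟨n, a, ⟨s, h⟩, h'⟩
  have hz : ∀ X : Cantor, initSeg X 0 = [] := fun X => rfl
  refine ⟨U, ⟨Mm, fun e => false :: onesZ e, ?_, Mm_all, ?_, ?_, ?_⟩, ?_, ?_, hI⟩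
  · exact Partrec.rfindOpt (f := fun (p : ℕ × List Bool) s => mg p.1 p.2 s) 
      (show Primrec fun q : (ℕ × List Bool) × ℕ => mg q.1.1 q.1.2 q.2 by fun_prop).to_comp.to₂
  · exact (show Primrec _ by fun_prop).to_comp
  · rintro _ ⟨c, rfl⟩ _ ⟨d, rfl⟩ h
    obtain ⟨ρ, h⟩ := h
    have h' : onesZ c ++ ρ = onesZ d ++ [] := by
      simpa using h
    simp [onesZ_inj h']
  · intro e τ
    show Nat.rfindOpt (GU d _) = Nat.rfindOpt (mg e τ)
    congr 1
    funext s
    show GU d (false :: onesZ e ++ τ) s = _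
    rw [List.cons_append, hf, G0_onesZ]
  · intro X
    rw [hI]
    refine forall_congr' fun k => ⟨?_, ?_⟩
    · rintro ⟨n, s, a, h, h'⟩
      cases n with
      | zero => rw [hz, hn] at h; cases h
      | succ n => rw [initSeg_consC, hf] at h; exact ⟨n, s, a, h, h'⟩
    · rintro ⟨n, s, a, h, h'⟩
      exact ⟨n+1, s, a, by rwa [initSeg_consC, hf], h'⟩
  · intro X
    rw [hI]
    refine forall_congr' fun k => ⟨?_, ?_⟩
    · rintro ⟨n, s, a, h, h'⟩
      cases n with
      | zero => rw [hz, hn] at h; cases h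
      | succ n => rw [initSeg_consC, ht] at h; cases h; exact ⟨n, h'⟩
    · rintro ⟨n, h⟩
      exact ⟨n+1, 0, _, by rw [initSeg_consC, ht], h⟩

theorem Sg_monoinf {G : List Bool → ℕ → Option (List Bool)} (hG : Primrec fun p : List Bool × ℕ => G p.1 p.2) :
    Sg 1 (fun (_ : Unit) X => ¬ ∀ k, ∃ n s a, G (initSeg X n) s = some a ∧ k ≤ a.length) := by
  have h1 : Sg 0 (fun (p : ((Unit × ℕ) × ℕ) × ℕ) X => 
      ((G (initSeg X p.1.2) p.2).map fun a => decide (p.1.1.2 ≤ a.length)).getD false = true) :=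
    Sg.primX (R := fun (p : ((Unit × ℕ) × ℕ) × ℕ) σ => 
      ((G σ p.2).map fun a => decide (p.1.1.2 ≤ a.length)).getD false) (f := fun p => p.1.2) (by
        have h2 : Primrec fun q : (((Unit × ℕ) × ℕ) × ℕ) × List Bool => G q.2 q.1.2 := hG.comp (g := fun q : (((Unit × ℕ) × ℕ) × ℕ) × List Bool => (q.2, q.1.2)) (by fun_prop)
        have h3 : Primrec fun q : ℕ × Option (List Bool) => (q.2.map fun a => decide (q.1 ≤ a.length)).getD false := by fun_prop
        exact h3.comp (g := fun q : (((Unit × ℕ) × ℕ) × ℕ) × List Bool => (q.1.1.1.2, G q.2 q.1.2)) 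
          (fp_mk (by fun_prop) h2)) (by fun_prop)
  refine h1.ex.ex.not.ex.congr fun a X => ?_
  push Not
  refine exists_congr fun k => forall_congr' fun n => forall_congr' fun s => ?_
  dsimp only
  cases h : G (initSeg X n) s <;> simp

theorem mono_variance : ∃ U V : MonoMachine, UniversalMono U ∧ UniversalMono V ∧
    TIncompReal (muR (MonoINF U)) (muR (MonoINF V)) := by
  let S0 : Set Cantor := {X | ¬ ∀ k, ∃ n s a, G0 (initSeg X n) s = some a ∧ k ≤ a.length}
  have hS0 : Sg 1 (fun (_ : Unit) X => X ∈ S0) := Sg_monoinf (by fun_prop)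
  obtain ⟨J, J', hJ, hJ', h⟩ := core le_rfl (muR_nonneg S0) (muR_le_one _)
    (hS0.measure.subst (f := fun p : ℕ × ℕ => ((), p)) (by fun_prop))
  have key : ∀ J : ℕ → Prop, Sg 1 (fun (i : ℕ) (_ : Cantor) => J i) → ∃ U, UniversalMono U ∧
      1 - muR (MonoINF U) = 1/2 * muR S0 + 1/2 * muR (DJ J) := by
    intro J hJ
    obtain ⟨g, hg, h1, h2⟩ := real1 hJ
    let cn : List Bool → ℕ := fun σ => lf σ.length fun n => !((List.range (σ.length + 1)).any fun k => g (σ.take k) n)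
    have hcn : ∀ {σ τ : List Bool}, σ <+: τ → cn σ ≤ cn τ := by
      intro σ τ h
      refine le_lf (fun y hy => ?_) ((lf_le _ _).trans h.length_le)
      have := lf_min hy
      simp only [Bool.not_eq_false', List.any_eq_true, List.mem_range] at this ⊢
      obtain ⟨k, hk, hk'⟩ := this
      have := h.length_le
      refine ⟨k, by omega, ?_⟩
      obtain ⟨ρ, rfl⟩ := h
      rwa [List.take_append_of_le_length (by omega)]
    obtain ⟨U, hU, u1, u2, u3⟩ := mono_real (d := fun σ => List.replicate (cn σ) true) (by dsimp only [cn]; fun_prop)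
      (fun {σ τ} h => by
        obtain ⟨k, hk⟩ := Nat.exists_eq_add_of_le (hcn h)
        rw [hk, List.replicate_add]
        exact List.prefix_append _ _)
    refine ⟨U, hU, ?_⟩
    have hme : MeasurableSet (MonoINF U)ᶜ := by
      have : Sg 1 (fun (_ : Unit) X => X ∈ (MonoINF U)ᶜ) := by
        refine (Sg_monoinf (G := GU fun σ => List.replicate (cn σ) true) ?_).congr fun a X => ?_
        · unfold GU; dsimp only [cn]; fun_prop
        · rw [Set.mem_compl_iff, u3]
      exact this.measurable ()
    rw [← muR_compl (MeasurableSet.of_compl hme), muR_half hme]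
    have e1 : {Z | consC false Z ∈ (MonoINF U)ᶜ} = S0 := by
      ext Z
      simp only [Set.mem_ofPred_eq, Set.mem_compl_iff, u1, S0]
    have e2 : {Z | consC true Z ∈ (MonoINF U)ᶜ} = DJ J := by
      ext Z
      simp only [Set.mem_ofPred_eq, Set.mem_compl_iff, u2, List.length_replicate]
      constructor
      · intro h
        by_contra hc
        apply h
        intro N
        have h3 := h2 Z hc
        choose k hk using h3
        refine ⟨max N ((Finset.range N).sup k), le_lf (fun y hy => ?_) (by simp)⟩
        have hle := Finset.le_sup (f := k) (Finset.mem_range.2 hy)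
        have hle' : k y ≤ max N ((Finset.range N).sup k) := le_trans hle (le_max_right _ _)
        simp only [Bool.not_eq_false', List.any_eq_true, List.mem_range, length_initSeg]
        exact ⟨k y, by omega, by rw [initSeg_take Z hle']; exact hk y⟩
      · intro hZ h
        obtain ⟨N, hN⟩ := h1 Z hZ
        obtain ⟨n, hn⟩ := h (N+1)
        have := lf_min (show N < cn (initSeg Z n) by omega)
        simp only [Bool.not_eq_false', List.any_eq_true, List.mem_range, length_initSeg] at this
        obtain ⟨k, hk, hk'⟩ := this
        rw [initSeg_take Z (by omega)] at hk'
        exact hN N le_rfl ⟨k, hk'⟩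
    rw [e1, e2]
  obtain ⟨U, hU, e⟩ := key J hJ
  obtain ⟨V, hV, e'⟩ := key J' hJ'
  rw [← e, ← e'] at h
  exact ⟨U, V, hU, hV, by simpa using TIncomp_compl h⟩

end RandProb

end

section
open Nat.Partrec (Code)
namespace RandProb

def ival (e s : ℕ) (ρ : List Bool) (i : ℕ) : Option (Option (List Bool)) :=
  (Code.evaln s (Denumerable.ofNat Code e) (Encodable.encode (ρ, i))).bind fun v =>
    (Encodable.decode v : Option (Option (List Bool)))

@[fun_prop] theorem fp_ival {α : Type} [Primcodable α] {f g h : α → ℕ} {r : α → List Bool} (hf : Primrec f) (hg : Primrec g)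
    (hr : Primrec r) (hh : Primrec h) : Primrec fun x => ival (f x) (g x) (r x) (h x) := by
  unfold ival; fun_prop

theorem ival_mono {e s s' i : ℕ} {ρ : List Bool} {a} (h : s ≤ s') (ha : ival e s ρ i = some a) : ival e s' ρ i = some a := by
  simp only [ival, Option.bind_eq_some_iff] at ha ⊢
  obtain ⟨v, h1, h2⟩ := ha
  exact ⟨v, Code.evaln_mono h h1, h2⟩

def dead (e n : ℕ) (ρ : List Bool) : Bool := (List.range n).any fun i => decide (ival e n ρ i = some none)

@[fun_prop] theorem fp_dead {α : Type} [Primcodable α] {f g : α → ℕ} {r : α → List Bool} (hf : Primrec f) (hg : Primrec g)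
    (hr : Primrec r) : Primrec fun x => dead (f x) (g x) (r x) := by
  unfold dead; fun_prop

theorem dead_iff {e n : ℕ} {ρ : List Bool} : dead e n ρ = true ↔ ∃ i < n, ival e n ρ i = some none := by
  simp [dead]

theorem dead_mono {e n n' : ℕ} {ρ : List Bool} (h : n ≤ n') (hd : dead e n ρ = true) : dead e n' ρ = true := by
  rw [dead_iff] at hd ⊢
  obtain ⟨i, h1, h2⟩ := hd
  exact ⟨i, by omega, ival_mono h h2⟩

/-- length of the shortest alive prefix -/
def sa (e : ℕ) (σ : List Bool) (n : ℕ) : ℕ := lf (σ.length + 1) fun j => !dead e n (σ.take j)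

@[fun_prop] theorem fp_sa {α : Type} [Primcodable α] {f g : α → ℕ} {r : α → List Bool} (hf : Primrec f) (hg : Primrec g)
    (hr : Primrec r) : Primrec fun x => sa (f x) (r x) (g x) := by
  unfold sa; fun_prop

theorem sa_alive {e n : ℕ} {σ : List Bool} (h : sa e σ n ≤ σ.length) : dead e n (σ.take (sa e σ n)) = false := by
  have := lf_true (show sa e σ n < σ.length + 1 by omega)
  change (!dead e n (σ.take (sa e σ n))) = true at this
  simpa using this

theorem sa_le {e n j : ℕ} {σ : List Bool} (h : dead e n (σ.take j) = false) : sa e σ n ≤ j :=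
  lf_le_of (by simp [h])

theorem sa_dead {e n j : ℕ} {σ : List Bool} (h : j < sa e σ n) : dead e n (σ.take j) = true := by
  have := lf_min h
  simpa using this

theorem sa_mono {e n n' : ℕ} {σ : List Bool} (h : n ≤ n') : sa e σ n ≤ sa e σ n' := by
  refine le_lf (fun j hj => ?_) (lf_le _ _)
  simp [dead_mono h (sa_dead hj)]
  
theorem sa_append {e n : ℕ} {σ τ : List Bool} (h : sa e σ n ≤ σ.length) : sa e (σ ++ τ) n = sa e σ n := by
  apply le_antisymm
  · apply sa_le
    rw [List.take_append_of_le_length h]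
    exact sa_alive h
  · refine le_lf (fun j hj => ?_) (by simp; omega)
    rw [List.take_append_of_le_length (by omega), sa_dead hj]
    rfl

def stp (e : ℕ) (σ : List Bool) (n : ℕ) (prev : List Bool) : List Bool :=
  if pfx prev (((ival e (n+1) (σ.take (sa e σ (n+1))) n.unpair.1).getD none).getD []) = true then
    ((ival e (n+1) (σ.take (sa e σ (n+1))) n.unpair.1).getD none).getD [] else prev

def outI (e : ℕ) (σ : List Bool) (n : ℕ) : List Bool := Nat.rec [] (fun n prev => stp e σ n prev) n

theorem outI_succ (e : ℕ) (σ : List Bool) (n : ℕ) : outI e σ (n+1) = stp e σ n (outI e σ n) := rfl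

@[fun_prop] theorem fp_outI {α : Type} [Primcodable α] {f g : α → ℕ} {r : α → List Bool} (hf : Primrec f) (hg : Primrec g)
    (hr : Primrec r) : Primrec fun x => outI (f x) (r x) (g x) := by
  have h1 : Primrec fun q : (ℕ × List Bool) × ℕ × List Bool => stp q.1.1 q.1.2 q.2.1 q.2.2 := by
    unfold stp; fun_prop
  have h2 : Primrec fun q : (ℕ × List Bool) × ℕ => outI q.1.1 q.1.2 q.2 := by
    unfold outI
    exact Primrec.nat_rec (f := fun _ : ℕ × List Bool => ([] : List Bool))
      (g := fun (a : ℕ × List Bool) (q : ℕ × List Bool) => stp a.1 a.2 q.1 q.2) (Primrec.const _) h1.to₂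
  exact h2.comp (g := fun x => ((f x, r x), g x)) (by fun_prop)

theorem outI_mono1 (e : ℕ) (σ : List Bool) (n : ℕ) : outI e σ n <+: outI e σ (n+1) := by
  rw [outI_succ, stp]
  split_ifs with h
  · exact pfx_iff.1 h
  · exact prefix_self _

theorem outI_mono (e : ℕ) (σ : List Bool) {n m : ℕ} (h : n ≤ m) : outI e σ n <+: outI e σ m := by
  induction m, h using Nat.le_induction with
  | base => exact prefix_self _
  | succ m _ ih => exact ih.trans (outI_mono1 e σ m)

theorem outI_append {e n : ℕ} {σ τ : List Bool} (h : sa e σ n ≤ σ.length) : outI e (σ ++ τ) n = outI e σ n := by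
  induction n with
  | zero => rfl
  | succ n ih =>
    rw [outI_succ, outI_succ, ih (le_trans (sa_mono (by omega)) h), stp, stp, sa_append h,
      List.take_append_of_le_length h]

def fI (e : ℕ) (σ : List Bool) (n : ℕ) : Option (List Bool) :=
  if sa e σ n ≤ σ.length then some (outI e σ n) else none

@[fun_prop] theorem fp_fI {α : Type} [Primcodable α] {f g : α → ℕ} {r : α → List Bool} (hf : Primrec f) (hg : Primrec g)
    (hr : Primrec r) : Primrec fun x => fI (f x) (r x) (g x) := by
  unfold fI; fun_prop

theorem fI_some {e n : ℕ} {σ a : List Bool} : fI e σ n = some a ↔ sa e σ n ≤ σ.length ∧ outI e σ n = a := by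
  rw [fI]
  split_ifs with h <;> simp [h]

def IMono (f : List Bool → ℕ → Option (List Bool)) : Prop :=
  ∀ σ m n a, n < m → f σ m = some a → ∃ b, f σ n = some b ∧ b <+: a
def ISd (f : List Bool → ℕ → Option (List Bool)) : Prop :=
  ∀ σ τ n a, f σ n = some a → f (σ ++ τ) n = some a

theorem fI_mono (e : ℕ) : IMono (fI e) := by
  intro σ m n a h ha
  rw [fI_some] at ha
  refine ⟨outI e σ n, fI_some.2 ⟨le_trans (sa_mono h.le) ha.1, rfl⟩, ?_⟩
  rw [← ha.2]
  exact outI_mono e σ h.le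

theorem fI_sd (e : ℕ) : ISd (fI e) := by
  intro σ τ n a ha
  rw [fI_some] at ha
  refine fI_some.2 ⟨?_, ?_⟩
  · rw [sa_append ha.1]; simp; omega
  · rw [outI_append ha.1, ha.2]

def mkI (f : List Bool → ℕ → Option (List Bool)) (hf : Primrec fun p : List Bool × ℕ => f p.1 p.2) (h1 : IMono f) (h2 : ISd f) :
    InfMachine := ⟨f, (Primrec.to_comp hf).to₂, h1, h2⟩

def Mi (e : ℕ) : InfMachine := mkI (fI e) (by fun_prop) (fI_mono e) (fI_sd e)

theorem Mi_all (V : InfMachine) : ∃ e, ∀ τ, InfAgree (Mi e) τ V τ := by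
  obtain ⟨c, hc⟩ := Code.exists_code.1 V.computable
  have hev : ∀ (ρ : List Bool) (i : ℕ), c.eval (Encodable.encode (ρ, i)) = Part.some (Encodable.encode (V.f ρ i)) := by
    intro ρ i
    rw [hc]
    simp
  set e := Encodable.encode c with he
  have hval : ∀ s ρ i a, ival e s ρ i = some a → a = V.f ρ i := by
    intro s ρ i a h1
    simp only [ival, he, Denumerable.ofNat_encode, Option.bind_eq_some_iff] at h1
    obtain ⟨v, h2, h3⟩ := h1
    have h4 := Code.evaln_sound h2
    rw [hev, Part.mem_some_iff] at h4
    rw [h4, Encodable.encodek] at h3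
    cases h3; rfl
  have hval' : ∀ ρ i, ∃ s0, ∀ s ≥ s0, ival e s ρ i = some (V.f ρ i) := by
    intro ρ i
    have h1 : Encodable.encode (V.f ρ i) ∈ c.eval (Encodable.encode (ρ, i)) := by
      rw [hev]; exact Part.mem_some _
    obtain ⟨s, hs⟩ := Code.evaln_complete.1 h1
    refine ⟨s, fun s' h => ival_mono h ?_⟩
    simp only [ival, he, Denumerable.ofNat_encode, Option.bind_eq_some_iff]
    exact ⟨_, hs, Encodable.encodek _⟩
  refine ⟨e, fun τ => ?_⟩
  have hf : ∀ n, (Mi e).f τ n = fI e τ n := fun n => rfl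
  have hdead : ∀ ρ, V.domInf ρ → ∀ n, dead e n ρ = false := by
    intro ρ hρ n
    by_contra hcc
    rw [Bool.not_eq_false, dead_iff] at hcc
    obtain ⟨i, _, h⟩ := hcc
    exact hρ i (hval _ _ _ _ h).symm
  have hdead' : ∀ ρ, ¬ V.domInf ρ → ∃ N, ∀ n ≥ N, dead e n ρ = true := by
    intro ρ hρ
    simp only [InfMachine.domInf] at hρ
    push Not at hρ
    obtain ⟨i, hi⟩ := hρ
    obtain ⟨s0, hs⟩ := hval' ρ i
    refine ⟨max s0 (i+1), fun n hn => dead_iff.2 ⟨i, by omega, ?_⟩⟩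
    rw [hs n (by omega), hi]
  have hpre : ∀ j n a, V.f (τ.take j) n = some a → V.f τ n = some a := by
    intro j n a h
    have := V.sd _ (τ.drop j) n a h
    rwa [List.take_append_drop] at this
  have hdom : (Mi e).domInf τ ↔ V.domInf τ := by
    constructor
    · intro h
      by_contra hcc
      have h1 : ∀ j, ¬ V.domInf (τ.take j) := by
        intro j hj
        apply hcc
        intro n hn
        obtain ⟨a, ha⟩ := Option.ne_none_iff_exists'.1 (hj n)
        rw [hpre j n a ha] at hn
        cases hn
      choose N hN using fun j => hdead' _ (h1 j)
      have h2 := h ((Finset.range (τ.length+1)).sup N)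
      apply h2
      rw [hf, fI, if_neg]
      intro h3
      have h4 := sa_alive h3
      rw [hN _ _ (Finset.le_sup (f := N) (Finset.mem_range.2 (by omega)))] at h4
      cases h4
    · intro h n
      rw [hf, fI, if_pos]
      · simp
      · apply sa_le
        rw [List.take_length]
        exact hdead τ h n
  refine ⟨hdom, fun hd k b => ?_⟩
  have hV := hdom.1 hd
  have hal : ∀ n, sa e τ n ≤ τ.length := fun n => sa_le (by rw [List.take_length]; exact hdead τ hV n)
  -- every candidate is a true approximation
  have hout : ∀ n, outI e τ n = [] ∨ ∃ i, V.f τ i = some (outI e τ n) := by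
    intro n
    induction n with
    | zero => exact Or.inl rfl
    | succ n ih =>
      rw [outI_succ, stp]
      split_ifs with hp
      · cases h1 : ival e (n+1) (τ.take (sa e τ (n+1))) n.unpair.1 with
        | none => left; rfl
        | some a =>
          have h2 := hval _ _ _ _ h1
          cases a with
          | none => left; rfl
          | some a => exact Or.inr ⟨_, hpre _ _ _ h2.symm⟩
      · exact ih
  constructor
  · rintro ⟨n, a, ha, hk⟩
    rw [hf, fI_some] at ha
    rcases hout n with h | ⟨i, hi⟩
    · rw [← ha.2, h] at hk
      simp at hk
    · exact ⟨i, _, hi, by rw [ha.2]; exact hk⟩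
  · rintro ⟨i, a, ha, hk⟩
    -- eventually the shortest alive prefix has total computation at `i`
    have hex : ∃ N, ∀ n ≥ N, ival e n (τ.take (sa e τ n)) i = some (some a) := by
      choose S hS using fun j => hval' (τ.take j) i
      refine ⟨max ((Finset.range (τ.length+1)).sup S) (i+1), fun n hn => ?_⟩
      have h1 := hS (sa e τ n) n (le_trans (Finset.le_sup (f := S) (Finset.mem_range.2 (by have := hal n; omega))) (le_trans (le_max_left _ _) hn))
      rw [h1]
      congr 1
      cases h2 : V.f (τ.take (sa e τ n)) i with
      | none =>
        have h3 := sa_alive (hal n)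
        rw [h2] at h1
        rw [dead_iff.2 ⟨i, by omega, h1⟩] at h3
        cases h3
      | some a' => rw [← ha]; exact (hpre _ _ _ h2).symm
    obtain ⟨N, hN⟩ := hex
    set n := Nat.pair i N with hn
    have h1 := hN (n+1) (by have := Nat.right_le_pair i N; omega)
    have h2 : outI e τ (n+1) = if pfx (outI e τ n) a = true then a else outI e τ n := by
      rw [outI_succ, stp, hn, Nat.unpair_pair, ← hn]
      simp only [h1, Option.getD_some]
    refine ⟨n+1, outI e τ (n+1), fI_some.2 ⟨hal _, rfl⟩, ?_⟩
    rw [h2]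
    split_ifs with hp
    · exact hk
    · rw [pfx_iff] at hp
      rcases hout n with h | ⟨i', hi'⟩
      · rw [h] at hp
        exact absurd ⟨_, List.nil_append _⟩ hp
      · have : a <+: outI e τ n := by
          rcases lt_trichotomy i i' with hl | hl | hl
          · obtain ⟨b', hb', hb''⟩ := V.mono τ i' i _ hl hi'
            rw [ha] at hb'; cases hb'; exact hb''
          · subst hl; rw [ha] at hi'; cases hi'; exact prefix_self _
          · obtain ⟨b', hb', hb''⟩ := V.mono τ i i' _ hl ha
            rw [hi'] at hb'; cases hb'; exact absurd hb'' hp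
        obtain ⟨ρ, hρ⟩ := this
        rw [← hρ]
        have hlt : k < a.length := by
          by_contra hcc
          rw [List.getElem?_eq_none (by omega)] at hk
          cases hk
        rw [List.getElem?_append_left hlt]
        exact hk

/-- the standard universal machine -/
def I0 (σ : List Bool) (n : ℕ) : Option (List Bool) :=
  if lead σ < σ.length then fI (lead σ) (σ.drop (lead σ + 1)) n else none

@[fun_prop] theorem fp_I0 {α : Type} [Primcodable α] {f : α → List Bool} {g : α → ℕ} (hf : Primrec f) (hg : Primrec g) :
    Primrec fun x => I0 (f x) (g x) := by unfold I0; fun_prop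

theorem I0_onesZ (e : ℕ) (τ : List Bool) : I0 (onesZ e ++ τ) = fI e τ := by
  funext s
  rw [I0, lead_onesZ, if_pos (by simp [length_onesZ]; omega), ← length_onesZ, List.drop_left]

theorem I0_form {σ a : List Bool} {n : ℕ} (h : I0 σ n = some a) : ∃ e τ, σ = onesZ e ++ τ := by
  have h1 : lead σ < σ.length := by
    by_contra hc
    rw [I0, if_neg hc] at h
    cases h
  exact ⟨_, lead_lt h1⟩

theorem I0_mono : IMono I0 := by
  intro σ m n a h ha
  obtain ⟨e, τ, rfl⟩ := I0_form ha
  rw [I0_onesZ] at ha ⊢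
  exact fI_mono e τ m n a h ha

theorem I0_sd : ISd I0 := by
  intro σ τ n a ha
  obtain ⟨e, ρ, rfl⟩ := I0_form ha
  rw [List.append_assoc, I0_onesZ]
  rw [I0_onesZ] at ha
  exact fI_sd e ρ τ n a ha

def zr (n : ℕ) : List Bool := List.replicate n false
theorem zr_mono {n m : ℕ} (h : n ≤ m) : zr n <+: zr m := by
  obtain ⟨k, rfl⟩ := Nat.exists_eq_add_of_le h
  rw [zr, zr, List.replicate_add]
  exact List.prefix_append _ _

/-- zero output machine from a decidable test -/
def tF (T : List Bool → ℕ → Bool) (σ : List Bool) (n : ℕ) : Option (List Bool) := if T σ n = true then some (zr n) else none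

theorem tF_some {T : List Bool → ℕ → Bool} {σ a : List Bool} {n : ℕ} : tF T σ n = some a ↔ T σ n = true ∧ zr n = a := by
  rw [tF]; split_ifs with h <;> simp [h]

theorem tF_mono {T : List Bool → ℕ → Bool} (hT : ∀ σ m n, n < m → T σ m = true → T σ n = true) : IMono (tF T) := by
  intro σ m n a h ha
  rw [tF_some] at ha
  exact ⟨zr n, tF_some.2 ⟨hT σ m n h ha.1, rfl⟩, ha.2 ▸ zr_mono h.le⟩

theorem tF_sd {T : List Bool → ℕ → Bool} (hT : ∀ σ τ n, T σ n = true → T (σ ++ τ) n = true) : ISd (tF T) := by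
  intro σ τ n a ha
  rw [tF_some] at ha
  exact tF_some.2 ⟨hT _ _ _ ha.1, ha.2⟩

def TB (σ : List Bool) (n : ℕ) : Bool := ((I0 σ n).map fun a => decide (a.length ≤ σ.length)).getD false

theorem TB_iff {σ : List Bool} {n : ℕ} : TB σ n = true ↔ ∃ a, I0 σ n = some a ∧ a.length ≤ σ.length := by
  unfold TB
  cases h : I0 σ n <;> simp

/-- combination of machines on the two halves -/
def cF (f g : List Bool → ℕ → Option (List Bool)) (σ : List Bool) (n : ℕ) : Option (List Bool) :=
  if σ.length = 0 then none else
  if σ[0]? = some false then f (σ.drop 1) n else g (σ.drop 1) n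

theorem cF_nil (f g n) : cF f g [] n = none := by simp [cF]
theorem cF_false (f g σ n) : cF f g (false :: σ) n = f σ n := by simp [cF]
theorem cF_true (f g σ n) : cF f g (true :: σ) n = g σ n := by simp [cF]

theorem cF_mono {f g} (hf : IMono f) (hg : IMono g) : IMono (cF f g) := by
  intro σ m n a h ha
  cases σ with
  | nil => rw [cF_nil] at ha; cases ha
  | cons b σ =>
    cases b with
    | false => rw [cF_false] at *; exact hf σ m n a h ha
    | true => rw [cF_true] at *; exact hg σ m n a h ha

theorem cF_sd {f g} (hf : ISd f) (hg : ISd g) : ISd (cF f g) := by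
  intro σ τ n a ha
  cases σ with
  | nil => rw [cF_nil] at ha; cases ha
  | cons b σ =>
    rw [List.cons_append]
    cases b with
    | false => rw [cF_false] at *; exact hf σ τ n a ha
    | true => rw [cF_true] at *; exact hg σ τ n a ha

def IDom (f : List Bool → ℕ → Option (List Bool)) : Set Cantor := {X | ∃ k, ∀ n, f (initSeg X k) n ≠ none}
def IInf (f : List Bool → ℕ → Option (List Bool)) : Set Cantor :=
  {X | ∃ k, (∀ n, f (initSeg X k) n ≠ none) ∧ ∀ l, ∃ n a, f (initSeg X k) n = some a ∧ l ≤ a.length}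

theorem IInf_meas (f) : MeasurableSet (IInf f) := by
  have : IInf f = ⋃ k, {X | decide ((∀ n, f (initSeg X k) n ≠ none) ∧ ∀ l, ∃ n a, f (initSeg X k) n = some a ∧ l ≤ a.length) = true} := by
    ext X; simp [IInf]
  rw [this]
  exact MeasurableSet.iUnion fun k => measurable_seg k fun σ => decide ((∀ n, f σ n ≠ none) ∧ ∀ l, ∃ n a, f σ n = some a ∧ l ≤ a.length)

theorem IInf_cF (f g) : muR (IInf (cF f g)) = 1/2 * muR (IInf f) + 1/2 * muR (IInf g) := by
  rw [muR_half (IInf_meas _)]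
  have hz : ∀ X : Cantor, initSeg X 0 = [] := fun X => rfl
  congr 3
  · ext X
    constructor
    · rintro ⟨k, h⟩
      cases k with
      | zero => exact absurd (cF_nil f g 0) (h.1 0)
      | succ k => simp only [initSeg_consC, cF_false] at h; exact ⟨k, h⟩
    · rintro ⟨k, h⟩
      refine ⟨k+1, ?_⟩
      simp only [initSeg_consC, cF_false]; exact h
  · ext X
    constructor
    · rintro ⟨k, h⟩
      cases k with
      | zero => exact absurd (cF_nil f g 0) (h.1 0)
      | succ k => simp only [initSeg_consC, cF_true] at h; exact ⟨k, h⟩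
    · rintro ⟨k, h⟩
      refine ⟨k+1, ?_⟩
      simp only [initSeg_consC, cF_true]; exact h

theorem IInf_tF (T : List Bool → ℕ → Bool) : IInf (tF T) = {X | ∃ k, ∀ n, T (initSeg X k) n = true} := by
  ext X
  constructor
  · rintro ⟨k, h, _⟩
    refine ⟨k, fun n => ?_⟩
    by_contra hc
    exact h n (by rw [tF, if_neg hc])
  · rintro ⟨k, h⟩
    refine ⟨k, fun n => by rw [tF, if_pos (h n)]; simp, fun l => ⟨l, zr l, tF_some.2 ⟨h l, rfl⟩, by simp [zr]⟩⟩

theorem IInf_B : muR (IInf I0) + muR (IInf (tF TB)) = muR (IDom I0) := by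
  have hd : Disjoint (IInf I0) (IInf (tF TB)) := by
    rw [Set.disjoint_left]
    rintro X ⟨k, h1, h2⟩ hB
    rw [IInf_tF] at hB
    obtain ⟨k', h3⟩ := hB
    obtain ⟨n, a, h4, h5⟩ := h2 (k'+1)
    obtain ⟨b, h6, h7⟩ := TB_iff.1 (h3 n)
    rw [length_initSeg] at h7
    have : a = b := by
      rcases le_total k k' with hl | hl
      · obtain ⟨ρ, hρ⟩ := initSeg_pfx X hl
        have := I0_sd _ ρ _ _ h4
        rw [hρ, h6] at this; cases this; rfl
      · obtain ⟨ρ, hρ⟩ := initSeg_pfx X hl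
        have := I0_sd _ ρ _ _ h6
        rw [hρ, h4] at this; cases this; rfl
    subst this
    omega
  have hu : IInf I0 ∪ IInf (tF TB) = IDom I0 := by
    ext X
    constructor
    · rintro (⟨k, h, _⟩ | hB)
      · exact ⟨k, h⟩
      · rw [IInf_tF] at hB
        obtain ⟨k, h⟩ := hB
        refine ⟨k, fun n => ?_⟩
        obtain ⟨a, ha, _⟩ := TB_iff.1 (h n)
        rw [ha]; simp
    · rintro ⟨k, h⟩
      by_cases hl : ∀ l, ∃ n a, I0 (initSeg X k) n = some a ∧ l ≤ a.length
      · exact Or.inl ⟨k, h, hl⟩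
      · right
        rw [IInf_tF]
        push Not at hl
        obtain ⟨l, hl⟩ := hl
        refine ⟨max k l, fun n => TB_iff.2 ?_⟩
        obtain ⟨a, ha⟩ := Option.ne_none_iff_exists'.1 (h n)
        obtain ⟨ρ, hρ⟩ := initSeg_pfx X (le_max_left k l)
        have := I0_sd _ ρ _ _ ha
        rw [hρ] at this
        refine ⟨a, this, ?_⟩
        have := hl n a ha
        simp; omega
  rw [← hu]
  exact (measureReal_union (μ := mu) hd (IInf_meas _)).symm

theorem Sg_IDom : Sg 1 (fun (_ : Unit) X => X ∈ IDom I0) := by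
  have h1 : Sg 0 (fun (p : (Unit × ℕ) × ℕ) X => (I0 (initSeg X p.1.2) p.2).isNone = true) :=
    Sg.primX (R := fun (p : (Unit × ℕ) × ℕ) σ => (I0 σ p.2).isNone) (f := fun p => p.1.2) (by fun_prop) (by fun_prop)
  refine h1.ex.not.ex.congr fun a X => ?_
  simp [IDom]

theorem infm_variance : ∃ U V : InfMachine, UniversalInf U ∧ UniversalInf V ∧
    TIncompReal (muR (cyl U.INF)) (muR (cyl V.INF)) := by
  have hρ : Sg 1 (fun (p : ℕ × ℕ) (_ : Cantor) => (p.1:ℝ)/2^p.2 < 1/2 * muR (IDom I0)) := by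
    refine (Sg_IDom.measure.subst (f := fun p : ℕ × ℕ => ((), (2 * p.1, p.2))) (by fun_prop)).congr fun p X => ?_
    have : ((2 * p.1 : ℕ) : ℝ) / 2^p.2 = 2 * ((p.1:ℝ)/2^p.2) := by push_cast; ring
    dsimp only
    simp only [Set.ofPred_mem_eq]
    rw [this]
    constructor <;> intro h <;> linarith
  obtain ⟨J, J', hJ, hJ', h⟩ := core le_rfl (by have := muR_nonneg (IDom I0); linarith) 
    (by have := muR_le_one (IDom I0); linarith) hρ
  have key : ∀ J : ℕ → Prop, Sg 1 (fun (i : ℕ) (_ : Cantor) => J i) → ∃ U, UniversalInf U ∧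
      muR (cyl U.INF) = 1/2 * (1/2 * muR (IDom I0)) + 1/2 * muR (DJ J) := by
    intro J hJ
    obtain ⟨R, hR, e⟩ := (Sg_EJ le_rfl hJ).matrix1
    have hR' : Primrec fun p : List Bool × ℕ × ℕ => R p.1 p.2.1 p.2.2 := hR
    let T : List Bool → ℕ → Bool := fun σ n => (List.range (σ.length + 1)).any fun w =>
      (List.range (n+1)).all fun l => !R (σ.take w.unpair.1) w.unpair.2 l
    have hTp : Primrec fun p : List Bool × ℕ => T p.1 p.2 := by dsimp only [T]; fun_prop
    have T_iff : ∀ σ n, T σ n = true ↔ ∃ w ≤ σ.length, ∀ l ≤ n, R (σ.take w.unpair.1) w.unpair.2 l = false := by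
      intro σ n; simp [T, Nat.lt_succ_iff]
    let f := cF (cF I0 (tF TB)) (tF T)
    have hf1 : IMono f := by
      refine cF_mono (cF_mono I0_mono (tF_mono ?_)) (tF_mono ?_)
      · intro σ m n h
        rw [TB_iff, TB_iff]
        rintro ⟨a, ha, hl⟩
        obtain ⟨b, hb, hb'⟩ := I0_mono σ m n a h ha
        exact ⟨b, hb, le_trans hb'.length_le hl⟩
      · intro σ m n h
        rw [T_iff, T_iff]
        rintro ⟨w, hw, hl⟩
        exact ⟨w, hw, fun l h' => hl l (by omega)⟩
    have hf2 : ISd f := by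
      refine cF_sd (cF_sd I0_sd (tF_sd ?_)) (tF_sd ?_)
      · intro σ τ n
        rw [TB_iff, TB_iff]
        rintro ⟨a, ha, hl⟩
        exact ⟨a, I0_sd _ _ _ _ ha, by simp; omega⟩
      · intro σ τ n
        rw [T_iff, T_iff]
        rintro ⟨w, hw, hl⟩
        refine ⟨w, by simp; omega, fun l h' => ?_⟩
        have := Nat.unpair_left_le w
        rw [List.take_append_of_le_length (by omega)]
        exact hl l h'
    have hfp : Primrec fun p : List Bool × ℕ => f p.1 p.2 := by
      have h1 : Primrec fun p : List Bool × ℕ => tF T p.1 p.2 := by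
        unfold tF zr; fun_prop
      have h2 : Primrec fun p : List Bool × ℕ => tF TB p.1 p.2 := by
        unfold tF zr TB; fun_prop
      have h3 : Primrec fun p : List Bool × ℕ => cF I0 (tF TB) p.1 p.2 := by
        unfold cF; fun_prop
      dsimp only [f]; unfold cF; unfold cF at h3; fun_prop
    refine ⟨mkI f hfp hf1 hf2, ⟨Mi, fun e => false :: false :: onesZ e, ?_, Mi_all, ?_, ?_, ?_⟩, ?_⟩
    · exact (show Primrec fun p : ℕ × List Bool × ℕ => fI p.1 p.2.1 p.2.2 by fun_prop).to_comp
    · exact (show Primrec _ by fun_prop).to_comp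
    · rintro _ ⟨c, rfl⟩ _ ⟨d, rfl⟩ h
      obtain ⟨ρ, h⟩ := h
      have h' : onesZ c ++ ρ = onesZ d ++ [] := by
        simpa using h
      simp [onesZ_inj h']
    · intro e τ
      have : ∀ n, (mkI f hfp hf1 hf2).f (false :: false :: onesZ e ++ τ) n = (Mi e).f τ n := by
        intro n
        show cF (cF I0 (tF TB)) (tF T) (false :: false :: onesZ e ++ τ) n = fI e τ n
        rw [List.cons_append, List.cons_append, cF_false, cF_false, I0_onesZ]
      refine ⟨?_, fun _ k b => ?_⟩
      · simp only [InfMachine.domInf, this]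
      · simp only [InfMachine.hasBit, this]
    · have e1 : cyl (mkI f hfp hf1 hf2).INF = IInf f := rfl
      rw [e1, IInf_cF, IInf_cF]
      have e2 : IInf (tF T) = DJ J := by
        rw [IInf_tF]
        ext Z
        rw [DJ_iff]
        constructor
        · rintro ⟨k, hk⟩
          by_contra hc
          push Not at hc
          have h1 : ∀ w : ℕ, ∃ l, R (initSeg Z w.unpair.1) w.unpair.2 l = true := by
            intro w
            by_contra hc'
            push Not at hc'
            exact hc _ ((e _).2 ⟨_, fun l => by simpa using hc' l⟩)
          choose l hl using h1
          obtain ⟨w, hw, h2⟩ := (T_iff _ _).1 (hk ((Finset.range (k+1)).sup l))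
          rw [length_initSeg] at hw
          have := h2 (l w) (Finset.le_sup (f := l) (Finset.mem_range.2 (by omega)))
          have := Nat.unpair_left_le w
          rw [initSeg_take Z (by omega), hl] at *
          simp at *
        · rintro ⟨j, hj⟩
          obtain ⟨y, hy⟩ := (e _).1 hj
          refine ⟨Nat.pair j y, fun n => (T_iff _ _).2 ⟨Nat.pair j y, by simp, fun l _ => ?_⟩⟩
          rw [Nat.unpair_pair, initSeg_take Z (Nat.left_le_pair j y)]
          exact hy l
      rw [e2]
      have := IInf_B
      linarith
  obtain ⟨U, hU, e⟩ := key J hJ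
  obtain ⟨V, hV, e'⟩ := key J' hJ'
  rw [← e, ← e'] at h
  exact ⟨U, V, hU, hV, h⟩

end RandProb

end

section
namespace RandProb

/-! ### A thick c.e. set construction, for the completeness probability -/

def lmem (L : List ℕ) (x : ℕ) : Bool := L.any fun y => decide (y = x)
def cs (L : List ℕ) (a : ℕ) : List Bool := (List.range a).map fun x => lmem L x

@[fun_prop] theorem fp_lmem {α : Type} [Primcodable α] {f : α → List ℕ} {g : α → ℕ} (hf : Primrec f) (hg : Primrec g) :
    Primrec fun x => lmem (f x) (g x) := by unfold lmem; fun_prop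
@[fun_prop] theorem fp_cs {α : Type} [Primcodable α] {f : α → List ℕ} {g : α → ℕ} (hf : Primrec f) (hg : Primrec g) :
    Primrec fun x => cs (f x) (g x) := by unfold cs; fun_prop

noncomputable def LL (j t : ℕ) (L : List ℕ) (a : ℕ) : ℕ :=
  lf t fun x => !decide (phi j (cs L a) x = some (cond (KB t x) 1 0))

@[fun_prop] theorem fp_LL {α : Type} [Primcodable α] {f : α → List ℕ} {j t g : α → ℕ} (hj : Primrec j) (ht : Primrec t)
    (hf : Primrec f) (hg : Primrec g) : Primrec fun x => LL (j x) (t x) (f x) (g x) := by unfold LL; fun_prop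

noncomputable def RR (j t : ℕ) (L : List ℕ) (a : ℕ) : ℕ :=
  lf a fun N => (List.range (LL j t L a + 1)).all fun x => !(phi j (cs L a) x).isSome || (phi j (cs L N) x).isSome

@[fun_prop] theorem fp_RR {α : Type} [Primcodable α] {f : α → List ℕ} {j t g : α → ℕ} (hj : Primrec j) (ht : Primrec t)
    (hf : Primrec f) (hg : Primrec g) : Primrec fun x => RR (j x) (t x) (f x) (g x) := by unfold RR; fun_prop

noncomputable def PPx (w : Bool) (t : ℕ) (L : List ℕ) (a x : ℕ) : Bool :=
  !lmem L x && (w && (List.range (x.unpair.1+1)).all fun j => decide (RR j t L a ≤ x))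

@[fun_prop] theorem fp_PPx {α : Type} [Primcodable α] {w : α → Bool} {f : α → List ℕ} {j t g : α → ℕ} (hw : Primrec w) (hj : Primrec j) (ht : Primrec t)
    (hf : Primrec f) (hg : Primrec g) : Primrec fun x => PPx (w x) (t x) (f x) (g x) (j x) := by unfold PPx; fun_prop

theorem PPx_iff {w : Bool} {t : ℕ} {L : List ℕ} {a x : ℕ} : PPx w t L a x = true ↔
    lmem L x = false ∧ w = true ∧ ∀ j ≤ x.unpair.1, RR j t L a ≤ x := by
  simp [PPx]

noncomputable def nxt (W : ℕ → ℕ → Bool) (t : ℕ) (s : List ℕ × ℕ) : ℕ := lf t fun x => PPx (W x t) t s.1 s.2 x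
noncomputable def stq (W : ℕ → ℕ → Bool) (t : ℕ) (s : List ℕ × ℕ) : List ℕ × ℕ :=
  if nxt W t s < t then (nxt W t s :: s.1, nxt W t s) else (s.1, t+1)
noncomputable def sts (W : ℕ → ℕ → Bool) (t : ℕ) : List ℕ × ℕ := Nat.rec ([], 0) (fun t s => stq W t s) t

theorem fp_sts {W : ℕ → ℕ → ℕ → Bool} (hW : Primrec fun p : ℕ × ℕ × ℕ => W p.1 p.2.1 p.2.2) :
    Primrec fun p : ℕ × ℕ => sts (W p.1) p.2 := by
  have h1 : Primrec fun q : ℕ × ℕ × (List ℕ × ℕ) => nxt (W q.1) q.2.1 q.2.2 := by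
    unfold nxt
    have h0 : Primrec fun p : (ℕ × ℕ × (List ℕ × ℕ)) × ℕ => W p.1.1 p.2 p.1.2.1 :=
      hW.comp (g := fun p : (ℕ × ℕ × (List ℕ × ℕ)) × ℕ => (p.1.1, p.2, p.1.2.1)) (by fun_prop)
    refine fp_lf (by fun_prop) ?_
    exact fp_PPx h0 (by fun_prop) (by fun_prop) (by fun_prop) (by fun_prop)
  have h2 : Primrec fun q : ℕ × ℕ × (List ℕ × ℕ) => stq (W q.1) q.2.1 q.2.2 := by
    unfold stq
    exact fp_ite (fp_lt h1 (by fun_prop)) (fp_mk (fp_cons h1 (by fun_prop)) h1) (by fun_prop)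
  unfold sts
  exact Primrec.nat_rec (f := fun _ : ℕ => (([], 0) : List ℕ × ℕ))
      (g := fun (a : ℕ) (q : ℕ × List ℕ × ℕ) => stq (W a) q.1 q.2) (Primrec.const _) h2.to₂

theorem fp_sts1 {W : ℕ → ℕ → Bool} (hW : Primrec fun p : ℕ × ℕ => W p.1 p.2) : Primrec fun t => sts W t :=
  (fp_sts (W := fun _ => W) (hW.comp Primrec.snd)).comp (g := fun t : ℕ => (0, t)) (by fun_prop)

section
variable {W : ℕ → ℕ → Bool}

def InA (W : ℕ → ℕ → Bool) (t x : ℕ) : Prop := lmem (sts W t).1 x = true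

theorem sts_succ (t : ℕ) : sts W (t+1) = stq W t (sts W t) := rfl

theorem sts_lt {t : ℕ} (h : nxt W t (sts W t) < t) : sts W (t+1) = (nxt W t (sts W t) :: (sts W t).1, nxt W t (sts W t)) := by
  rw [sts_succ, stq, if_pos h]
theorem sts_ge {t : ℕ} (h : ¬ nxt W t (sts W t) < t) : sts W (t+1) = ((sts W t).1, t+1) := by
  rw [sts_succ, stq, if_neg h]

theorem nxt_PPx {t : ℕ} {s : List ℕ × ℕ} (h : nxt W t s < t) :
    lmem s.1 (nxt W t s) = false ∧ W (nxt W t s) t = true ∧ ∀ j ≤ (nxt W t s).unpair.1, RR j t s.1 s.2 ≤ nxt W t s := by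
  have h1 : PPx (W (nxt W t s) t) t s.1 s.2 (nxt W t s) = true := lf_true (p := fun x => PPx (W x t) t s.1 s.2 x) h
  exact PPx_iff.1 h1

theorem InA_mono1 {t x : ℕ} (h : InA W t x) : InA W (t+1) x := by
  unfold InA at *
  by_cases h1 : nxt W t (sts W t) < t
  · rw [sts_lt h1]
    simp only [lmem, List.any_cons, Bool.or_eq_true] at h ⊢
    exact Or.inr h
  · rw [sts_ge h1]; exact h

theorem InA_mono {t t' x : ℕ} (ht : t ≤ t') (h : InA W t x) : InA W t' x := by
  induction t', ht using Nat.le_induction with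
  | base => exact h
  | succ m _ ih => exact InA_mono1 ih

theorem InA_new {t x : ℕ} (h : InA W (t+1) x) (h' : ¬ InA W t x) :
    x = (sts W (t+1)).2 ∧ x < t ∧ W x t = true ∧ ∀ j ≤ x.unpair.1, RR j t (sts W t).1 (sts W t).2 ≤ x := by
  unfold InA at *
  by_cases h1 : nxt W t (sts W t) < t
  · have h2 := nxt_PPx h1
    rw [sts_lt h1] at h ⊢
    simp only [lmem, List.any_cons, Bool.or_eq_true, decide_eq_true_eq] at h
    rcases h with h | h
    · subst h
      exact ⟨rfl, h1, h2.2⟩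
    · exact absurd h h'
  · rw [sts_ge h1] at h
    exact absurd h h'

theorem sts_enum {t : ℕ} (h : (sts W (t+1)).2 ≠ t+1) : ¬ InA W t (sts W (t+1)).2 ∧ InA W (t+1) (sts W (t+1)).2 := by
  unfold InA
  by_cases h1 : nxt W t (sts W t) < t
  · have h2 := nxt_PPx h1
    rw [sts_lt h1]
    refine ⟨by simpa using h2.1, by simp [lmem]⟩
  · rw [sts_ge h1] at h
    exact absurd rfl h

theorem sts_le (t : ℕ) : (sts W t).2 ≤ t := by
  cases t with
  | zero => exact le_rfl
  | succ t =>
    by_cases h1 : nxt W t (sts W t) < t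
    · rw [sts_lt h1]; dsimp only; omega
    · rw [sts_ge h1]

theorem sts_nrec : ¬ Rec fun t => (sts W t).2 := by
  rintro ⟨v, hv⟩
  obtain ⟨t1, h1, e1⟩ := hv (v+2)
  obtain ⟨t2, h2, e2⟩ := hv (t1+1)
  obtain ⟨s1, rfl⟩ : ∃ s, t1 = s + 1 := ⟨t1 - 1, by omega⟩
  obtain ⟨s2, rfl⟩ : ∃ s, t2 = s + 1 := ⟨t2 - 1, by omega⟩
  dsimp only at e1 e2
  have := (sts_enum (W := W) (t := s1) (by omega)).2
  have h3 := (sts_enum (W := W) (t := s2) (by omega)).1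
  rw [e1] at this
  rw [e2] at h3
  exact h3 (InA_mono (by omega) this)

def Tru (W : ℕ → ℕ → Bool) (t : ℕ) : Prop := ∀ t' > t, (sts W t).2 < (sts W t').2

theorem exists_Tru (N x : ℕ) : ∃ t ≥ N, x < (sts W t).2 ∧ Tru W t := exists_last sts_nrec N x

theorem Tru_M {t t' x : ℕ} (h : Tru W t) (hx : x < (sts W t).2) (hM : InA W t' x) : InA W t x := by
  rcases le_total t' t with ht | ht
  · exact InA_mono ht hM
  · induction t', ht using Nat.le_induction with
    | base => exact hM
    | succ m hm ih =>
      refine ih ?_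
      by_contra hc
      have := (InA_new hM hc).1
      have := h (m+1) (by omega)
      omega

noncomputable def XA (W : ℕ → ℕ → Bool) : Cantor := fun x => decide (∃ t, InA W t x)

theorem XA_iff {x : ℕ} : XA W x = true ↔ ∃ t, InA W t x := by simp [XA]

theorem cs_eq {L : List ℕ} {X : Cantor} {N : ℕ} (h : ∀ x < N, (lmem L x = true ↔ X x = true)) : cs L N = initSeg X N := by
  unfold cs initSeg
  refine List.map_congr_left fun x hx => ?_
  rw [List.mem_range] at hx
  exact Bool.eq_iff_iff.2 (h x hx)

theorem cs_congr {L L' : List ℕ} {N : ℕ} (h : ∀ x < N, (lmem L x = true ↔ lmem L' x = true)) : cs L N = cs L' N := by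
  unfold cs
  refine List.map_congr_left fun x hx => ?_
  rw [List.mem_range] at hx
  exact Bool.eq_iff_iff.2 (h x hx)

theorem cs_take {L : List ℕ} {N N' : ℕ} (h : N ≤ N') : cs L N <+: cs L N' := by
  have e : ∀ M, cs L M = initSeg (lmem L) M := fun M => rfl
  rw [e, e]
  exact initSeg_pfx _ h

theorem cs_Tru {t N : ℕ} (h : Tru W t) (hN : N ≤ (sts W t).2) : cs (sts W t).1 N = initSeg (XA W) N := by
  refine cs_eq fun x hx => ?_
  rw [XA_iff]
  exact ⟨fun h => ⟨t, h⟩, fun ⟨t', h'⟩ => Tru_M h (by omega) h'⟩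

theorem KB_settle (x : ℕ) : ∃ T, ∀ t ≥ T, (cond (KB t x) 1 0 : ℕ) = chi HaltingSet x := by
  by_cases h : x ∈ HaltingSet
  · obtain ⟨T, hT⟩ := mem_K.1 h
    exact ⟨T, fun t ht => by simp [KB_mono ht hT, chi, h]⟩
  · have h' := h
    rw [mem_K] at h
    push Not at h
    exact ⟨0, fun t _ => by simp [h, chi, h']⟩

def Bdd (W : ℕ → ℕ → Bool) (j : ℕ) : Prop := ∃ B T, ∀ t ≥ T, Tru W t → RR j t (sts W t).1 (sts W t).2 ≤ B

theorem thick2 {j n : ℕ} (hn : ¬ ∃ k, phi j (initSeg (XA W) k) n = some (chi HaltingSet n)) : Bdd W j := by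
  have h1 : ∀ x, ∃ u, (∃ k, (phi j (initSeg (XA W) k) x).isSome) → ∀ u' ≥ u, (phi j (initSeg (XA W) u') x).isSome := by
    intro x
    by_cases h : ∃ k, (phi j (initSeg (XA W) k) x).isSome
    · obtain ⟨k, hk⟩ := h
      obtain ⟨v, hv⟩ := Option.isSome_iff_exists.1 hk
      refine ⟨k, fun _ u' hu => ?_⟩
      rw [phi_mono (initSeg_pfx _ hu) hv]; rfl
    · exact ⟨0, fun h' => absurd h' h⟩
  choose u hu using h1
  set U := (Finset.range (n+1)).sup u with hU
  obtain ⟨T0, hT0⟩ := KB_settle n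
  obtain ⟨T1, hT1⟩ := not_rec (sts_nrec (W := W)) U
  refine ⟨U, max (max T0 T1) (n+1), fun t ht hTt => ?_⟩
  have hUa := hT1 t (by omega)
  have hL : LL j t (sts W t).1 (sts W t).2 ≤ n := by
    refine lf_le_of ?_
    rw [hT0 t (by omega), cs_Tru hTt le_rfl]
    simp only [Bool.not_eq_true', decide_eq_false_iff_not]
    exact fun h => hn ⟨_, h⟩
  refine lf_le_of ?_
  simp only [List.all_eq_true, List.mem_range, Bool.or_eq_true, Bool.not_eq_true']
  intro x hx
  rw [cs_Tru hTt le_rfl, cs_Tru hTt hUa.le]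
  by_cases hs : (phi j (initSeg (XA W) (sts W t).2) x).isSome
  · refine Or.inr (hu x ⟨_, hs⟩ U ?_)
    exact Finset.le_sup (f := u) (Finset.mem_range.2 (show x < n + 1 by omega))
  · left; simpa using hs

noncomputable def srch (j : ℕ) (E : List ℕ) (p t : ℕ) (L : List ℕ) (a : ℕ) : Bool :=
  decide (p < LL j t L a) &&
    ((List.range a).all fun y => decide (j ≤ y.unpair.1) || ((E.any fun z => decide (z = y)) || lmem L y))

theorem srch_iff {j : ℕ} {E : List ℕ} {p t : ℕ} {L : List ℕ} {a : ℕ} : srch j E p t L a = true ↔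
    p < LL j t L a ∧ ∀ y < a, j ≤ y.unpair.1 ∨ y ∈ E ∨ lmem L y = true := by
  simp [srch]

theorem fp_srch (j : ℕ) (E : List ℕ) : Primrec fun p : ℕ × (ℕ × List ℕ × ℕ) => srch j E p.1 p.2.1 p.2.2.1 p.2.2.2 := by
  have h1 : Primrec fun p : ℕ × (ℕ × List ℕ × ℕ) => decide (p.1 < LL j p.2.1 p.2.2.1 p.2.2.2) :=
    fp_lt Primrec.fst (by fun_prop)
  have h2 : Primrec fun q : (List ℕ × ℕ) × ℕ => decide (j ≤ q.2.unpair.1) || ((E.any fun z => decide (z = q.2)) || lmem q.1.1 q.2) := by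
    have h3 : Primrec fun y : ℕ => decide (j ≤ y.unpair.1) := by fun_prop
    have h4 : Primrec fun y : ℕ => E.any fun z => decide (z = y) := by fun_prop
    have h5 : Primrec fun q : (List ℕ × ℕ) × ℕ => q.2 := by fun_prop
    have h6 : Primrec fun q : (List ℕ × ℕ) × ℕ => lmem q.1.1 q.2 := by fun_prop
    exact fp_bor (h3.comp h5) (fp_bor (h4.comp h5) h6)
  have h3 : Primrec fun q : List ℕ × ℕ => (List.range q.2).all fun y =>
      decide (j ≤ y.unpair.1) || ((E.any fun z => decide (z = y)) || lmem q.1 y) :=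
    fp_all (by fun_prop) h2
  exact fp_band h1 (h3.comp (g := fun p : ℕ × (ℕ × List ℕ × ℕ) => p.2.2) (by fun_prop))

theorem thick1 (hW : Primrec fun p : ℕ × ℕ => W p.1 p.2) {j : ℕ} {E : List ℕ}
    (hE : ∀ y : ℕ, y.unpair.1 < j → (y ∉ E ↔ ∃ t, InA W t y)) :
    ∃ n, ¬ ∃ k, phi j (initSeg (XA W) k) n = some (chi HaltingSet n) := by
  by_contra hcon
  push Not at hcon
  have hst := fp_sts1 hW
  refine K_search (P := fun p t => srch j E p t (sts W t).1 (sts W t).2 = true) ?_ ?_ ?_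
  · refine ⟨inferInstance, ?_⟩
    have h2 := (fp_srch j E).comp (g := fun p : ℕ × ℕ => (p.1, p.2, sts W p.2))
      (Primrec.fst.pair (Primrec.snd.pair (hst.comp Primrec.snd)))
    refine h2.to_comp.of_eq fun p => ?_
    exact (Bool.decide_eq_true (b := _)).symm
  · intro p
    choose k hk using hcon
    choose T hT using KB_settle
    set U := (Finset.range (p+1)).sup k
    set V := (Finset.range (p+1)).sup T
    obtain ⟨t, ht, hx, htr⟩ := exists_Tru (W := W) (max (V) (p+1)) U
    refine ⟨t, ?_⟩
    rw [srch_iff]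
    constructor
    · refine le_lf (fun x hxp => ?_) (by omega)
      rw [cs_Tru htr le_rfl]
      have h1 := Finset.le_sup (f := k) (Finset.mem_range.2 hxp)
      have h2 := Finset.le_sup (f := T) (Finset.mem_range.2 hxp)
      rw [hT x t (le_trans h2 (le_trans (le_max_left _ _) ht)), phi_mono (initSeg_pfx _ (le_trans h1 hx.le)) (hk x)]
      simp
    · intro y hy
      by_cases h1 : j ≤ y.unpair.1
      · exact Or.inl h1
      · right
        by_cases h2 : y ∈ E
        · exact Or.inl h2
        · right
          obtain ⟨t', ht'⟩ := (hE y (by omega)).1 h2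
          exact Tru_M htr hy ht'
  · intro p t hP hp
    rw [srch_iff] at hP
    obtain ⟨hL, hy⟩ := hP
    by_contra hKp
    have hex : ∃ y, y ≤ p ∧ y ∈ HaltingSet ∧ ¬ KB t y = true := ⟨p, le_rfl, hp, hKp⟩
    obtain ⟨hy0p, hy0K, hy0t⟩ := Nat.find_spec hex
    have hy0m : ∀ x < Nat.find hex, x ∈ HaltingSet → KB t x = true := by
      intro x hx hxK
      by_contra hc
      exact Nat.find_min hex hx ⟨by omega, hxK, hc⟩
    set y0 := Nat.find hex
    have hag : ∀ x ≤ y0, phi j (cs (sts W t).1 (sts W t).2) x = some (cond (KB t x) 1 0) := by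
      intro x hx
      have := lf_min (show x < LL j t (sts W t).1 (sts W t).2 by omega)
      simpa using this
    have hN : ∃ N, ∀ x ≤ y0, (phi j (cs (sts W t).1 N) x).isSome := ⟨_, fun x hx => by rw [hag x hx]; rfl⟩
    have hN0 := Nat.find_spec hN
    have hNmin : ∀ N, (∀ x ≤ y0, (phi j (cs (sts W t).1 N) x).isSome) → Nat.find hN ≤ N := fun N h => Nat.find_le h
    set N0 := Nat.find hN
    have hNa : N0 ≤ (sts W t).2 := hNmin _ fun x hx => by rw [hag x hx]; rfl
    have hval : ∀ x ≤ y0, phi j (cs (sts W t).1 N0) x = some (cond (KB t x) 1 0) := by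
      intro x hx
      obtain ⟨v, hv⟩ := Option.isSome_iff_exists.1 (hN0 x hx)
      have := phi_mono (cs_take hNa) hv
      rw [hag x hx] at this
      rw [hv, this]
    have hat := sts_le (W := W) t
    have hLt : LL j t (sts W t).1 (sts W t).2 ≤ t := lf_le _ _
    have key : ∀ t' ≥ t, (∀ x < N0, InA W t' x → InA W t x) ∧ N0 ≤ (sts W t').2 := by
      intro t' ht'
      induction t', ht' using Nat.le_induction with
      | base => exact ⟨fun x _ h => h, hNa⟩
      | succ m hm ih =>
        obtain ⟨ih1, ih2⟩ := ih
        have hcs : ∀ N ≤ N0, cs (sts W m).1 N = cs (sts W t).1 N := fun N hN => cs_congr fun x hx =>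
          ⟨fun h => ih1 x (by omega) h, fun h => InA_mono hm h⟩
        have hval' : ∀ x ≤ y0, phi j (cs (sts W m).1 (sts W m).2) x = some (cond (KB t x) 1 0) := by
          intro x hx
          refine phi_mono (cs_take ih2) ?_
          rw [hcs N0 le_rfl]; exact hval x hx
        have hLm : y0 ≤ LL j m (sts W m).1 (sts W m).2 := by
          refine le_lf (fun x hx => ?_) (by omega)
          rw [hval' x hx.le]
          have : KB t x = KB m x := by
            refine Bool.eq_iff_iff.2 ⟨fun h => KB_mono hm h, fun h => hy0m x hx (mem_K.2 ⟨_, h⟩)⟩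
          simp [this]
        have hR : N0 ≤ RR j m (sts W m).1 (sts W m).2 := by
          by_contra hc
          push Not at hc
          have h1 := lf_true (lt_of_lt_of_le hc ih2)
          change ((List.range (LL j m (sts W m).1 (sts W m).2 + 1)).all fun x => !(phi j (cs (sts W m).1 (sts W m).2) x).isSome ||
            (phi j (cs (sts W m).1 (RR j m (sts W m).1 (sts W m).2)) x).isSome) = true at h1
          simp only [List.all_eq_true, List.mem_range, Bool.or_eq_true, Bool.not_eq_true'] at h1
          have := hNmin (RR j m (sts W m).1 (sts W m).2) fun x hx => by
            rw [← hcs _ hc.le]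
            have h2 := h1 x (by omega)
            rw [hval' x hx] at h2
            simpa using h2
          omega
        have hnew : ∀ x, InA W (m+1) x → ¬ InA W m x → N0 ≤ x := by
          intro x h1 h2
          by_contra hc
          push Not at hc
          obtain ⟨-, -, -, h3⟩ := InA_new h1 h2
          by_cases h4 : j ≤ x.unpair.1
          · have := h3 j h4
            omega
          · have h5 := hy x (by omega)
            have h6 := (hE x (by omega)).2 ⟨_, h1⟩
            rcases h5 with h5 | hz | h5
            · exact h4 h5
            · exact h6 hz
            · exact h2 (InA_mono hm h5)
        refine ⟨fun x hx hM => ?_, ?_⟩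
        · refine ih1 x hx ?_
          by_contra hc
          have := hnew x hM hc
          omega
        · by_cases h1 : (sts W (m+1)).2 = m + 1
          · omega
          · exact hnew _ (sts_enum h1).2 (sts_enum h1).1
    have hfin : cs (sts W t).1 N0 = initSeg (XA W) N0 := cs_eq fun x hx => by
      rw [XA_iff]
      refine ⟨fun h => ⟨t, h⟩, fun ⟨t', h⟩ => ?_⟩
      exact (key (max t t') (le_max_left _ _)).1 x hx (InA_mono (le_max_right _ _) h)
    obtain ⟨k, hk⟩ := hcon y0
    have h1 := hval y0 le_rfl
    rw [hfin] at h1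
    have h2 := phi_mono (initSeg_pfx (XA W) (le_max_left N0 k)) h1
    have h3 := phi_mono (initSeg_pfx (XA W) (le_max_right N0 k)) hk
    rw [h2] at h3
    simp [hy0t, chi, hy0K] at h3

theorem thick3 (hm : ∀ x t t', t ≤ t' → W x t = true → W x t' = true) {e : ℕ} (h : ∀ j ≤ e, Bdd W j) :
    ∃ B, ∀ x ≥ B, x.unpair.1 = e → (∃ t, W x t = true) → ∃ t, InA W t x := by
  have h1 : ∀ j, ∃ B T, j ≤ e → ∀ t ≥ T, Tru W t → RR j t (sts W t).1 (sts W t).2 ≤ B := by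
    intro j
    by_cases hj : j ≤ e
    · obtain ⟨B, T, hB⟩ := h j hj
      exact ⟨B, T, fun _ => hB⟩
    · exact ⟨0, 0, fun h => absurd h hj⟩
  choose B T hB using h1
  refine ⟨(Finset.range (e+1)).sup B, fun x hx hxe ⟨t0, ht0⟩ => ?_⟩
  by_contra hc
  push Not at hc
  obtain ⟨N, hN⟩ := not_rec (sts_nrec (W := W)) x
  obtain ⟨t, ht, -, htr⟩ := exists_Tru (W := W) (max (max N t0) (max (x+1) ((Finset.range (e+1)).sup T))) 0
  have h2 : nxt W t (sts W t) ≤ x := by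
    refine lf_le_of (PPx_iff.2 ⟨by simpa [InA] using hc t, hm x t0 t (by omega) ht0, fun j hj => ?_⟩)
    rw [hxe] at hj
    have h3 := Finset.le_sup (f := B) (Finset.mem_range.2 (show j < e + 1 by omega))
    have h4 := Finset.le_sup (f := T) (Finset.mem_range.2 (show j < e + 1 by omega))
    exact le_trans (hB j hj t (le_trans h4 (by omega)) htr) (le_trans h3 hx)
  have h3 := hN (t+1) (by omega)
  rw [sts_lt (by omega)] at h3
  dsimp only at h3
  omega
end

end RandProb

end

section
namespace RandProb

def wantB (h : ℕ → ℕ → ℕ) (x t : ℕ) : Bool := (List.range (t+1)).any fun t' => decide (x.unpair.2 < t') &&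
  decide (h x.unpair.1 t' ≤ h x.unpair.1 x.unpair.2)

theorem wantB_iff {h : ℕ → ℕ → ℕ} {x : ℕ} : (∃ t, wantB h x t = true) ↔
    ∃ t > x.unpair.2, h x.unpair.1 t ≤ h x.unpair.1 x.unpair.2 := by
  simp only [wantB, List.any_eq_true, List.mem_range, Bool.and_eq_true, decide_eq_true_eq]
  constructor
  · rintro ⟨t, t', _, h1, h2⟩; exact ⟨t', h1, h2⟩
  · rintro ⟨t', h1, h2⟩; exact ⟨t', t', by omega, h1, h2⟩

theorem wantB_mono {h : ℕ → ℕ → ℕ} (x t t' : ℕ) (ht : t ≤ t') (hw : wantB h x t = true) : wantB h x t' = true := by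
  simp only [wantB, List.any_eq_true, List.mem_range, Bool.and_eq_true, decide_eq_true_eq] at hw ⊢
  obtain ⟨s, h1, h2⟩ := hw
  exact ⟨s, by omega, h2⟩

theorem InA_want {W : ℕ → ℕ → Bool} {t x : ℕ} (h : InA W t x) : ∃ s, W x s = true := by
  induction t with
  | zero => simp [InA, sts, lmem] at h
  | succ t ih =>
    by_cases hc : InA W t x
    · exact ih hc
    · exact ⟨t, (InA_new h hc).2.2.1⟩

theorem chi_eq (A : Set ℕ) : chi A = oX (fun n => decide (n ∈ A)) := by
  funext n
  by_cases h : n ∈ A <;> simp [chi, oX, h]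

section
variable {h : ℕ → ℕ → ℕ}

/-- the non-wanting elements of a recurrent column are finitely many -/
theorem want_fin {e : ℕ} (hr : Rec (h e)) : {x : ℕ | x.unpair.1 = e ∧ ¬ ∃ t, wantB h x t = true}.Finite := by
  obtain ⟨v, hv⟩ := hr
  have hb : ∀ x : ℕ, x.unpair.1 = e → (¬ ∃ t, wantB h x t = true) → ∀ t > x.unpair.2, h e x.unpair.2 < h e t := by
    intro x hx hn t ht
    rw [wantB_iff, hx] at hn
    push Not at hn
    exact hn t ht
  refine Set.Finite.of_finite_image (f := fun x => h e x.unpair.2) ?_ ?_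
  · refine (Set.finite_lt_nat v).subset ?_
    rintro _ ⟨x, ⟨hx, hn⟩, rfl⟩
    obtain ⟨t, ht, e1⟩ := hv (x.unpair.2 + 1)
    have := hb x hx hn t (by omega)
    dsimp only [Set.mem_ofPred_eq]
    omega
  · rintro x ⟨hx, hn⟩ y ⟨hy, hn'⟩ e1
    dsimp only at e1
    have : x.unpair.2 = y.unpair.2 := by
      rcases lt_trichotomy x.unpair.2 y.unpair.2 with hl | hl | hl
      · have := hb x hx hn _ hl; omega
      · exact hl
      · have := hb y hy hn' _ hl; omega
    rw [← Nat.pair_unpair x, ← Nat.pair_unpair y, hx, hy, this]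

theorem thick_ind (hh : Primrec fun p : ℕ × ℕ => h p.1 p.2) (j : ℕ) (hr : ∀ e < j, Rec (h e)) :
    {y : ℕ | y.unpair.1 < j ∧ ¬ ∃ t, InA (wantB h) t y}.Finite ∧ ∀ i ≤ j,
      (∃ n, ¬ ∃ k, phi i (initSeg (XA (wantB h)) k) n = some (chi HaltingSet n)) := by
  have hW : Primrec fun p : ℕ × ℕ => wantB h p.1 p.2 := by unfold wantB; fun_prop
  have h1 : ∀ j, {y : ℕ | y.unpair.1 < j ∧ ¬ ∃ t, InA (wantB h) t y}.Finite → 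
      (∃ n, ¬ ∃ k, phi j (initSeg (XA (wantB h)) k) n = some (chi HaltingSet n)) := by
    intro j hf
    refine thick1 hW (E := hf.toFinset.toList) fun y hy => ?_
    simp only [Finset.mem_toList, Set.Finite.mem_toFinset, Set.mem_ofPred_eq]
    tauto
  induction j with
  | zero =>
    have : {y : ℕ | y.unpair.1 < 0 ∧ ¬ ∃ t, InA (wantB h) t y}.Finite := by simp
    refine ⟨this, fun i hi => ?_⟩
    obtain rfl : i = 0 := by omega
    exact h1 _ this
  | succ j ih =>
    obtain ⟨h2, h3⟩ := ih fun e he => hr e (by omega)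
    obtain ⟨B, hB⟩ := thick3 (wantB_mono (h := h)) (e := j) fun i hi => by
      obtain ⟨n, hn⟩ := h3 i hi
      exact thick2 hn
    have h4 : {y : ℕ | y.unpair.1 < j+1 ∧ ¬ ∃ t, InA (wantB h) t y}.Finite := by
      refine ((h2.union (want_fin (hr j (by omega)))).union (Set.finite_lt_nat B)).subset ?_
      rintro y ⟨hy, hn⟩
      by_cases h5 : y.unpair.1 < j
      · exact Or.inl (Or.inl ⟨h5, hn⟩)
      · by_cases h6 : y < B
        · exact Or.inr h6
        · refine Or.inl (Or.inr ⟨by omega, fun hw => hn (hB y (by omega) (by omega) hw)⟩)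
    refine ⟨h4, fun i hi => ?_⟩
    rcases Nat.lt_or_ge i (j+1) with hl | hl
    · exact h3 i (by omega)
    · obtain rfl : i = j + 1 := by omega
      exact h1 _ h4

theorem thick_main (hh : Primrec fun p : ℕ × ℕ => h p.1 p.2) (hk : ∀ e t, h e t ≤ kap t) :
    TuringLEf (chi HaltingSet) (oX (XA (wantB h))) ↔ ∃ e, ¬ Rec (h e) := by
  constructor
  · rintro ⟨c, hc⟩
    by_contra hcon
    push Not at hcon
    obtain ⟨n, hn⟩ := (thick_ind hh c.encode fun e _ => hcon e).2 _ le_rfl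
    obtain ⟨k, hk'⟩ := (turing_phi hc n).2
    exact hn ⟨k, hk' k le_rfl⟩
  · intro hex
    have h1 := Nat.find_spec hex
    have h2 : ∀ e' < Nat.find hex, Rec (h e') := fun e' he => by
      by_contra hc
      exact Nat.find_min hex he hc
    set e := Nat.find hex
    obtain ⟨B, hB⟩ := thick3 (wantB_mono (h := h)) (e := e) fun i hi => by
      obtain ⟨n, hn⟩ := (thick_ind hh e h2).2 i hi
      exact thick2 hn
    let F : List Bool → ℕ → Option ℕ := fun σ x => ((List.range σ.length).find? fun s => decide (B ≤ s) &&
      (decide (σ[Nat.pair e s]? = some false) && decide (x < h e s))).map fun s => cond (KB (s+1) x) 1 0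
    have hF : Primrec fun p : List Bool × ℕ => F p.1 p.2 := by
      dsimp only [F]; fun_prop
    refine turing_of_approx hF ?_ ?_
    · intro x
      obtain ⟨s, hs, hx, hl⟩ := exists_last h1 B x
      have hp := Nat.right_le_pair e s
      refine ⟨Nat.pair e s + 1, ?_⟩
      simp only [F, Option.isSome_map, List.find?_isSome, List.mem_range, length_initSeg, Bool.and_eq_true, decide_eq_true_eq]
      refine ⟨s, by omega, hs, ?_, hx⟩
      rw [initSeg_get _ _ _ (by omega)]
      simp only [Option.some.injEq, XA, decide_eq_false_iff_not]
      rintro ⟨t, ht⟩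
      obtain ⟨t', ht', h3⟩ := wantB_iff.1 (InA_want ht)
      rw [Nat.unpair_pair] at ht' h3
      dsimp only at ht' h3
      have := hl t' ht'
      omega
    · intro x k v hv
      simp only [F, Option.map_eq_some_iff] at hv
      obtain ⟨s, hs, rfl⟩ := hv
      have h3 := List.find?_some hs
      simp only [Bool.and_eq_true, decide_eq_true_eq] at h3
      obtain ⟨hsB, h4, h5⟩ := h3
      have hlt : Nat.pair e s < k := by
        by_contra hc
        rw [List.getElem?_eq_none (by simpa using hc)] at h4
        cases h4
      rw [initSeg_get _ _ _ hlt] at h4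
      simp only [Option.some.injEq, XA, decide_eq_false_iff_not] at h4
      have hp := Nat.right_le_pair e s
      have h6 : ¬ ∃ t, wantB h (Nat.pair e s) t = true := fun hw => h4 (hB _ (by omega) (by simp) hw)
      rw [wantB_iff] at h6
      simp only [Nat.unpair_pair] at h6
      push Not at h6
      by_cases hx : x ∈ HaltingSet
      · rw [kap_search (s0 := s+1) (fun t ht => ?_) le_rfl hx]
        · simp [chi, hx]
        · have := h6 t (by omega)
          have := hk e t
          omega
      · have h7 : ¬ KB (s+1) x = true := fun hc => hx (mem_K.2 ⟨_, hc⟩)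
        simp [chi, hx, h7]
end

theorem not_K_univ : ¬ TuringLEs HaltingSet Set.univ := by
  rintro ⟨c, hc⟩
  rw [chi_eq] at hc
  have h1 := turing_phi hc
  refine K_search (P := fun x s => (phi c.encode (List.replicate s true) x = some 0 ∨ KB s x = true)) ?_ ?_ ?_
  · exact ⟨inferInstance, Primrec.to_comp (by fun_prop)⟩
  · intro x
    by_cases hx : x ∈ HaltingSet
    · obtain ⟨s, hs⟩ := mem_K.1 hx
      exact ⟨s, Or.inr hs⟩
    · obtain ⟨k, hk⟩ := (h1 x).2
      refine ⟨k, Or.inl ?_⟩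
      have := hk k le_rfl
      simpa [initSeg, chi, hx] using this
  · rintro x s (hs | hs) hx
    · have := (h1 x).1 s 0 (by simpa [initSeg] using hs)
      simp [chi, hx] at this
    · exact hs

theorem Sg_K {α : Type} [Primcodable α] {f : α → ℕ} (hf : Primrec f) : Sg 0 (fun (a : α) (_ : Cantor) => f a ∈ HaltingSet) := by
  have h1 : Sg 0 (fun (p : α × ℕ) (_ : Cantor) => KB p.2 (f p.1) = true) := Sg.prim (by fun_prop)
  exact h1.ex.congr fun a X => mem_K

def corr (S : Set ℕ) (σ : List Bool) : Prop := (∀ n < σ.length, σ[n]? = some true → n ∈ S) ∧ ¬ ∃ n, σ[n]? = some false ∧ n ∈ S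

theorem corr_iff {S : Set ℕ} {σ : List Bool} : corr S σ ↔ σ = initSeg (fun n => decide (n ∈ S)) σ.length := by
  constructor
  · rintro ⟨h1, h2⟩
    apply List.ext_getElem?
    intro n
    by_cases hn : n < σ.length
    · rw [initSeg_get _ _ _ hn, List.getElem?_eq_getElem hn]
      have h1 := h1 n hn
      push Not at h2
      have h2 := h2 n
      rw [List.getElem?_eq_getElem hn] at h1 h2
      cases hb : σ[n] with
      | true => rw [hb] at h1; simp [h1 rfl]
      | false => rw [hb] at h2; simp [h2 rfl]
    · rw [List.getElem?_eq_none (by omega), List.getElem?_eq_none (by simpa using hn)]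
  · intro h
    constructor
    · intro n hn h3
      rw [h, initSeg_get _ _ _ hn] at h3
      simpa using h3
    · rintro ⟨n, h3, h4⟩
      have hn : n < σ.length := by
        by_contra hc
        rw [List.getElem?_eq_none (by omega)] at h3
        cases h3
      rw [h, initSeg_get _ _ _ hn] at h3
      simp [h4] at h3

theorem Sg_corr (u : CodeO) : Sg 1 (fun (σ : List Bool) X => corr (domSet u X) σ) := by
  have hd : Sg 0 (fun (p : List Bool × ℕ) X => p.2 ∈ domSet u X) :=
    (Sg_dom u).subst (f := fun p : List Bool × ℕ => p.2) (by fun_prop)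
  have h1 : Sg 0 (fun (p : List Bool × ℕ) (_ : Cantor) => ¬ p.1[p.2]? = some true) := Sg.prim (by fun_prop)
  have h2 : Sg 0 (fun (p : List Bool × ℕ) (_ : Cantor) => p.1[p.2]? = some false) := Sg.prim (by fun_prop)
  have h3 := ((h1.or hd).ball (f := fun σ : List Bool => σ.length) (by fun_prop)).lift.and (h2.and hd).ex.not
  refine h3.congr fun σ X => ?_
  simp only [corr, imp_iff_not_or]

theorem Sg_compl (u : CodeO) : Sg 3 (fun (_ : Unit) X => TuringLEs HaltingSet (domSet u X)) := by
  have h1 : Sg 1 (fun (p : ((Unit × ℕ) × ℕ) × List Bool) X => corr (domSet u X) p.2) :=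
    (Sg_corr u).subst (f := fun p : ((Unit × ℕ) × ℕ) × List Bool => p.2) (by fun_prop)
  have h2 : Sg 0 (fun (p : ((Unit × ℕ) × ℕ) × List Bool) (_ : Cantor) => phi p.1.1.2 p.2 p.1.2 = some 1) := Sg.prim (by fun_prop)
  have h3 : Sg 0 (fun (p : ((Unit × ℕ) × ℕ) × List Bool) (_ : Cantor) => phi p.1.1.2 p.2 p.1.2 = some 0) := Sg.prim (by fun_prop)
  have h4 : Sg 0 (fun (p : ((Unit × ℕ) × ℕ) × List Bool) (_ : Cantor) => p.1.2 ∈ HaltingSet) := Sg_K (by fun_prop)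
  have h5 := (h1.and ((h2.and h4).lift.or (h3.lift.and h4.not))).exT.not.ex.not.ex
  refine h5.congr fun a X => ?_
  dsimp only
  have e1 : ∀ e n : ℕ, (∃ σ, corr (domSet u X) σ ∧ (phi e σ n = some 1 ∧ n ∈ HaltingSet ∨ phi e σ n = some 0 ∧ n ∉ HaltingSet)) ↔
      ∃ k, phi e (initSeg (fun n => decide (n ∈ domSet u X)) k) n = some (chi HaltingSet n) := by
    intro e n
    have e2 : ∀ σ, (phi e σ n = some 1 ∧ n ∈ HaltingSet ∨ phi e σ n = some 0 ∧ n ∉ HaltingSet) ↔ phi e σ n = some (chi HaltingSet n) := by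
      intro σ
      by_cases hn : n ∈ HaltingSet <;> simp [hn, chi]
    simp only [e2, corr_iff]
    constructor
    · rintro ⟨σ, h, h'⟩
      rw [h] at h'
      exact ⟨_, h'⟩
    · rintro ⟨k, h⟩
      exact ⟨_, by simp, h⟩
  simp only [e1]
  push Not
  rw [TuringLEs, chi_eq (domSet u X)]
  constructor
  · rintro ⟨c, hc⟩
    refine ⟨c.encode, fun n => ?_⟩
    obtain ⟨k, hk⟩ := (turing_phi hc n).2
    exact ⟨k, hk k le_rfl⟩
  · rintro ⟨e, he⟩
    obtain ⟨c, rfl⟩ := encode_surj e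
    refine ⟨c, fun n => ?_⟩
    obtain ⟨k, hk⟩ := he n
    exact Part.eq_some_iff.2 (phi_sound hk)

set_option maxHeartbeats 2000000 in
theorem real3 {J : ℕ → Prop} (hJ : Sg 3 (fun (i : ℕ) (_ : Cantor) => J i)) :
    ∃ g : List Bool → ℕ → Bool, (Primrec fun p : List Bool × ℕ => g p.1 p.2) ∧
      ∀ Z, TuringLEs HaltingSet {n | ∃ k, g (initSeg Z k) n = true} ↔ Z ∈ DJ J := by
  obtain ⟨Q, hQ, e⟩ := hJ
  obtain ⟨h0, hh0, e0⟩ := hQ.EV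
  let h : ℕ → ℕ → ℕ → ℕ := fun i e t => min (h0 (i, e) t) (kap t)
  have hh : Primrec fun p : ℕ × ℕ × ℕ => h p.1 p.2.1 p.2.2 := by
    have h1 : Primrec fun p : ℕ × ℕ × ℕ => h0 (p.1, p.2.1) p.2.2 :=
      hh0.comp (g := fun p : ℕ × ℕ × ℕ => ((p.1, p.2.1), p.2.2)) (by fun_prop)
    exact fp_min h1 (by fun_prop)
  have hJ' : ∀ i, J i ↔ ∃ e, ¬ Rec (h i e) := by
    intro i
    refine (e i X0).trans ?_
    refine exists_congr fun k => not_congr ?_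
    rw [e0]
    constructor
    · rintro ⟨v, hv⟩
      refine rec_of_bdd (y := v) fun N => ?_
      obtain ⟨t, ht, e1⟩ := hv N
      exact ⟨t, ht, by dsimp only [h]; omega⟩
    · rintro ⟨v, hv⟩
      refine rec_of_bdd (y := v) fun N => ?_
      obtain ⟨N1, hN1⟩ := kap_unb v
      obtain ⟨t, ht, e1⟩ := hv (max N N1)
      have := hN1 t (by omega)
      exact ⟨t, by omega, by dsimp only [h] at e1; omega⟩
  have hmain : ∀ i, TuringLEf (chi HaltingSet) (oX (XA (wantB (h i)))) ↔ J i := by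
    intro i
    rw [hJ', thick_main (hh.comp (g := fun p : ℕ × ℕ => (i, p)) (by fun_prop)) fun e t => min_le_right _ _]
  have hW : Primrec fun p : ℕ × ℕ × ℕ => wantB (h p.1) p.2.1 p.2.2 := by
    unfold wantB; fun_prop
  have hst := fp_sts (W := fun i => wantB (h i)) hW
  have hst' : Primrec fun p : ℕ × ℕ => (sts (wantB (h p.1)) p.2).1 := Primrec.fst.comp hst
  let g : List Bool → ℕ → Bool := fun σ w => decide (w.unpair.1 ≤ σ.length) &&
    (lmem (sts (wantB (h (FF (σ.take w.unpair.1)))) σ.length).1 w.unpair.2 ||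
      (List.range (σ.length+1)).any fun k => decide (w.unpair.1 < k) && !decide (FF (σ.take k) = FF (σ.take w.unpair.1)))
  have hg : Primrec fun p : List Bool × ℕ => g p.1 p.2 := by
    have h1 : Primrec fun p : List Bool × ℕ => (sts (wantB (h (FF (p.1.take p.2.unpair.1)))) p.1.length).1 :=
      hst'.comp (g := fun p : List Bool × ℕ => (FF (p.1.take p.2.unpair.1), p.1.length)) (by fun_prop)
    exact fp_band (by fun_prop) (fp_bor (fp_lmem h1 (by fun_prop)) (by fun_prop))
  refine ⟨g, hg, fun Z => ?_⟩
  have hgZ : ∀ w : ℕ, (∃ k, g (initSeg Z k) w = true) ↔ (∃ t, InA (wantB (h (FF (initSeg Z w.unpair.1)))) t w.unpair.2) ∨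
      ∃ k > w.unpair.1, FF (initSeg Z k) ≠ FF (initSeg Z w.unpair.1) := by
    intro w
    simp only [g, length_initSeg, Bool.and_eq_true, Bool.or_eq_true, decide_eq_true_eq, List.any_eq_true, List.mem_range,
      Bool.not_eq_true', decide_eq_false_iff_not]
    constructor
    · rintro ⟨k, h1, h2 | ⟨k', h2, h3, h4⟩⟩
      · rw [initSeg_take Z h1] at h2
        exact Or.inl ⟨k, h2⟩
      · rw [initSeg_take Z h1, initSeg_take Z (by omega)] at h4
        exact Or.inr ⟨k', h3, h4⟩
    · rintro (⟨t, h2⟩ | ⟨k', h3, h4⟩)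
      · refine ⟨max t w.unpair.1, le_max_right _ _, Or.inl ?_⟩
        rw [initSeg_take Z (le_max_right _ _)]
        exact InA_mono (le_max_left _ _) h2
      · refine ⟨k', h3.le, Or.inr ⟨k', by omega, h3, ?_⟩⟩
        rwa [initSeg_take Z h3.le, initSeg_take Z le_rfl]
  by_cases hc : ∃ i, Cv Z i
  · obtain ⟨i, hi⟩ := hc
    have hD : Z ∈ DJ J ↔ J i := ⟨fun ⟨i', h1, h2⟩ => by rwa [Cv_uniq hi h2], fun h => ⟨i, h, hi⟩⟩
    rw [hD, ← hmain]
    obtain ⟨k0, hk0⟩ := hi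
    unfold TuringLEs
    rw [chi_eq {n | ∃ k, g (initSeg Z k) n = true}]
    set Y : Cantor := fun n => decide (n ∈ {n | ∃ k, g (initSeg Z k) n = true}) with hY
    have hYi : ∀ w, Y w = true ↔ ∃ k, g (initSeg Z k) w = true := fun w => by simp [hY]
    have hY1 : ∀ x, Y (Nat.pair k0 x) = XA (wantB (h i)) x := by
      intro x
      rw [Bool.eq_iff_iff, hYi, hgZ, XA_iff, Nat.unpair_pair]
      dsimp only
      rw [hk0 k0 le_rfl]
      refine ⟨?_, Or.inl⟩
      rintro (h1 | ⟨k, h1, h2⟩)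
      · exact h1
      · exact absurd (hk0 k (by omega)) h2
    have hY2 : ∃ T : List ℕ, ∀ w : ℕ, Y w = true ↔ w.unpair.1 ∈ T ∨ XA (wantB (h i)) w.unpair.2 = true := by
      have hf : {k0' | ∃ k > k0', FF (initSeg Z k) ≠ FF (initSeg Z k0')}.Finite := by
        refine (Set.finite_lt_nat k0).subset ?_
        rintro k1 ⟨k, h1, h2⟩
        by_contra hc
        simp only [Set.mem_ofPred_eq, not_lt] at hc
        exact h2 (by rw [hk0 k (by omega), hk0 k1 hc])
      refine ⟨hf.toFinset.toList, fun w => ?_⟩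
      rw [hYi, hgZ, XA_iff]
      simp only [Finset.mem_toList, Set.Finite.mem_toFinset, Set.mem_ofPred_eq]
      rw [or_comm]
      by_cases h1 : ∃ k > w.unpair.1, FF (initSeg Z k) ≠ FF (initSeg Z w.unpair.1)
      · simp only [h1, true_or]
      · have h2 : FF (initSeg Z w.unpair.1) = i := by
          push Not at h1
          rw [← h1 (max k0 (w.unpair.1 + 1)) (by omega), hk0 _ (le_max_left _ _)]
        simp only [h1, false_or, h2]
    constructor
    · intro hK
      obtain ⟨T, hT⟩ := hY2
      refine turing_trans hK ?_
      let F : List Bool → ℕ → Option ℕ := fun σ w => if (T.any fun y => decide (y = w.unpair.1)) = true then some 1 else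
        σ[w.unpair.2]?.map fun b => cond b 1 0
      have hF : Primrec fun p : List Bool × ℕ => F p.1 p.2 := by
        have h1 : Primrec fun y : ℕ => T.any fun z => decide (z = y) := by fun_prop
        have h2 : Primrec fun p : List Bool × ℕ => T.any fun z => decide (z = p.2.unpair.1) :=
          h1.comp (g := fun p : List Bool × ℕ => p.2.unpair.1) (by fun_prop)
        exact fp_ite (fp_dect h2) (by fun_prop) (by fun_prop)
      refine turing_of_approx hF ?_ ?_
      · intro w
        refine ⟨w.unpair.2 + 1, ?_⟩
        dsimp only [F]
        split_ifs
        · rfl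
        · rw [initSeg_get _ _ _ (by omega)]; rfl
      · intro w k v hv
        dsimp only [F] at hv
        have := hT w
        split_ifs at hv with h1
        · have h2 : w.unpair.1 ∈ T := by simpa using h1
          have h3 : Y w = true := this.2 (Or.inl h2)
          simp only [Option.some.injEq] at hv
          simp [oX, h3, ← hv]
        · have h2 : w.unpair.1 ∉ T := by simpa using h1
          by_cases hl : w.unpair.2 < k
          · rw [initSeg_get _ _ _ hl] at hv
            simp only [h2, false_or] at this
            have h3 : Y w = XA (wantB (h i)) w.unpair.2 := Bool.eq_iff_iff.2 this
            simp only [Option.map_some, Option.some.injEq] at hv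
            simp [oX, h3, ← hv]
          · rw [List.getElem?_eq_none (by simpa using hl)] at hv
            simp at hv
    · intro hK
      refine turing_trans hK ?_
      let F : List Bool → ℕ → Option ℕ := fun σ x => σ[Nat.pair k0 x]?.map fun b => cond b 1 0
      have hF : Primrec fun p : List Bool × ℕ => F p.1 p.2 := by dsimp only [F]; fun_prop
      refine turing_of_approx hF ?_ ?_
      · intro x
        refine ⟨Nat.pair k0 x + 1, ?_⟩
        dsimp only [F]
        rw [initSeg_get _ _ _ (by omega)]; rfl
      · intro x k v hv
        dsimp only [F] at hv
        by_cases hl : Nat.pair k0 x < k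
        · rw [initSeg_get _ _ _ hl, hY1] at hv
          simp only [Option.map_some, Option.some.injEq] at hv
          simp [oX, ← hv]
        · rw [List.getElem?_eq_none (by simpa using hl)] at hv
          simp at hv
  · have h1 : Z ∉ DJ J := fun ⟨i, _, h2⟩ => hc ⟨i, h2⟩
    have h2 : {n | ∃ k, g (initSeg Z k) n = true} = Set.univ := by
      ext w
      simp only [Set.mem_ofPred_eq, Set.mem_univ, iff_true]
      rw [hgZ]
      right
      by_contra h3
      push Not at h3
      exact hc ⟨FF (initSeg Z w.unpair.1), w.unpair.1 + 1, fun k hk => h3 k (by omega)⟩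
    rw [h2]
    exact ⟨fun h => absurd h not_K_univ, fun h => absurd h h1⟩

theorem compl_variance : ∃ u v : CodeO, UniversalOM u ∧ UniversalOM v ∧ TIncompReal (muR (COMPL u)) (muR (COMPL v)) :=
  om_variance (C := fun S => TuringLEs HaltingSet S) (by norm_num) Sg_compl fun _ hJ => real3 hJ

end RandProb

end

namespace RandProb

/-- **Turing degree variance of the probabilities of universal machines.**
For each of the considered probabilities (totality, infinitude, monotone infinity,
infinitary-machine infinity, cofiniteness, computability, completeness) there are two
universal machines of the corresponding type whose probabilities have Turing-incomparable
degrees. -/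
theorem degree_variance :
    (∃ u v : CodeO, UniversalOM u ∧ UniversalOM v ∧
        TIncompReal (muR (TOT u)) (muR (TOT v))) ∧
    (∃ u v : CodeO, UniversalOM u ∧ UniversalOM v ∧
        TIncompReal (muR (INF u)) (muR (INF v))) ∧
    (∃ U V : MonoMachine, UniversalMono U ∧ UniversalMono V ∧
        TIncompReal (muR (MonoINF U)) (muR (MonoINF V))) ∧
    (∃ U V : InfMachine, UniversalInf U ∧ UniversalInf V ∧
        TIncompReal (muR (cyl U.INF)) (muR (cyl V.INF))) ∧
    (∃ u v : CodeO, UniversalOM u ∧ UniversalOM v ∧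
        TIncompReal (muR (COF u)) (muR (COF v))) ∧
    (∃ u v : CodeO, UniversalOM u ∧ UniversalOM v ∧
        TIncompReal (muR (COM u)) (muR (COM v))) ∧
    (∃ u v : CodeO, UniversalOM u ∧ UniversalOM v ∧
        TIncompReal (muR (COMPL u)) (muR (COMPL v))) := by
  exact ⟨tot_variance, inf_variance, mono_variance, infm_variance, cof_variance, com_variance,
    compl_variance⟩

end RandProb
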